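/- arXiv:1804.00990 — 2 statements merged into one kernel-verified Lean document; each statement's English description precedes it below -/
import Mathlib

section
/- For every non-negative integer s, the GL_5-invariant subspace of (QP_5)_{15·2^s − 5} is zero; equivalently, every homogeneous polynomial f ∈ P_5 of degree 15·2^s − 5 such that g·f + f is hit for every g ∈ GL_5 is itself hit. -/
open MvPolynomial

noncomputable section

/-- `P n` is the polynomial algebra `F_2[x_1, …, x_n]`, with `x_{k+1}` corresponding to
the variable indexed by `k : Fin n`. -/
abbrev P (n : ℕ) : Type := MvPolynomial (Fin n) (ZMod 2)

/-- The total Steenrod square, the ring homomorphism determined by `x_i ↦ x_i + x_i^2`. -/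
def sqTot (n : ℕ) : P n →ₐ[ZMod 2] P n := bind₁ fun i => X i + X i ^ 2

/-- The Steenrod square `Sq^k`: on a homogeneous polynomial of degree `d` it is the
homogeneous component of degree `d + k` of the total square, extended additively. -/
def SqK (n k : ℕ) (f : P n) : P n :=
  ∑ d ∈ Finset.range (f.totalDegree + 1),
    homogeneousComponent (d + k) (sqTot n (homogeneousComponent d f))

/-- `A^+ P_n = Σ_{j ≥ 1} Sq^j(P_n)`, the submodule of hit polynomials. -/
def hitS (n : ℕ) : Submodule (ZMod 2) (P n) :=
  Submodule.span (ZMod 2) {g | ∃ j, 1 ≤ j ∧ ∃ h, g = SqK n j h}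

/-- `A_s^+ P_n = Σ_{1 ≤ j < 2^s} Sq^j(P_n)`. -/
def AplusS (n s : ℕ) : Submodule (ZMod 2) (P n) :=
  Submodule.span (ZMod 2) {g | ∃ j, 1 ≤ j ∧ j < 2 ^ s ∧ ∃ h, g = SqK n j h}

/-- Degree of a monomial given by its exponent vector. -/
def mdeg {n : ℕ} (a : Fin n →₀ ℕ) : ℕ := ∑ j, a j

/-- The weight vector of a monomial, zero-based: `wt a i = ω_{i+1}(x) = Σ_j α_i(a_j)`. -/
def wt {n : ℕ} (a : Fin n →₀ ℕ) (i : ℕ) : ℕ := ∑ j, a j / 2 ^ i % 2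

/-- Left-lexicographic strict order on weight vectors. -/
def lexLt (w w' : ℕ → ℕ) : Prop := ∃ i, (∀ j, j < i → w j = w' j) ∧ w i < w' i

def lexLe (w w' : ℕ → ℕ) : Prop := w = w' ∨ lexLt w w'

/-- `P_n^-(ω)`: span of monomials of degree `D = deg ω` with weight vector `< ω`. -/
def PnLt (n D : ℕ) (w : ℕ → ℕ) : Submodule (ZMod 2) (P n) :=
  Submodule.span (ZMod 2)
    {p | ∃ a : Fin n →₀ ℕ, mdeg a = D ∧ lexLt (wt a) w ∧ p = monomial a 1}

/-- `P_n(ω)`: span of monomials of degree `D = deg ω` with weight vector `≤ ω`. -/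
def PnLe (n D : ℕ) (w : ℕ → ℕ) : Submodule (ZMod 2) (P n) :=
  Submodule.span (ZMod 2)
    {p | ∃ a : Fin n →₀ ℕ, mdeg a = D ∧ lexLe (wt a) w ∧ p = monomial a 1}

/-- The order on monomials (of a common degree): first by weight vector, then by
exponent vector, both left-lexicographically. -/
def monLt {n : ℕ} (a b : Fin n →₀ ℕ) : Prop :=
  lexLt (wt a) (wt b) ∨
    (wt a = wt b ∧ ∃ j : Fin n, (∀ k, k < j → a k = b k) ∧ a j < b j)

/-- A monomial is inadmissible if it is congruent, modulo hit elements, to a sum of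
strictly smaller monomials of the same degree. -/
def Inadmissible {n : ℕ} (a : Fin n →₀ ℕ) : Prop :=
  ∃ S : Finset (Fin n →₀ ℕ), (∀ b ∈ S, mdeg b = mdeg a ∧ monLt b a) ∧
    ((monomial a 1 : P n) + ∑ b ∈ S, monomial b 1) ∈ hitS n

def Admissible {n : ℕ} (a : Fin n →₀ ℕ) : Prop := ¬ Inadmissible a

/-- Strict inadmissibility: with `s` the top of the weight vector, the monomial is
congruent to a sum of smaller monomials modulo `A_s^+ P_n`. -/
def StrictlyInadmissible {n : ℕ} (a : Fin n →₀ ℕ) : Prop :=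
  ∃ s : ℕ, 1 ≤ s ∧ wt a (s - 1) ≠ 0 ∧ (∀ i, s ≤ i → wt a i = 0) ∧
    ∃ S : Finset (Fin n →₀ ℕ), (∀ b ∈ S, mdeg b = mdeg a ∧ monLt b a) ∧
      ((monomial a 1 : P n) + ∑ b ∈ S, monomial b 1) ∈ AplusS n s

/-- Exponent vector from a tuple of exponents. -/
def ev {n : ℕ} (v : Fin n → ℕ) : Fin n →₀ ℕ := Finsupp.equivFunOnFinite.symm v

/-- `ν_k(x)`, the exponent of the (1-based) variable `x_k` in a monomial. -/
def nuE {m : ℕ} (b : Fin m →₀ ℕ) (k : ℕ) : ℕ := if h : k - 1 < m then b ⟨k - 1, h⟩ else 0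

/-- `u`-compatibility of a monomial of `P_{n-1}` with a pair `(i; I)` (only `I` matters);
by convention every monomial is `1`-compatible with `(i; ∅)`. -/
def uCompat {m : ℕ} (I : List ℕ) (u : ℕ) (b : Fin m →₀ ℕ) : Prop :=
  if I = [] then u = 1 else
    1 ≤ u ∧ u ≤ I.length ∧
    (∀ t, 1 ≤ t → t < u → nuE b (I.getD (t - 1) 0 - 1) = 2 ^ I.length - 1) ∧
    2 ^ I.length - 1 < nuE b (I.getD (u - 1) 0 - 1) ∧
    (∀ t, 1 ≤ t → t ≤ u → Nat.testBit (nuE b (I.getD (u - 1) 0 - 1)) (I.length - t) = true) ∧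
    (∀ t, u < t → t ≤ I.length → Nat.testBit (nuE b (I.getD (t - 1) 0 - 1)) (I.length - t) = true)

/-- The exponent vector of `x_{(I,u)} = x_{i_u}^{2^{r-1}+⋯+2^{r-u}} Π_{u<t≤r} x_{i_t}^{2^{r-t}}`. -/
def xIuExp (n : ℕ) (I : List ℕ) (u : ℕ) : Fin n → ℕ := fun k =>
  (if I.getD (u - 1) 0 = (k : ℕ) + 1 then 2 ^ I.length - 2 ^ (I.length - u) else 0) +
  ∑ t ∈ Finset.Icc (u + 1) I.length,
    if I.getD (t - 1) 0 = (k : ℕ) + 1 then 2 ^ (I.length - t) else 0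

/-- The variable substitution underlying `f_i : P_{n-1} → P_n` (`x_j ↦ x_j` for `j < i`,
`x_j ↦ x_{j+1}` for `j ≥ i`, in 1-based labels). -/
def fIdx (n i : ℕ) (j : Fin (n - 1)) : Fin n :=
  if (j : ℕ) + 1 < i then ⟨j, by have := j.isLt; omega⟩
  else ⟨(j : ℕ) + 1, by have := j.isLt; omega⟩

open Classical in
/-- `φ_{(i;I)}` evaluated on the monomial of `P_{n-1}` with exponent vector `b`:
`(x_i^{2^r - 1} f_i(x)) / x_{(I,u)}` if `x` is `u`-compatible with `(i;I)` for some `u`,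
and `0` otherwise.  Here `i` and the entries of `I` are 1-based variable labels. -/
def phiMon (n i : ℕ) (I : List ℕ) (b : Fin (n - 1) →₀ ℕ) : P n :=
  if h : ∃ u, uCompat I u b then
    monomial (ev fun k : Fin n =>
      (if (k : ℕ) + 1 = i then 2 ^ I.length - 1 else 0) +
        Finsupp.mapDomain (fIdx n i) b k - xIuExp n I (Classical.choose h) k) 1
  else 0

/-- Exponent vector of `X^e = (x_1 ⋯ x_m)^e` in `P_m`. -/
def Xexp (m e : ℕ) : Fin m →₀ ℕ := ev fun _ => e

/-- `X_u^e = (Π_{j ≠ u} x_j)^e` in `P_n` (`u` 1-based). -/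
def XjMon (n u e : ℕ) : P n := monomial (ev fun k : Fin n => if (k : ℕ) + 1 = u then 0 else e) 1

/-- `x_u^e` in `P_n` (`u` 1-based). -/
def xvMon (n u e : ℕ) : P n := monomial (ev fun k : Fin n => if (k : ℕ) + 1 = u then e else 0) 1

/-- The weight vector `((n-1)^{(d)}, 1)` (zero-based indexing). -/
def wSpike (n d : ℕ) : ℕ → ℕ := fun i => if i < d then n - 1 else if i = d then 1 else 0

/-- Kameko's map `ψ : P_5 → P_5`, `x_1x_2x_3x_4x_5 · y^2 ↦ y` on monomials, `0` otherwise. -/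
def psi : P 5 →ₗ[ZMod 2] P 5 :=
  (basisMonomials (Fin 5) (ZMod 2)).constr (ZMod 2) fun a =>
    if ∀ j, Odd (a j) then monomial (Finsupp.mapRange (· / 2) (Nat.zero_div 2) a) 1 else 0

/-- The Σ₅-invariant subspace of a subspace `V` of `QP_5 = P_5 / A^+P_5`: classes in `V`
having a representative `f` with `[σ · f] = [f]` for all permutations `σ` of the variables. -/
def invSub (V : Submodule (ZMod 2) (P 5 ⧸ hitS 5)) : Submodule (ZMod 2) (P 5 ⧸ hitS 5) where
  carrier := {q | q ∈ V ∧ ∃ f : P 5, (hitS 5).mkQ f = q ∧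
      ∀ σ : Equiv.Perm (Fin 5), (hitS 5).mkQ (rename (⇑σ) f) = q}
  add_mem' := by
    rintro a b ⟨haV, f, hf, hfa⟩ ⟨hbV, g, hg, hgb⟩
    refine ⟨V.add_mem haV hbV, f + g, ?_, fun σ => ?_⟩
    · simp [map_add, hf, hg]
    · simp [map_add, hfa σ, hgb σ]
  zero_mem' := ⟨V.zero_mem, 0, by simp, fun σ => by simp⟩
  smul_mem' := by
    rintro c a ⟨haV, f, hf, hfa⟩
    refine ⟨V.smul_mem c haV, c • f, ?_, fun σ => ?_⟩
    · simp [map_smul, hf]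
    · simp [map_smul, hfa σ]

/-- The maps `ρ_1, …, ρ_5` generating the action of `GL_5` on `P_5`:
`ρ_i` (for `1 ≤ i ≤ 4`) swaps `x_i, x_{i+1}`; `ρ_5` sends `x_1 ↦ x_1 + x_2`. -/
def rho5 (i : ℕ) : P 5 → P 5 := fun f =>
  if i = 1 then rename (⇑(Equiv.swap (0 : Fin 5) 1)) f
  else if i = 2 then rename (⇑(Equiv.swap (1 : Fin 5) 2)) f
  else if i = 3 then rename (⇑(Equiv.swap (2 : Fin 5) 3)) f
  else if i = 4 then rename (⇑(Equiv.swap (3 : Fin 5) 4)) f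
  else if i = 5 then MvPolynomial.aeval (R := ZMod 2)
    (fun j : Fin 5 => if j = 0 then X 0 + X 1 else X j) f
  else f

/-- The action of an invertible matrix on `P_5` by linear substitution of the variables. -/
def glAct (g : Matrix (Fin 5) (Fin 5) (ZMod 2)) (f : P 5) : P 5 :=
  MvPolynomial.aeval (R := ZMod 2) (fun i : Fin 5 => ∑ j : Fin 5, g i j • X j) f

/-- The weight vector `(3,3,4)` (zero-based indexing). -/
def w334 : ℕ → ℕ := fun i => if i = 0 then 3 else if i = 1 then 3 else if i = 2 then 4 else 0

/-- The weight vector `(3,3,2,1)` (zero-based indexing). -/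
def w3321 : ℕ → ℕ := fun i =>
  if i = 0 then 3 else if i = 1 then 3 else if i = 2 then 2 else if i = 3 then 1 else 0

/-! ### Generic hit submodules -/

def hG {K : Type*} [CommRing K]
    (S : MvPolynomial (Fin 5) K →ₐ[K] MvPolynomial (Fin 5) K) :
    Submodule K (MvPolynomial (Fin 5) K) :=
  Submodule.span K {g | ∃ (a : Fin 5 →₀ ℕ) (k : ℕ), 1 ≤ k ∧
    g = homogeneousComponent (a.degree + k) (S (monomial a 1))}

theorem hG_homog {K : Type*} [CommRing K]
    (S : MvPolynomial (Fin 5) K →ₐ[K] MvPolynomial (Fin 5) K)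
    {D k : ℕ} (hk : 1 ≤ k) {h : MvPolynomial (Fin 5) K} (hh : h.IsHomogeneous D) :
    homogeneousComponent (D + k) (S h) ∈ hG S := by
  rw [h.as_sum, map_sum, map_sum]
  refine Submodule.sum_mem _ fun a ha => ?_
  have hd : a.degree = D := by
    have := hh (mem_support_iff.1 ha)
    rw [Finsupp.degree_eq_weight_one]
    exact this
  have : monomial a (coeff a h) = coeff a h • (monomial a 1 : MvPolynomial (Fin 5) K) := by
    rw [smul_monomial, smul_eq_mul, mul_one]
  rw [this, map_smul, map_smul]
  exact Submodule.smul_mem _ _ (Submodule.subset_span ⟨a, k, hk, by rw [hd]⟩)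

theorem hitS_eq : hitS 5 = hG (sqTot 5) := by
  apply le_antisymm
  · refine Submodule.span_le.2 ?_
    rintro g ⟨j, hj, h, rfl⟩
    refine Submodule.sum_mem _ fun d _ => ?_
    exact hG_homog _ hj (homogeneousComponent_isHomogeneous d h)
  · refine Submodule.span_le.2 ?_
    rintro g ⟨a, k, hk, rfl⟩
    refine Submodule.subset_span ⟨k, hk, monomial a 1, ?_⟩
    have hm : (monomial a (1 : ZMod 2)).IsHomogeneous a.degree := isHomogeneous_monomial 1 rfl
    unfold SqK
    rw [Finset.sum_eq_single a.degree]
    · rw [homogeneousComponent_of_mem hm, if_pos rfl]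
    · intro b _ hb
      rw [homogeneousComponent_of_mem hm, if_neg hb, map_zero, map_zero]
    · intro h
      exfalso
      apply h
      rw [hm.totalDegree (by simp)]
      simp

/-- linear substitution by a matrix -/
def glA {K : Type*} [CommRing K] (A : Matrix (Fin 5) (Fin 5) K) :
    MvPolynomial (Fin 5) K →ₐ[K] MvPolynomial (Fin 5) K :=
  aeval fun i => ∑ j, A i j • X j

theorem glA_X {K : Type*} [CommRing K] (A : Matrix (Fin 5) (Fin 5) K) (i : Fin 5) :
    glA A (X i) = ∑ j, A i j • X j := by simp [glA]

theorem glA_mul {K : Type*} [CommRing K] (A B : Matrix (Fin 5) (Fin 5) K) :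
    (glA A).comp (glA B) = glA (B * A) := by
  apply algHom_ext
  intro i
  simp only [AlgHom.comp_apply, glA_X, map_sum, map_smul, Matrix.mul_apply, Finset.smul_sum,
    Finset.sum_smul, smul_smul]
  rw [Finset.sum_comm]

theorem glA_one {K : Type*} [CommRing K] :
    glA (1 : Matrix (Fin 5) (Fin 5) K) = AlgHom.id K _ := by
  apply algHom_ext
  intro i
  simp [glA_X, Matrix.one_apply]

theorem glA_homog {K : Type*} [CommRing K] (A : Matrix (Fin 5) (Fin 5) K)
    {D : ℕ} {h : MvPolynomial (Fin 5) K} (hh : h.IsHomogeneous D) :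
    (glA A h).IsHomogeneous D := by
  have := hh.aeval (R := K) (g := fun i => ∑ j, A i j • (X j : MvPolynomial (Fin 5) K)) (n := 1)
    (fun i => ?_)
  · rwa [one_mul] at this
  · refine IsHomogeneous.sum _ _ _ fun j _ => ?_
    exact Submodule.smul_mem (homogeneousSubmodule (Fin 5) K 1) _ (isHomogeneous_X K j)

theorem glA_comp {K : Type*} [CommRing K] (A : Matrix (Fin 5) (Fin 5) K)
    (n : ℕ) (h : MvPolynomial (Fin 5) K) :
    homogeneousComponent n (glA A h) = glA A (homogeneousComponent n h) := by
  conv_lhs => rw [← sum_homogeneousComponent h, map_sum, map_sum]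
  simp only [fun i => homogeneousComponent_of_mem (m := n)
    (glA_homog A (homogeneousComponent_isHomogeneous i h))]
  rw [Finset.sum_ite_eq]
  split_ifs with hn
  · rfl
  · rw [homogeneousComponent_eq_zero, map_zero]
    simpa using hn

theorem glA_hG {K : Type*} [CommRing K] (A : Matrix (Fin 5) (Fin 5) K)
    (S S' : MvPolynomial (Fin 5) K →ₐ[K] MvPolynomial (Fin 5) K)
    (hS : (glA A).comp S = S'.comp (glA A)) {g : MvPolynomial (Fin 5) K} (hg : g ∈ hG S) :
    glA A g ∈ hG S' := by
  induction hg using Submodule.span_induction with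
  | mem x hx =>
    obtain ⟨a, k, hk, rfl⟩ := hx
    rw [← glA_comp]
    have : glA A (S (monomial a 1)) = S' (glA A (monomial a 1)) := DFunLike.congr_fun hS _
    rw [this]
    exact hG_homog _ hk (glA_homog A (isHomogeneous_monomial 1 rfl))
  | zero => simp
  | add x y _ _ hx hy => rw [map_add]; exact add_mem hx hy
  | smul c x _ hx => rw [map_smul]; exact Submodule.smul_mem _ _ hx

theorem glAct_eq (g : Matrix (Fin 5) (Fin 5) (ZMod 2)) (f : P 5) : glAct g f = glA g f := rfl

/-! ### Base change and Singer coordinates -/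

def sqK (K : Type*) [CommRing K] : MvPolynomial (Fin 5) K →ₐ[K] MvPolynomial (Fin 5) K :=
  aeval fun i => X i + X i ^ 2

def sqZ (K : Type*) [CommRing K] : MvPolynomial (Fin 5) K →ₐ[K] MvPolynomial (Fin 5) K :=
  aeval fun i => X i + X (i - 1) ^ 2

theorem homComp_map {A B : Type*} [CommRing A] [CommRing B] (φ : A →+* B) (n : ℕ)
    (p : MvPolynomial (Fin 5) A) :
    homogeneousComponent n (map φ p) = map φ (homogeneousComponent n p) := by
  ext e
  simp only [coeff_homogeneousComponent, coeff_map]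
  split_ifs <;> simp

theorem map_sqTot (K : Type*) [CommRing K] [Algebra (ZMod 2) K] (p : P 5) :
    map (algebraMap (ZMod 2) K) (sqTot 5 p) = sqK K (map (algebraMap (ZMod 2) K) p) := by
  induction p using MvPolynomial.induction_on with
  | C a => simp [sqTot, sqK]
  | add p q hp hq => simp only [map_add, hp, hq]
  | mul_X p i hp => simp only [map_mul, hp]; simp [sqTot, sqK]

theorem map_hG (K : Type*) [CommRing K] [Algebra (ZMod 2) K] {p : P 5} (hp : p ∈ hG (sqTot 5)) :
    map (algebraMap (ZMod 2) K) p ∈ hG (sqK K) := by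
  induction hp using Submodule.span_induction with
  | mem x hx =>
    obtain ⟨a, k, hk, rfl⟩ := hx
    rw [← homComp_map, map_sqTot]
    exact hG_homog _ hk (by simpa using isHomogeneous_monomial (1 : K) rfl)
  | zero => simp
  | add x y _ _ hx hy => rw [map_add]; exact add_mem hx hy
  | smul c x _ hx =>
    rw [smul_eq_C_mul, map_mul, map_C, ← smul_eq_C_mul]; exact Submodule.smul_mem _ _ hx

theorem descend (K : Type*) [Field K] [Algebra (ZMod 2) K] {f : P 5}
    (hf : map (algebraMap (ZMod 2) K) f ∈ hG (sqK K)) : f ∈ hG (sqTot 5) := by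
  by_contra hn
  obtain ⟨l, hl, hker⟩ := Submodule.exists_le_ker_of_notMem hn
  let L : MvPolynomial (Fin 5) K →ₗ[K] K := (basisMonomials (Fin 5) K).constr K
    fun a => algebraMap (ZMod 2) K (l (monomial a 1))
  have hLm : ∀ a, L (monomial a 1) = algebraMap (ZMod 2) K (l (monomial a 1)) := fun a => by
    have := (basisMonomials (Fin 5) K).constr_basis K
      (fun a => algebraMap (ZMod 2) K (l (monomial a 1))) a
    rwa [coe_basisMonomials] at this
  have hL : ∀ p : P 5, L (map (algebraMap (ZMod 2) K) p) = algebraMap (ZMod 2) K (l p) := by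
    intro p
    induction p using MvPolynomial.induction_on' with
    | monomial a c =>
      have h1 : (monomial a (algebraMap (ZMod 2) K c)) =
          algebraMap (ZMod 2) K c • (monomial a (1 : K)) := by
        rw [smul_monomial, smul_eq_mul, mul_one]
      have h2 : (monomial a c) = c • (monomial a (1 : ZMod 2)) := by
        rw [smul_monomial, smul_eq_mul, mul_one]
      rw [map_monomial, h1, map_smul, hLm, h2, map_smul, smul_eq_mul, smul_eq_mul, map_mul]
    | add p q hp hq => simp only [map_add, hp, hq]
  have hz : ∀ g ∈ hG (sqK K), L g = 0 := by
    intro g hg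
    induction hg using Submodule.span_induction with
    | mem x hx =>
      obtain ⟨a, k, hk, rfl⟩ := hx
      have : (monomial a (1 : K)) = map (algebraMap (ZMod 2) K) (monomial a 1) := by simp
      rw [this, ← map_sqTot, homComp_map, hL]
      have h0 : l (homogeneousComponent (a.degree + k) (sqTot 5 (monomial a 1))) = 0 :=
        hker (Submodule.subset_span ⟨a, k, hk, rfl⟩)
      rw [h0, map_zero]
    | zero => simp
    | add x y _ _ hx hy => rw [map_add, hx, hy, add_zero]
    | smul c x _ hx => rw [map_smul, hx, smul_zero]
  have := hz _ hf
  rw [hL] at this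
  exact hl (by simpa using this)

theorem map_glA (K : Type*) [CommRing K] [Algebra (ZMod 2) K]
    (g : Matrix (Fin 5) (Fin 5) (ZMod 2)) (p : P 5) :
    map (algebraMap (ZMod 2) K) (glA g p) =
      glA (g.map (algebraMap (ZMod 2) K)) (map (algebraMap (ZMod 2) K) p) := by
  induction p using MvPolynomial.induction_on with
  | C a => simp [glA]
  | add p q hp hq => simp only [map_add, hp, hq]
  | mul_X p i hp =>
    simp only [map_mul, hp, map_X, glA_X, map_sum, smul_eq_C_mul, map_C, Matrix.map_apply]

def gL : Matrix (Fin 5) (Fin 5) (ZMod 2) :=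
  !![0, 0, 0, 0, 1; 1, 0, 0, 0, 0; 0, 1, 0, 0, 1; 0, 0, 1, 0, 0; 0, 0, 0, 1, 0]
def hL : Matrix (Fin 5) (Fin 5) (ZMod 2) :=
  !![0, 1, 0, 0, 0; 1, 0, 1, 0, 0; 0, 0, 0, 1, 0; 0, 0, 0, 0, 1; 1, 0, 0, 0, 0]
def gS : Matrix (Fin 5) (Fin 5) (ZMod 2) :=
  !![1, 0, 0, 0, 1; 0, 0, 0, 1, 0; 0, 1, 0, 0, 1; 0, 0, 0, 1, 1; 0, 0, 1, 0, 0]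
def hS : Matrix (Fin 5) (Fin 5) (ZMod 2) :=
  !![1, 1, 0, 1, 0; 0, 1, 1, 1, 0; 0, 0, 0, 0, 1; 0, 1, 0, 0, 0; 0, 1, 0, 1, 0]
def gU : Matrix (Fin 5) (Fin 5) (ZMod 2) :=
  !![1, 0, 1, 0, 0; 0, 1, 0, 0, 1; 0, 1, 0, 1, 1; 0, 0, 1, 1, 0; 0, 1, 1, 0, 0]
def hU : Matrix (Fin 5) (Fin 5) (ZMod 2) :=
  !![1, 1, 1, 1, 0; 0, 1, 1, 1, 1; 0, 1, 1, 1, 0; 0, 1, 1, 0, 0; 0, 0, 1, 1, 1]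

def uL : Matrix.GeneralLinearGroup (Fin 5) (ZMod 2) :=
  ⟨gL, hL, by decide +kernel, by decide +kernel⟩
def uS : Matrix.GeneralLinearGroup (Fin 5) (ZMod 2) :=
  ⟨gS, hS, by decide +kernel, by decide +kernel⟩
def uU : Matrix.GeneralLinearGroup (Fin 5) (ZMod 2) :=
  ⟨gU, hU, by decide +kernel, by decide +kernel⟩

/-- the operators in Singer coordinates -/
def mL {K : Type*} [CommRing K] (ζ : K) : Matrix (Fin 5) (Fin 5) K :=
  Matrix.diagonal fun i => ζ ^ (33 ^ (i : ℕ))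
def mS (K : Type*) [CommRing K] : Matrix (Fin 5) (Fin 5) K :=
  fun i j => if j = i + 1 then 1 else 0
def mU (K : Type*) [CommRing K] : Matrix (Fin 5) (Fin 5) K :=
  fun i j => (if j = i then 1 else 0) + (if j = i + 1 then 1 else 0) + (if j = i + 2 then 1 else 0)

section coords
set_option linter.unusedSectionVars false
variable {K : Type*} [Field K] [Algebra (ZMod 2) K]

theorem idL (z : K) (hz : z ^ 5 = z ^ 2 + 1) (k : Fin 5) :
    ∑ j : Fin 5, z ^ (j : ℕ) * algebraMap (ZMod 2) K (gL j k) = z ^ ((k : ℕ) + 1) := by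
  fin_cases k <;> simp [Fin.sum_univ_five, gL]
  linear_combination -hz

theorem idS (z : K) (hz : z ^ 5 = z ^ 2 + 1) (k : Fin 5) :
    ∑ j : Fin 5, z ^ (j : ℕ) * algebraMap (ZMod 2) K (gS j k) = z ^ (2 * (k : ℕ)) := by
  have h6 : z ^ 6 = z ^ 3 + z := by linear_combination z * hz
  have h8 : z ^ 8 = z ^ 3 + z ^ 2 + 1 := by linear_combination z ^ 3 * hz + hz
  fin_cases k <;> simp [Fin.sum_univ_five, gS]
  · linear_combination -h6
  · linear_combination -h8

theorem z12 (h2 : (2 : K) = 0) (z : K) (hz : z ^ 5 = z ^ 2 + 1) :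
    z ^ 12 = z ^ 3 + z ^ 2 + z := by
  have h6 : z ^ 6 = z ^ 3 + z := by linear_combination z * hz
  linear_combination (z ^ 6 + z ^ 3 + z) * h6 + h6 + z ^ 4 * h2

theorem z16 (h2 : (2 : K) = 0) (z : K) (hz : z ^ 5 = z ^ 2 + 1) :
    z ^ 16 = z ^ 4 + z ^ 3 + z + 1 := by
  have h6 : z ^ 6 = z ^ 3 + z := by linear_combination z * hz
  have h8 : z ^ 8 = z ^ 3 + z ^ 2 + 1 := by linear_combination z ^ 3 * hz + hz
  linear_combination (z ^ 8 + z ^ 3 + z ^ 2 + 1) * h8 + h6 + (z ^ 5 + z ^ 3 + z ^ 2) * h2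

theorem z32 (h2 : (2 : K) = 0) (z : K) (hz : z ^ 5 = z ^ 2 + 1) : z ^ 32 = z := by
  have h6 : z ^ 6 = z ^ 3 + z := by linear_combination z * hz
  have h8 : z ^ 8 = z ^ 3 + z ^ 2 + 1 := by linear_combination z ^ 3 * hz + hz
  linear_combination (z ^ 16 + z ^ 4 + z ^ 3 + z + 1) * z16 h2 z hz + h6 + h8 +
    (z ^ 7 + z ^ 5 + z ^ 4 * 2 + z ^ 3 * 2 + z + 1 + z ^ 2) * h2

theorem idU (h2 : (2 : K) = 0) (z : K) (hz : z ^ 5 = z ^ 2 + 1) (k : Fin 5) :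
    ∑ j : Fin 5, z ^ (j : ℕ) * algebraMap (ZMod 2) K (gU j k) =
      z ^ (k : ℕ) + z ^ (2 * (k : ℕ)) + z ^ (4 * (k : ℕ)) := by
  have h6 : z ^ 6 = z ^ 3 + z := by linear_combination z * hz
  have h8 : z ^ 8 = z ^ 3 + z ^ 2 + 1 := by linear_combination z ^ 3 * hz + hz
  have h12 := z12 h2 z hz
  have h16 := z16 h2 z hz
  fin_cases k <;> simp [Fin.sum_univ_five, gU]
  · linear_combination h2
  · linear_combination -h8 - z ^ 2 * h2
  · linear_combination -h6 - h12 - (z ^ 3 + z) * h2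
  · linear_combination -h8 - h16 - (z ^ 4 + z ^ 3 + 1) * h2

/-- the conjugates of the Singer generator -/
def zc (ζ : K) (i : Fin 5) : K := ζ ^ (2 ^ (i : ℕ))

def vM (ζ : K) : Matrix (Fin 5) (Fin 5) K := Matrix.vandermonde (zc ζ)

theorem zc_root (h2 : (2 : K) = 0) (ζ : K) (hz : ζ ^ 5 = ζ ^ 2 + 1) (i : Fin 5) :
    zc ζ i ^ 5 = zc ζ i ^ 2 + 1 := by
  have key : ∀ w : K, w ^ 5 = w ^ 2 + 1 → (w ^ 2) ^ 5 = (w ^ 2) ^ 2 + 1 := fun w hw => by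
    linear_combination (w ^ 5 + w ^ 2 + 1) * hw + w ^ 2 * h2
  have : ∀ n : ℕ, (ζ ^ (2 ^ n)) ^ 5 = (ζ ^ (2 ^ n)) ^ 2 + 1 := by
    intro n
    induction n with
    | zero => simpa using hz
    | succ n ih => rw [pow_succ 2 n, pow_mul]; exact key _ ih
  exact this _

theorem zc_succ (h2 : (2 : K) = 0) (ζ : K) (hz : ζ ^ 5 = ζ ^ 2 + 1) (i : Fin 5) :
    zc ζ (i + 1) = zc ζ i ^ 2 := by
  have h := z32 h2 ζ hz
  fin_cases i <;> simp [zc, ← pow_mul]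
  exact h.symm

theorem zeta_ne {ζ : K} (hz : ζ ^ 5 = ζ ^ 2 + 1) : ζ ≠ 0 := by
  rintro rfl
  simp at hz

theorem zeta31 (h2 : (2 : K) = 0) (ζ : K) (hz : ζ ^ 5 = ζ ^ 2 + 1) : ζ ^ 31 = 1 := by
  have h := z32 h2 ζ hz
  have h0 := zeta_ne hz
  apply mul_right_cancel₀ h0
  rw [← pow_succ, one_mul]
  exact h

theorem zeta_ord (h2 : (2 : K) = 0) (ζ : K) (hz : ζ ^ 5 = ζ ^ 2 + 1) : orderOf ζ = 31 := by
  have : Fact (Nat.Prime 31) := ⟨by norm_num⟩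
  apply orderOf_eq_prime (zeta31 h2 ζ hz)
  rintro rfl
  have : (1 : K) = 0 := by linear_combination -hz
  exact one_ne_zero this

theorem zc_inj (h2 : (2 : K) = 0) (ζ : K) (hz : ζ ^ 5 = ζ ^ 2 + 1) :
    Function.Injective (zc ζ) := by
  intro i j hij
  unfold zc at hij
  have hp := IsPrimitiveRoot.orderOf ζ
  rw [zeta_ord h2 ζ hz] at hp
  have hlt : ∀ k : Fin 5, 2 ^ (k : ℕ) < 31 := by decide
  have := Nat.pow_right_injective le_rfl (hp.pow_inj (hlt i) (hlt j) hij)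
  exact Fin.ext this

theorem vM_det (h2 : (2 : K) = 0) (ζ : K) (hz : ζ ^ 5 = ζ ^ 2 + 1) : IsUnit (vM ζ).det :=
  (Matrix.det_vandermonde_ne_zero_iff.2 (zc_inj h2 ζ hz)).isUnit

theorem intL (h2 : (2 : K) = 0) (ζ : K) (hz : ζ ^ 5 = ζ ^ 2 + 1) :
    mL ζ * vM ζ = vM ζ * gL.map (algebraMap (ZMod 2) K) := by
  ext i k
  rw [Matrix.mul_apply, Matrix.mul_apply]
  simp only [vM, Matrix.vandermonde_apply, Matrix.map_apply]
  rw [idL _ (zc_root h2 ζ hz i)]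
  have : ζ ^ (33 ^ (i : ℕ)) = zc ζ i := by
    unfold zc
    have h := pow_mod_orderOf ζ (33 ^ (i : ℕ))
    rw [zeta_ord h2 ζ hz, Nat.pow_mod] at h
    have h' := pow_mod_orderOf ζ (2 ^ (i : ℕ))
    rw [zeta_ord h2 ζ hz] at h'
    rw [← h, ← h']
  simp [mL, Matrix.diagonal_apply, this, pow_succ']

theorem intS (h2 : (2 : K) = 0) (ζ : K) (hz : ζ ^ 5 = ζ ^ 2 + 1) :
    mS K * vM ζ = vM ζ * gS.map (algebraMap (ZMod 2) K) := by
  ext i k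
  rw [Matrix.mul_apply, Matrix.mul_apply]
  simp only [vM, Matrix.vandermonde_apply, Matrix.map_apply]
  rw [idS _ (zc_root h2 ζ hz i)]
  simp [mS, zc_succ h2 ζ hz, ← pow_mul]

theorem intU (h2 : (2 : K) = 0) (ζ : K) (hz : ζ ^ 5 = ζ ^ 2 + 1) :
    mU K * vM ζ = vM ζ * gU.map (algebraMap (ZMod 2) K) := by
  ext i k
  rw [Matrix.mul_apply, Matrix.mul_apply]
  simp only [vM, Matrix.vandermonde_apply, Matrix.map_apply]
  rw [idU h2 _ (zc_root h2 ζ hz i)]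
  have h : zc ζ (i + 2) = zc ζ i ^ 4 := by
    rw [show i + 2 = (i + 1) + 1 by rw [add_assoc]; rfl, zc_succ h2 ζ hz, zc_succ h2 ζ hz, ← pow_mul]
  simp [mU, add_mul, Finset.sum_add_distrib, zc_succ h2 ζ hz, h, ← pow_mul]

theorem intSq (h2 : (2 : K) = 0) (ζ : K) (hz : ζ ^ 5 = ζ ^ 2 + 1) :
    (glA (vM ζ)).comp (sqZ K) = (sqK K).comp (glA (vM ζ)) := by
  have : CharP (MvPolynomial (Fin 5) K) 2 := by
    have : CharP K 2 := CharTwo.of_one_ne_zero_of_two_eq_zero one_ne_zero h2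
    infer_instance
  apply algHom_ext
  intro i
  have hi : zc ζ i = zc ζ (i - 1) ^ 2 := by rw [← zc_succ h2 ζ hz, sub_add_cancel]
  simp only [AlgHom.comp_apply, sqZ, sqK, aeval_X, map_add, map_pow, glA_X, map_sum, map_smul,
    smul_add, Finset.sum_add_distrib]
  congr 1
  rw [CharTwo.sum_sq]
  refine Finset.sum_congr rfl fun j _ => ?_
  rw [smul_pow, vM, Matrix.vandermonde_apply, Matrix.vandermonde_apply, hi, ← pow_mul, ← pow_mul,
    mul_comm]

/-- Transfer of the problem to Singer coordinates. -/
theorem transfer (h2 : (2 : K) = 0) (ζ : K) (hz : ζ ^ 5 = ζ ^ 2 + 1) (d : ℕ)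
    (main : ∀ F : MvPolynomial (Fin 5) K, F.IsHomogeneous d →
      glA (mL ζ) F + F ∈ hG (sqZ K) → glA (mS K) F + F ∈ hG (sqZ K) →
      glA (mU K) F + F ∈ hG (sqZ K) → F ∈ hG (sqZ K))
    (f : P 5) (hf : f.IsHomogeneous d)
    (hinv : ∀ g : Matrix.GeneralLinearGroup (Fin 5) (ZMod 2),
      glAct (↑g) f + f ∈ hitS 5) : f ∈ hitS 5 := by
  rw [hitS_eq] at *
  apply descend K
  set fK := map (algebraMap (ZMod 2) K) f
  have hV := vM_det h2 ζ hz
  have hVV : vM ζ * (vM ζ)⁻¹ = 1 := Matrix.mul_nonsing_inv _ hV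
  have hVV' : (vM ζ)⁻¹ * vM ζ = 1 := Matrix.nonsing_inv_mul _ hV
  have hinvl : ∀ q, glA (vM ζ)⁻¹ (glA (vM ζ) q) = q := fun q => by
    have := DFunLike.congr_fun (glA_mul (vM ζ)⁻¹ (vM ζ)) q
    rw [hVV, glA_one] at this
    exact this
  have hinvr : ∀ q, glA (vM ζ) (glA (vM ζ)⁻¹ q) = q := fun q => by
    have := DFunLike.congr_fun (glA_mul (vM ζ) (vM ζ)⁻¹) q
    rw [hVV', glA_one] at this
    exact this
  have hcomm : (glA (vM ζ)⁻¹).comp (sqK K) = (sqZ K).comp (glA (vM ζ)⁻¹) := by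
    apply AlgHom.ext
    intro q
    have := DFunLike.congr_fun (intSq h2 ζ hz) (glA (vM ζ)⁻¹ q)
    simp only [AlgHom.comp_apply, hinvr] at this ⊢
    rw [← this, hinvl]
  have step : ∀ (g : Matrix.GeneralLinearGroup (Fin 5) (ZMod 2)) (m : Matrix (Fin 5) (Fin 5) K),
      m * vM ζ = vM ζ * (g : Matrix (Fin 5) (Fin 5) (ZMod 2)).map (algebraMap (ZMod 2) K) →
      glA m (glA (vM ζ)⁻¹ fK) + glA (vM ζ)⁻¹ fK ∈ hG (sqZ K) := by
    intro g m hm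
    have h1 := map_hG K (hinv g)
    rw [map_add, glAct_eq, map_glA] at h1
    have h2 := glA_hG _ _ _ hcomm h1
    rw [map_add] at h2
    have e1 := DFunLike.congr_fun (glA_mul m (vM ζ)⁻¹) fK
    have e2 := DFunLike.congr_fun
      (glA_mul (vM ζ)⁻¹ ((g : Matrix (Fin 5) (Fin 5) (ZMod 2)).map (algebraMap (ZMod 2) K))) fK
    simp only [AlgHom.comp_apply] at e1 e2
    rw [e2] at h2
    rw [e1]
    have e3 : (vM ζ)⁻¹ * m = (g : Matrix (Fin 5) (Fin 5) (ZMod 2)).map (algebraMap (ZMod 2) K) * (vM ζ)⁻¹ := by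
      calc (vM ζ)⁻¹ * m = (vM ζ)⁻¹ * (m * vM ζ) * (vM ζ)⁻¹ := by
            rw [Matrix.mul_assoc, Matrix.mul_assoc, hVV, Matrix.mul_one]
        _ = _ := by rw [hm, ← Matrix.mul_assoc, hVV', Matrix.one_mul]
    rw [e3]
    exact h2
  have hF := main (glA (vM ζ)⁻¹ fK) (glA_homog _ (hf.map _))
    (step uL (mL ζ) (intL h2 ζ hz)) (step uS (mS K) (intS h2 ζ hz)) (step uU (mU K) (intU h2 ζ hz))
  have := glA_hG _ _ _ (intSq h2 ζ hz) hF
  rwa [hinvr] at this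

end coords
def lamL10 : ℕ := 0x6d01006c01058402000000000000000000000000000000002b01002a0109e70200000000000004ae0104ad010000000000000edc020e4a02000000000000000000000000
def lamP10 : ℕ := 29
def disL10 : ℕ := 0x700020000000000000001000000000000000000000000000000000000000000000000000000000000000000000000000000000000000000000000000000000000000000010000000000000000000000000000000200000000000000000000000000000000000000000000000000000000000000000007000000000000000000000000000000000000000000030000000000000000000100000000000000000000000b0007000500000000000000000000000000000000000000060003000000000000000000000000000000000000000000000000000000000000000000000000000000000000000000000000000000000000000000000000000000050002000000020000000000000000000000000000000000000000000100000000000000000000000e000000000000000000000000000000000000000000000006000000010000000000010000000000000000000000000000000000000000000000000000000000000000000d000b0005000000000000000000000000000000000003000200000000000000000000000000000000000000000000000000000000000000000000000000000000000000090004000700000000000000000000000000000000000100000000000200000000000000000000000000000000000000000000000000000000000000000000000000080003000000060005000100000000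
def sltL10 : ℕ := 0x3000000000000000000000000000004000000000400000007000000000002000000000700000000060001000001000000000300000006010005000006000000000006000000030403000005050604030704050701070100050000
def rhoB10 : ℕ := 256
def rhoP10 : ℕ := 157

def ords10 : List ℕ := [7224426, 1299210, 2445962, 2412234, 1331946, 8304714, 2444970, 2379498]

def steps10 : List (List ℕ) := [[78271777], [77224225, 78304514], [42655009], [79352066], [79384803], [115034308]]

def lamL25 : ℕ := 0x20b81e0000000000000000000000000000000000000000000000000000000000000000000000000000000000000000000000000000000000000000000000000000003d05493d040f00000000000000000000000000000000000000000000000000000000000000000000000000000000000000000000000017d4de00000000000000000000000000000000000000000000000000000000000017c97917c84b17c7b417c61f0000000000000000000000000000000f04bd0f031a0f02870f01de0f00bd000000000000000000000000000000063e59063d7900000000000017b2de00000000000000000000000000000000000000000000000000000000000017a78600000017a5ff17a4e017a3ff0000000000000000000000000ee2bd0ee1520ee0520edf430edebd000000000000000000000000061db6061cef061b7900000000000000000000000000000000000000000000000000000000000000000000000000000000000000000000000000000000000013226113216113201e0000000000000ebf200ebebd0ebd9d0000000000000a5cbd0a5bbd00000000000000000000000000000000000000000000000033cf4933ce5433cd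120000000000000000000000000000000000000000000000002b082b00000000000000000000000012fe1e0000000000002244cf00000000000000000000000000000000000000000000000000000000000000000000000000000000000000000033ac460000000000000000000000000000000000000000000000000000000000000000000000000000000000000000000e7dde0000000000000000000000000000000000000000000000000000000000000000000e71a60e706b000000000000000000000000338a7f00000000000005ac2b05ab0b00000005a9de0000000000000000000000000000000000000000000000000000000e5bde0000000000000000000000000000000000000000000000000000000000000e50a60000000e4e6b0000000e4ce0000000000000000000000000000000058a200000000588de0000000586200000000000000000000000000000000000000000000000000000000000000000000000000000000000000000000000000000000000000000000e2e400e2d400000000e2b210e2a3f0000000000000000000000000000000000000000000000000000000000000000000000000000000000000000000000000000000000000000000000000000000000002a765400000000000000000000000000000000000000000021b2e40e0a210000000e083f0000000000000000000000000000000000000000000000000000000000000000000000000000000000000000000000000000000000000000000000002a56490000002a54460000000000000000000000000000000000002191e42190e4218f2b0000000000000000000000000000000000000525de18cbcf0000000000000000000000000000000000000000000000000000000000000519cd0000000000000000000000002a331200000000000000000000000025d07f000000000000216fe40000000000000000000000000000000000000000000504de000000000000000000000000000000000000000000467e0f467d4900000000000004f8a604f76b00000000000004f4e0000000000000000000000000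000000000000000000000000000000000000000000000000000000000000000000000000000000000000000000000000000000000000000000000000000000465c4600000000000004d71200000004d51200000000000000744000734000000000712100703f0000000000000000000000000000000000000000000000000000000000000000000000000000000000000000000000002120cd211f4b211ee0211dff000000000000000000000000000000000000185ad51859d51858fe000000000000005021000000004e3f0f96ef0f95b60f947900000000000000000000000000000000000000000006d02000000000000000000000000000000020fe8600000020fc1f00000020faff0000000000000000000000000000000000000000001836fe0000000000000000000000000000000f74590000000f727900000000000000000000000000000000000000000006ae2000000000000000000000000000000020dc6120db6120da1e0000000000000000000000000000000000000000000000000000000000000000000000000000000000000000000000000000000000000000000000000000000000003d2646000000000000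
def lamP25 : ℕ := 559
def disL25 : ℕ := 0x350079001f0022000d00130075005d0043000d002f0019004d003f004b007b0066006b00160011005b008f008b0034001b000b001200470011009f00cd003b0017004300410032005c000e0052003a001000710065002b001f0003007f0047000b005f004a000d00240000008c0089001d002e0053007f0043002700d300ce00570013006100310014000600180049007a00350001003b001500490053001b00250002008300620022001a003a0062004400410017007a00430040003b000d0089002d009400b500590056002b0050003f0080008e00970034002e000e003e0048003b002f00330017003400080030001b001200250061007700370010005d00420020002c00f3002300420052001f003e00370009008600830031004a0022002500ad0055001d0043000900130011007e001f0036000200210027003500290046001f0024001e00e5007f001b0008000b003600230021005900890088002900da003a0037002a0051006d00470025004f001c006a0061007b005200260044004a00000008001c001a00150045001c00200040000f0013004300160053003d0003001c00b10033006f005d00050027003900680032001f001800600062004f002a002e001c00290023002f003b000900290035003f002f0007004d00330013002f00410007001d00cf003d005c0011000d0015003c002900740056000b0004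
def sltL25 : ℕ := 0x1b1c0000029000006b7a1200712a7c4f002c00006f0000008400790065008d003333925c3b00000025190000007a8c00000078273b970051008f004d7500004f004b000002016400002c4c5a00000057612b00000d150000180b04009600004595007a007f00784a00840000600076008d002e0098002505557a004576003f96000001003a792426670000004e000000000d2a00006c5a00000000000300005338000000001f00001d8a5b038f8400410000004339646a000b0000008c0075000762005b008100007600003e7b113a382d00428e0e00640019820000646b0000241700004b1b4d000000506c7b3b86663270009100007f3600003f00590000995d000022294f00006e29433d34002b004f7e00000c6d230c88008e00989100008537197c890e2a89007d0d0018205c540008524661006d001452001a43694b00170000211f0089360000052356537500489585008c740e0007005d3f2f005b00003c97998e0032460c72004595546e000024502685022988713809001d924c004a480000433f0550007800003044830062326500151e000012493727473d784e727599006f004b0000171c006a86395c4d7d00060074616180924491965f9200744c2700562800003a630000327c7a4d005590007587050000623c468d061f00618b002e81000f5e2d006c0082030068002b480030007600582f5919883a8f3b0000701c34005e2e6f004a00006a681a609113000050231f2c0000007652004612870772005e24005571265d0731950a8331790030109800312936425d000000695b840016915560008662147d005b740000687f80000000938e4f008b5f0a878b0022281b002081000064003c0430604999000000002f003e4921464d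4a6e002685732190900700932d6d7e0093093c06532912528a870096477d00504213887366008d77202577110e630058061e000088002a541a0048702a1b0022031c000001928a0500217e5c006f7b100000677c6069380097570000005d00816b4e873100560070675c00278f6c2f203e163930397e4909002f8d6d08373879451d73777b415a252815472b0183005a70638e9057998a6f3e745571287f65680679516639430a471b2c1f34671d7f0b40898f186e585a96243a356b026c000d2b80331680985e41584a346b35093782627265934e8c7d13772283257c8b65573d58419777941711173d5702860d146a42131c16350b73443404483540286a1e1466222e69084432400a476e63310c042710164c0f2653330e4083688b405f4c591069089785378c72111a8201861915716d593d49350098115f54933c821d892c3e203f3b365467411e5312665f524b362e0c031a214463510842815e04730b0f183356592d78808a7b1e23455110564e090f95511413840a7e150f2d231800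
def rhoB25 : ℕ := 256
def rhoP25 : ℕ := 1021

def ords25 : List ℕ := [13232505, 4066425, 5146713, 4099161, 3673593, 7586041, 15671833, 3821401, 9958905, 11104665, 14280057, 15425817, 5179449, 9500601, 9779353, 7798329, 8878617, 2396889, 4819353, 26163225, 2953401, 1349337, 2429625, 21351033, 3018873, 2462361, 19190457, 4868953, 21383769, 2446489, 1905849, 19157721, 11039193, 2495097, 9991641, 14312793, 5180441, 15491289, 14345529, 1414809, 5213177, 6293465, 12005401, 14378265, 11939929, 16604313, 4786617, 12152217, 12184953, 13265241, 14379257, 13199769, 5113977, 3706329, 2560569, 1480281, 8454041, 4968153, 6014713, 7340025, 7274553, 7405497, 9566073, 9599801, 12119481, 2527833, 3640857, 2593305, 2626041, 6227001, 9567065, 18077433, 14591545, 2741113, 13085689, 9533337, 9812089, 3854137, 2708377, 7406489, 7341017, 1316601, 3739065, 8354841, 1873113, 2986137, 1513017, 6505753, 10711833, 20238009, 20270745, 4100153, 7373753, 3674585, 4033689, 6194265, 4934425, 4999897, 6113913, 16752121, 10859641, 3608121, 1447545, 6325209, 9598809, 1382073, 3919609, 11907193, 11071929, 10826905, 15458553,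 8485785, 6080185, 4901689, 6259737, 5212185, 6260729, 16784857, 17865145, 3788665, 9746617, 13297977, 10892377, 8420313, 6048441, 8666329, 8699065, 10893369, 2773849, 7225945, 2806585, 13298969, 8387577, 15492281, 8518521, 11972665, 3707321, 6292473, 7307289, 7193209, 8421305, 11973657, 4967161, 7372761, 8486777, 6081177, 5000889, 8453049, 6114905, 6047449, 3886873, 17832409, 6112921, 5981977]

def steps25 : List (List ℕ) := [[320845538], [355414754], [459122402], [493691618], [165807842], [304084706], [47434466], [534742568], [569311784], [85342760], [154481192], [310566440], [379704872], [51821096], [86390312], [155528744], [190097960], [87437864], [123054632], [39250472], [199018024], [78549544], [417482218], [115279338], [354334465], [130158337], [355382017], [493658881], [165775105], [304051969], [494706433], [45306625], [166822657], [201391873], [305099521], [461184769], [308242177], [49496833], [153204481], [312972033], [314019585], [348588801], [89843457], [424553186], [391031522], [531403490], [82003682], [49529570], [84098786], [118668002], [89876194], [194631394], [78353122], [306211554], [238120674], [307259106], [425633475], [426681027], [117653187], [118700739], [79433411], [203585188], [84164260], [160127652], [194696868], [92036772], [161175204], [309453414], [345070182], [380686950], [39184998], [121974343], [79564359], [50773544],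 [119911976], [275997224], [345135656], [380752424], [191145512], [40298024], [233587240], [304820776], [116261416], [131205889], [235961089], [123365121], [131238626], [269515490], [201424610], [270563042], [307227362], [538228450], [349669090], [573877955], [46452388], [202537636], [307292836], [117685924], [125558436], [385351332], [420968100], [162222756], [196791972], [273836646], [196857446], [232474214], [233521766], [268090982], [200344321], [537148161], [571717377], [122317569], [347541249], [425600738], [349701827], [273771172], [155429540], [117652194], [278402817], [155364066], [126573251], [231361188], [232408740], [88795905], [496866018], [90956483], [272723620], [119812772], [120925798], [121973350], [233554503], [268123719], [269482753], [125460225], [194598657, 272658146], [235993826], [230248162], [273738435], [273803909], [231393925], [117406186], [193583842, 195744420], [124445410], [197839524], [197904998], [269204008]]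
def kM : ℕ := 39135392

def allLt (p : ℕ → Bool) (n : ℕ) : Bool :=
  Nat.rec true (fun m ih => cond (p m) ih false) n

/-- factors for `(X_i + X_{i-1}^2)^a`: pairs (key increment, degree increment) -/
def facs (n : ℕ) : ℕ → ℕ → ℕ → List (ℕ × ℕ) → List (ℕ × ℕ) :=
  Nat.rec (fun _ _ _ r => r) (fun _ ih D h a r =>
    cond (Nat.beq (Nat.mod a 2) 1)
      ((D, h) :: ih (Nat.mul 2 D) (Nat.mul 2 h) (Nat.div a 2) r)
      (ih (Nat.mul 2 D) (Nat.mul 2 h) (Nat.div a 2) r)) n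

/-- XOR over the terms of `Sq^k`. -/
def val (leaf : ℕ → ℕ) (fs : List (ℕ × ℕ)) : ℕ → ℕ → ℕ :=
  List.rec (fun k κ => cond (Nat.beq k 0) (leaf κ) 0)
    (fun f _ ih k κ => cond (Nat.beq k 0) (leaf κ)
      (Nat.xor (ih k κ) (cond (Nat.ble f.2 k) (ih (Nat.sub k f.2) (Nat.add κ f.1)) 0))) fs

def key5 (a0 a1 a2 a3 a4 : ℕ) : ℕ :=
  Nat.add a0 (Nat.mul 33 (Nat.add a1 (Nat.mul 33 (Nat.add a2 (Nat.mul 33 (Nat.add a3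
    (Nat.mul 33 a4)))))))

def facs5 (a0 a1 a2 a3 a4 : ℕ) : List (ℕ × ℕ) :=
  facs 5 2371841 1 a0 (facs 5 39135361 1 a1 (facs 5 39134369 1 a2 (facs 5 39101633 1 a3
    (facs 5 38021345 1 a4 []))))

def lamT (L p w x : ℕ) : ℕ :=
  cond (Nat.beq (Nat.mod x 31) w)
    ((fun s q => cond (Nat.beq (Nat.mod (Nat.div s 256) 65536) q) (Nat.mod s 256) 0)
      (Nat.shiftRight L (Nat.mul 24 (Nat.mod (Nat.div x 992) p))) (Nat.div x 992))
    0

def funChk1 (T : ℕ → ℕ) (d a0 a1 a2 a3 a4 : ℕ) : Bool :=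
  (fun t => cond (Nat.ble d t) true
  (Nat.beq (val (fun κ => T (Nat.mod κ kM)) (facs5 a0 a1 a2 a3 a4) (Nat.sub d t)
    (key5 a0 a1 a2 a3 a4)) 0)) (Nat.add a0 (Nat.add a1 (Nat.add a2 (Nat.add a3 a4))))

def enumA (p : ℕ → ℕ → ℕ → ℕ → ℕ → Bool) (D w : ℕ) : Bool :=
  allLt (fun a4 => allLt (fun a3 => allLt (fun a2 => allLt (fun a1 =>
    p (Nat.mod (Nat.add w (Nat.mul 30 (key5 0 a1 a2 a3 a4))) 31) a1 a2 a3 a4)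
    (Nat.sub (Nat.sub (Nat.sub D a4) a3) a2)) (Nat.sub (Nat.sub D a4) a3)) (Nat.sub D a4)) D

def rhoI (DL SL nb p x : ℕ) : ℕ :=
  (fun q => Nat.mod (Nat.shiftRight SL (Nat.mul 8 (Nat.mod (Nat.mul (Nat.add (Nat.div q nb) 1)
    (Nat.mod (Nat.shiftRight DL (Nat.mul 16 (Nat.mod q nb))) 65536)) p))) 256) (Nat.div x 992)

def orbChk1 (R : ℕ → ℕ) (O : List ℕ) (d a0 a1 a2 a3 a4 : ℕ) : Bool :=
  cond (Nat.beq (Nat.add a0 (Nat.add a1 (Nat.add a2 (Nat.add a3 a4)))) d)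
    ((fun i => cond (Nat.ble (Nat.succ i) O.length)
      ((fun o => Nat.beq o (key5 a0 a1 a2 a3 a4) || (Nat.beq o (key5 a4 a0 a1 a2 a3) ||
        (Nat.beq o (key5 a3 a4 a0 a1 a2) || (Nat.beq o (key5 a2 a3 a4 a0 a1) ||
          Nat.beq o (key5 a1 a2 a3 a4 a0))))) (O.getD i 0)) false)
      (R (Nat.mod (key5 a0 a1 a2 a3 a4) kM)))
    true

def dg (κ i : ℕ) : ℕ := Nat.mod (Nat.div κ (Nat.pow 33 i)) 33

def genOk (d g : ℕ) : Bool :=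
  Nat.ble 1 (Nat.mod g 32) && (Nat.beq (Nat.add (dg (Nat.div g 32) 0) (Nat.add (dg (Nat.div g 32) 1)
    (Nat.add (dg (Nat.div g 32) 2) (Nat.add (dg (Nat.div g 32) 3)
      (Nat.add (dg (Nat.div g 32) 4) (Nat.mod g 32)))))) d &&
    Nat.beq (Nat.mod (key5 (dg (Nat.div g 32) 0) (dg (Nat.div g 32) 1) (dg (Nat.div g 32) 2)
      (dg (Nat.div g 32) 3) (dg (Nat.div g 32) 4)) 31) 0)

def genVal (R : ℕ → ℕ) (g : ℕ) : ℕ :=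
  val (fun κ => Nat.shiftLeft 1 (R (Nat.mod κ kM)))
    (facs5 (dg (Nat.div g 32) 0) (dg (Nat.div g 32) 1) (dg (Nat.div g 32) 2)
      (dg (Nat.div g 32) 3) (dg (Nat.div g 32) 4)) (Nat.mod g 32)
    (key5 (dg (Nat.div g 32) 0) (dg (Nat.div g 32) 1) (dg (Nat.div g 32) 2)
      (dg (Nat.div g 32) 3) (dg (Nat.div g 32) 4))

def xorAll (f : ℕ → ℕ) (l : List ℕ) : ℕ := List.rec 0 (fun g _ ih => Nat.xor (f g) ih) l

def stepChk (R : ℕ → ℕ) (d : ℕ) (st : List (List ℕ)) : ℕ → Bool :=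
  List.rec (fun _ => true) (fun l _ ih i =>
    cond (l.all (genOk d)) (cond (Nat.beq (Nat.shiftRight (xorAll (genVal R) l) i) 1)
      (ih (Nat.succ i)) false) false) st

def facsU (n : ℕ) : ℕ → ℕ → ℕ → List (ℕ × ℕ) → List (ℕ × ℕ) :=
  Nat.rec (fun _ _ _ r => r) (fun _ ih D E a r =>
    cond (Nat.beq (Nat.mod a 2) 1)
      ((D, E) :: ih (Nat.mul 2 D) (Nat.mul 2 E) (Nat.div a 2) r)
      (ih (Nat.mul 2 D) (Nat.mul 2 E) (Nat.div a 2) r)) n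

def force (f : ℕ → ℕ) (κ : ℕ) : ℕ := Nat.rec (f 0) (fun n _ => f (Nat.succ n)) κ

def valU (leaf : ℕ → ℕ) (fs : List (ℕ × ℕ)) : ℕ → ℕ :=
  List.rec leaf (fun f _ ih κ =>
    Nat.xor (ih κ) (Nat.xor (force ih (Nat.add κ f.1)) (force ih (Nat.add κ f.2)))) fs

def facsU5 (a0 a1 a2 a3 a4 : ℕ) : List (ℕ × ℕ) :=
  facsU 5 32 1088 a0 (facsU 5 1056 35904 a1 (facsU 5 34848 1184832 a2
    (facsU 5 1149984 39099456 a3 (facsU 5 37949472 37949504 a4 []))))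

def leafU (T : ℕ → ℕ) (κ : ℕ) : ℕ :=
  (fun r => cond (Nat.beq r 7) (T (Nat.mod κ kM))
    (cond (Nat.beq r 19) (T (Nat.mod (Nat.mul 33 κ) kM))
    (cond (Nat.beq r 25) (T (Nat.mod (Nat.mul 1089 κ) kM))
    (cond (Nat.beq r 28) (T (Nat.mod (Nat.mul 35937 κ) kM))
    (cond (Nat.beq r 14) (T (Nat.mod (Nat.mul 1185921 κ) kM)) 0))))) (Nat.mod κ 31)

def uChk1 (T : ℕ → ℕ) (o j : ℕ) : Bool :=
  Nat.beq (valU (leafU T) (facsU5 (dg o 0) (dg o 1) (dg o 2) (dg o 3) (dg o 4)) o)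
    (Nat.shiftLeft 1 j)

def uChk (T : ℕ → ℕ) (O : List ℕ) (n : ℕ) : Bool := allLt (fun j => uChk1 T (O.getD j 0) j) n


theorem fun25 : enumA (funChk1 (lamT lamL25 lamP25 7) 25) 25 7 = true := by decide +kernel
theorem orb25 : enumA (orbChk1 (rhoI disL25 sltL25 rhoB25 rhoP25) ords25 25) 26 0 = true := by
  decide +kernel
theorem step25 : stepChk (rhoI disL25 sltL25 rhoB25 rhoP25) 25 steps25 8 = true := by
  decide +kernel
theorem u25 : uChk (lamT lamL25 lamP25 7) ords25 8 = true := by decide +kernel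
theorem orb10 : enumA (orbChk1 (rhoI disL10 sltL10 rhoB10 rhoP10) ords10 10) 11 0 = true := by
  decide +kernel
theorem step10 : stepChk (rhoI disL10 sltL10 rhoB10 rhoP10) 10 steps10 2 = true := by
  decide +kernel
theorem u10 : uChk (lamT lamL10 lamP10 7) ords10 2 = true := by decide +kernel
theorem fun10 : enumA (funChk1 (lamT lamL10 lamP10 7) 10) 10 7 = true := by decide +kernel
/-! ### Semantics of the checks -/

theorem val_nil (leaf : ℕ → ℕ) (k κ : ℕ) :
    val leaf [] k κ = if k = 0 then leaf κ else 0 := by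
  cases k <;> rfl

theorem val_zero (leaf : ℕ → ℕ) (fs : List (ℕ × ℕ)) (κ : ℕ) : val leaf fs 0 κ = leaf κ := by
  cases fs <;> rfl

theorem val_cons (leaf : ℕ → ℕ) (f : ℕ × ℕ) (fs : List (ℕ × ℕ)) (k κ : ℕ) (hk : k ≠ 0) :
    val leaf (f :: fs) k κ =
      Nat.xor (val leaf fs k κ) (if f.2 ≤ k then val leaf fs (k - f.2) (κ + f.1) else 0) := by
  obtain ⟨k, rfl⟩ := Nat.exists_eq_succ_of_ne_zero hk
  by_cases h : f.2 ≤ k + 1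
  · have h' : Nat.ble f.2 (k + 1) = true := by
      rw [Nat.ble_eq]; exact h
    simp only [Nat.succ_eq_add_one, if_pos h]
    change Nat.xor _ (cond (Nat.ble f.2 (k + 1)) _ _) = _
    rw [h']
    rfl
  · have h' : Nat.ble f.2 (k + 1) = false := by
      rw [← Bool.not_eq_true, Nat.ble_eq]; exact h
    simp only [Nat.succ_eq_add_one, if_neg h]
    change Nat.xor _ (cond (Nat.ble f.2 (k + 1)) _ _) = _
    rw [h']
    rfl

theorem force_eq (f : ℕ → ℕ) (κ : ℕ) : force f κ = f κ := by cases κ <;> rfl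

theorem valU_cons (leaf : ℕ → ℕ) (f : ℕ × ℕ) (fs : List (ℕ × ℕ)) (κ : ℕ) :
    valU leaf (f :: fs) κ = Nat.xor (valU leaf fs κ)
      (Nat.xor (valU leaf fs (κ + f.1)) (valU leaf fs (κ + f.2))) := by
  change Nat.xor _ (Nat.xor (force (valU leaf fs) (κ + f.1)) (force (valU leaf fs) (κ + f.2))) = _
  rw [force_eq, force_eq]
  rfl

theorem facs_succ (n D h a : ℕ) (r : List (ℕ × ℕ)) :
    facs (n + 1) D h a r = if a % 2 = 1 then (D, h) :: facs n (2 * D) (2 * h) (a / 2) r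
      else facs n (2 * D) (2 * h) (a / 2) r := by
  rcases Nat.mod_two_eq_zero_or_one a with h' | h'
  · rw [if_neg (by omega)]
    change cond (Nat.beq (a % 2) 1) _ _ = _
    rw [h']; rfl
  · rw [if_pos h']
    change cond (Nat.beq (a % 2) 1) _ _ = _
    rw [h']; rfl

theorem facsU_eq : facsU = facs := rfl

def keyE (e : Fin 5 →₀ ℕ) : ℕ := key5 (e 0) (e 1) (e 2) (e 3) (e 4)

theorem key5_eq (a b c d e : ℕ) :
    key5 a b c d e = a + 33 * b + 1089 * c + 35937 * d + 1185921 * e := by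
  simp only [key5, Nat.add_eq, Nat.mul_eq]; ring

theorem keyE_add (e f : Fin 5 →₀ ℕ) : keyE (e + f) = keyE e + keyE f := by
  simp only [keyE, key5_eq, Finsupp.add_apply]; ring

theorem keyE_zero : keyE 0 = 0 := by simp [keyE, key5_eq]

theorem keyE_single (i : Fin 5) (n : ℕ) : keyE (Finsupp.single i n) = n * 33 ^ (i : ℕ) := by
  fin_cases i <;> simp [keyE, key5_eq, mul_comm]

section sem
variable {K : Type*} [Field K] {V : Type*} [AddCommGroup V] [Module K V]

/-- exponents pairs -/
abbrev EP := (Fin 5 →₀ ℕ) × (Fin 5 →₀ ℕ)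

def RelE (f : ℕ × ℕ) (p : EP) : Prop :=
  keyE p.1 + f.1 ≡ keyE p.2 [MOD kM] ∧ p.2.degree = p.1.degree + f.2 ∧ 1 ≤ f.2 ∧ f.1 % 31 = 0

def pr (K : Type*) [Field K] (es : List EP) : MvPolynomial (Fin 5) K :=
  (es.map fun p => monomial p.1 (1 : K) + monomial p.2 1).prod

def sa (es : List EP) : Fin 5 →₀ ℕ := (es.map Prod.fst).sum

theorem pr_cons (p : EP) (es : List EP) (γ : Fin 5 →₀ ℕ) :
    monomial γ 1 * pr K (p :: es) =
      monomial (γ + p.1) 1 * pr K es + monomial (γ + p.2) 1 * pr K es := by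
  have h : ∀ a b : Fin 5 →₀ ℕ, (monomial (a + b) (1 : K)) = monomial a 1 * monomial b 1 := by
    intro a b; rw [monomial_mul, one_mul]
  rw [h, h]
  simp only [pr, List.map_cons, List.prod_cons]
  ring

theorem L_big (d : ℕ) (L : MvPolynomial (Fin 5) K →ₗ[K] V)
    (hL0 : ∀ e : Fin 5 →₀ ℕ, e.degree ≠ d → L (monomial e 1) = 0)
    {fs : List (ℕ × ℕ)} {es : List EP} (hr : List.Forall₂ RelE fs es) :
    ∀ γ : Fin 5 →₀ ℕ, d < γ.degree + (sa es).degree → L (monomial γ 1 * pr K es) = 0 := by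
  induction hr with
  | nil =>
    intro γ h
    simp only [pr, sa, List.map_nil, List.prod_nil, mul_one, List.sum_nil, map_zero, add_zero] at h ⊢
    exact hL0 _ (by omega)
  | @cons f p fs es h1 h2 ih =>
    intro γ h
    obtain ⟨_, hd, hf, _⟩ := h1
    have hs : (sa (p :: es)).degree = p.1.degree + (sa es).degree := by
      simp [sa, map_add]
    rw [hs] at h
    rw [pr_cons, map_add, ih _ (by rw [map_add]; omega), ih _ (by rw [map_add]; omega), add_zero]

theorem val_sem (sem : ℕ → V) (hx : ∀ a b, sem (Nat.xor a b) = sem a + sem b) (h0 : sem 0 = 0)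
    (leaf : ℕ → ℕ) (d w : ℕ) (L : MvPolynomial (Fin 5) K →ₗ[K] V)
    (hL : ∀ (e : Fin 5 →₀ ℕ) (κ : ℕ), e.degree = d → κ ≡ keyE e [MOD kM] → κ % 31 = w →
      L (monomial e 1) = sem (leaf κ))
    (hL0 : ∀ e : Fin 5 →₀ ℕ, e.degree ≠ d → L (monomial e 1) = 0)
    {fs : List (ℕ × ℕ)} {es : List EP} (hr : List.Forall₂ RelE fs es) :
    ∀ (γ : Fin 5 →₀ ℕ) (k κ : ℕ), d = γ.degree + (sa es).degree + k →
      κ ≡ keyE (γ + sa es) [MOD kM] → κ % 31 = w →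
      L (monomial γ 1 * pr K es) = sem (val leaf fs k κ) := by
  induction hr with
  | nil =>
    intro γ k κ hd hκ hw
    simp only [pr, sa, List.map_nil, List.prod_nil, mul_one, List.sum_nil, map_zero, add_zero]
      at hd hκ ⊢
    rw [val_nil]
    split_ifs with hk
    · exact hL _ _ (by omega) hκ hw
    · rw [h0]; exact hL0 _ (by omega)
  | @cons f p fs es h1 h2 ih =>
    intro γ k κ hd hκ hw
    obtain ⟨hkey, hdeg, hf, hf31⟩ := h1
    have hs : (sa (p :: es)) = p.1 + sa es := by simp [sa]
    rw [hs] at hκ hd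
    rw [map_add] at hd
    have t1 := ih (γ + p.1) k κ (by rw [map_add]; omega) (by rw [add_assoc]; exact hκ) hw
    rw [pr_cons, map_add, t1]
    by_cases hk : k = 0
    · subst hk
      rw [val_zero, val_zero, L_big d L hL0 h2 _ (by rw [map_add]; omega), add_zero]
    · rw [val_cons _ _ _ _ _ hk, hx]
      congr 1
      split_ifs with hfk
      · apply ih
        · rw [map_add]; omega
        · have e1 : γ + p.2 + sa es = γ + sa es + p.2 := by abel
          have e2 : γ + (p.1 + sa es) = γ + sa es + p.1 := by abel
          rw [e2, keyE_add] at hκ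
          rw [e1, keyE_add]
          calc κ + f.1 ≡ keyE (γ + sa es) + keyE p.1 + f.1 [MOD kM] := hκ.add_right _
            _ = keyE (γ + sa es) + (keyE p.1 + f.1) := by ring
            _ ≡ _ [MOD kM] := hkey.add_left _
        · omega
      · rw [h0]
        exact L_big d L hL0 h2 _ (by rw [map_add]; omega)

theorem val_vanish (leaf : ℕ → ℕ) (w : ℕ) (hl : ∀ κ, κ % 31 ≠ w → leaf κ = 0)
    {fs : List (ℕ × ℕ)} {es : List EP} (hr : List.Forall₂ RelE fs es) :
    ∀ k κ : ℕ, κ % 31 ≠ w → val leaf fs k κ = 0 := by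
  induction hr with
  | nil => intro k κ h; rw [val_nil, hl _ h]; simp
  | @cons f p fs es h1 h2 ih =>
    intro k κ h
    by_cases hk : k = 0
    · subst hk; rw [val_zero]; exact hl _ h
    · obtain ⟨_, _, _, h31⟩ := h1
      rw [val_cons _ _ _ _ _ hk, ih _ _ h, ih _ _ (by omega)]
      simp

def facsE (n : ℕ) (α β : Fin 5 →₀ ℕ) (a : ℕ) (es : List EP) : List EP :=
  match n with
  | 0 => es
  | n + 1 => if a % 2 = 1 then (α, β) :: facsE n (2 • α) (2 • β) (a / 2) es
      else facsE n (2 • α) (2 • β) (a / 2) es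

theorem RelE_two {D h : ℕ} {α β : Fin 5 →₀ ℕ} (hr : RelE (D, h) (α, β)) :
    RelE (2 * D, 2 * h) (2 • α, 2 • β) := by
  obtain ⟨h1, h2, h3, h4⟩ := hr
  simp only at h1 h2 h3 h4
  refine ⟨?_, ?_, ?_, ?_⟩
  · simp only [two_smul, keyE_add, two_mul]
    have := h1.add h1
    rwa [show keyE α + D + (keyE α + D) = keyE α + keyE α + (D + D) by ring] at this
  · simp only [two_smul, map_add]; omega
  · simp only; omega
  · simp only; omega

theorem facs_rel (n : ℕ) : ∀ (D h a : ℕ) (α β : Fin 5 →₀ ℕ) (fs : List (ℕ × ℕ)) (es : List EP),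
    RelE (D, h) (α, β) → List.Forall₂ RelE fs es →
    List.Forall₂ RelE (facs n D h a fs) (facsE n α β a es) := by
  induction n with
  | zero => intro D h a α β fs es _ hr; exact hr
  | succ n ih =>
    intro D h a α β fs es h1 hr
    rw [facs_succ, facsE]
    split_ifs
    · exact List.Forall₂.cons h1 (ih _ _ _ _ _ _ _ (RelE_two h1) hr)
    · exact ih _ _ _ _ _ _ _ (RelE_two h1) hr

theorem facsE_pr (h2 : (2 : K) = 0) (n : ℕ) : ∀ (a : ℕ) (α β : Fin 5 →₀ ℕ) (es : List EP),
    a < 2 ^ n → pr K (facsE n α β a es) = (monomial α 1 + monomial β 1) ^ a * pr K es := by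
  induction n with
  | zero =>
    intro a α β es ha
    have : a = 0 := by simpa using ha
    subst this
    simp [facsE]
  | succ n ih =>
    intro a α β es ha
    have : CharP K 2 := CharTwo.of_one_ne_zero_of_two_eq_zero one_ne_zero h2
    have hsq : (monomial (2 • α) (1 : K) + monomial (2 • β) 1) =
        (monomial α 1 + monomial β 1) ^ 2 := by
      rw [CharTwo.add_sq, monomial_pow, monomial_pow, one_pow]
    have ha' : a / 2 < 2 ^ n := by rw [pow_succ] at ha; omega
    rw [facsE]
    split_ifs with hodd
    · have e : a = 2 * (a / 2) + 1 := by omega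
      have : ∀ p es, pr K (p :: es) = (monomial p.1 1 + monomial p.2 1) * pr K es := by
        intro p es; simp [pr]
      rw [this, ih _ _ _ _ ha', hsq]
      conv_rhs => rw [e]
      rw [← pow_mul]
      ring
    · have e : a = 2 * (a / 2) := by omega
      rw [ih _ _ _ _ ha', hsq]
      conv_rhs => rw [e]
      rw [← pow_mul]

theorem facsE_sa (n : ℕ) : ∀ (a : ℕ) (α β : Fin 5 →₀ ℕ) (es : List EP),
    a < 2 ^ n → sa (facsE n α β a es) = a • α + sa es := by
  induction n with
  | zero =>
    intro a α β es ha
    have : a = 0 := by simpa using ha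
    subst this
    simp [facsE]
  | succ n ih =>
    intro a α β es ha
    have ha' : a / 2 < 2 ^ n := by rw [pow_succ] at ha; omega
    rw [facsE]
    split_ifs with hodd
    · have e : a = (a / 2) * 2 + 1 := by omega
      have : ∀ p es, sa (p :: es) = p.1 + sa es := by
        intro p es; simp [sa]
      rw [this, ih _ _ _ _ ha']
      conv_rhs => rw [e]
      rw [add_smul, mul_smul, one_smul]
      abel
    · have e : a = (a / 2) * 2 := by omega
      rw [ih _ _ _ _ ha']
      conv_rhs => rw [e]
      rw [mul_smul]

def facsE5 (a : Fin 5 →₀ ℕ) : List EP :=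
  facsE 5 (Finsupp.single 0 1) (Finsupp.single 4 2) (a 0)
  (facsE 5 (Finsupp.single 1 1) (Finsupp.single 0 2) (a 1)
  (facsE 5 (Finsupp.single 2 1) (Finsupp.single 1 2) (a 2)
  (facsE 5 (Finsupp.single 3 1) (Finsupp.single 2 2) (a 3)
  (facsE 5 (Finsupp.single 4 1) (Finsupp.single 3 2) (a 4) []))))

theorem facs5_rel (a : Fin 5 →₀ ℕ) :
    List.Forall₂ RelE (facs5 (a 0) (a 1) (a 2) (a 3) (a 4)) (facsE5 a) := by
  unfold facs5 facsE5
  refine facs_rel _ _ _ _ _ _ _ _ ?_ (facs_rel _ _ _ _ _ _ _ _ ?_ (facs_rel _ _ _ _ _ _ _ _ ?_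
    (facs_rel _ _ _ _ _ _ _ _ ?_ (facs_rel _ _ _ _ _ _ _ _ ?_ List.Forall₂.nil))))
  all_goals
    refine ⟨?_, ?_, ?_, ?_⟩
    · simp only [keyE_single]; rfl
    · simp [Finsupp.degree_single]
    · simp
    · rfl

theorem monomial_prod5 (a : Fin 5 →₀ ℕ) : (monomial a (1 : K)) =
    X 0 ^ a 0 * X 1 ^ a 1 * X 2 ^ a 2 * X 3 ^ a 3 * X 4 ^ a 4 := by
  rw [monomial_eq, C_1, one_mul, Finsupp.prod_fintype _ _ (fun i => by simp), Fin.prod_univ_five]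

theorem single5 (a : Fin 5 →₀ ℕ) : a 0 • Finsupp.single (0 : Fin 5) 1 + (a 1 • Finsupp.single 1 1 +
    (a 2 • Finsupp.single 2 1 + (a 3 • Finsupp.single 3 1 + (a 4 • Finsupp.single 4 1 + 0)))) = a := by
  ext i
  fin_cases i <;> simp

theorem facsE5_pr (h2 : (2 : K) = 0) (a : Fin 5 →₀ ℕ) (ha : ∀ i, a i < 32) :
    pr K (facsE5 a) = sqZ K (monomial a 1) := by
  unfold facsE5
  rw [facsE_pr h2 _ _ _ _ _ (ha _), facsE_pr h2 _ _ _ _ _ (ha _), facsE_pr h2 _ _ _ _ _ (ha _),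
    facsE_pr h2 _ _ _ _ _ (ha _), facsE_pr h2 _ _ _ _ _ (ha _), monomial_prod5 a]
  have hp : pr K [] = 1 := by simp [pr]
  have h1 : ∀ i : Fin 5, (monomial (Finsupp.single i 1) (1 : K)) = X i := fun i => rfl
  have h22 : ∀ i : Fin 5, (monomial (Finsupp.single i 2) (1 : K)) = X i ^ 2 := fun i => by
    rw [X_pow_eq_monomial]
  simp only [hp, h1, h22, map_mul, map_pow, sqZ, aeval_X]
  have e0 : (0 : Fin 5) - 1 = 4 := rfl
  have e1 : (1 : Fin 5) - 1 = 0 := rfl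
  have e2 : (2 : Fin 5) - 1 = 1 := rfl
  have e3 : (3 : Fin 5) - 1 = 2 := rfl
  have e4 : (4 : Fin 5) - 1 = 3 := rfl
  rw [e0, e1, e2, e3, e4]
  ring

theorem facsE5_sa (a : Fin 5 →₀ ℕ) (ha : ∀ i, a i < 32) : sa (facsE5 a) = a := by
  unfold facsE5
  rw [facsE_sa _ _ _ _ _ (ha _), facsE_sa _ _ _ _ _ (ha _), facsE_sa _ _ _ _ _ (ha _),
    facsE_sa _ _ _ _ _ (ha _), facsE_sa _ _ _ _ _ (ha _)]
  exact single5 a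

theorem L_homComp (d : ℕ) (L : MvPolynomial (Fin 5) K →ₗ[K] V)
    (hL0 : ∀ e : Fin 5 →₀ ℕ, e.degree ≠ d → L (monomial e 1) = 0) (p : MvPolynomial (Fin 5) K)
    (n : ℕ) : L (homogeneousComponent n p) = if n = d then L p else 0 := by
  induction p using MvPolynomial.induction_on' with
  | monomial a c =>
    have h1 : (monomial a c) = c • (monomial a (1 : K)) := by
      rw [smul_monomial, smul_eq_mul, mul_one]
    have hm : (monomial a (1 : K)).IsHomogeneous a.degree := isHomogeneous_monomial 1 rfl
    rw [h1, map_smul, map_smul, map_smul, homogeneousComponent_of_mem hm]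
    by_cases hn : n = a.degree
    · rw [if_pos hn]
      split_ifs with hd
      · rfl
      · rw [hL0 _ (by omega), smul_zero]
    · rw [if_neg hn]
      split_ifs with hd
      · rw [hL0 _ (by omega), map_zero]
      · simp
  | add p q hp hq => rw [map_add, map_add, hp, hq, map_add]; split_ifs <;> simp

theorem hit_sem (h2 : (2 : K) = 0)
    (sem : ℕ → V) (hx : ∀ a b, sem (Nat.xor a b) = sem a + sem b) (h0 : sem 0 = 0)
    (leaf : ℕ → ℕ) (d : ℕ) (L : MvPolynomial (Fin 5) K →ₗ[K] V)
    (a : Fin 5 →₀ ℕ) (ha : ∀ i, a i < 32) (k : ℕ) (hk : a.degree + k = d)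
    (hL : ∀ (e : Fin 5 →₀ ℕ) (κ : ℕ), e.degree = d → κ ≡ keyE e [MOD kM] →
      κ % 31 = keyE a % 31 → L (monomial e 1) = sem (leaf κ))
    (hL0 : ∀ e : Fin 5 →₀ ℕ, e.degree ≠ d → L (monomial e 1) = 0) :
    L (homogeneousComponent (a.degree + k) (sqZ K (monomial a 1))) =
      sem (val leaf (facs5 (a 0) (a 1) (a 2) (a 3) (a 4)) k (keyE a)) := by
  rw [L_homComp d L hL0, if_pos hk, ← facsE5_pr h2 a ha]
  have := val_sem sem hx h0 leaf d (keyE a % 31) L hL hL0 (facs5_rel a) 0 k (keyE a)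
    (by rw [facsE5_sa a ha, map_zero]; omega) (by rw [facsE5_sa a ha, zero_add]) rfl
  rw [← this, monomial_zero', C_1, one_mul]

end sem
section semU
variable {K : Type*} [Field K] {V : Type*} [AddCommGroup V] [Module K V]

abbrev ET := (Fin 5 →₀ ℕ) × (Fin 5 →₀ ℕ) × (Fin 5 →₀ ℕ)

def RelU (f : ℕ × ℕ) (p : ET) : Prop :=
  keyE p.1 + f.1 ≡ keyE p.2.1 [MOD kM] ∧ keyE p.1 + f.2 ≡ keyE p.2.2 [MOD kM] ∧
    p.2.1.degree = p.1.degree ∧ p.2.2.degree = p.1.degree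

def prU (K : Type*) [Field K] (es : List ET) : MvPolynomial (Fin 5) K :=
  (es.map fun p => monomial p.1 (1 : K) + monomial p.2.1 1 + monomial p.2.2 1).prod

def saU (es : List ET) : Fin 5 →₀ ℕ := (es.map Prod.fst).sum

theorem prU_cons (p : ET) (es : List ET) (γ : Fin 5 →₀ ℕ) :
    monomial γ 1 * prU K (p :: es) =
      monomial (γ + p.1) 1 * prU K es + (monomial (γ + p.2.1) 1 * prU K es +
        monomial (γ + p.2.2) 1 * prU K es) := by
  have h : ∀ a b : Fin 5 →₀ ℕ, (monomial (a + b) (1 : K)) = monomial a 1 * monomial b 1 := by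
    intro a b; rw [monomial_mul, one_mul]
  rw [h, h, h]
  simp only [prU, List.map_cons, List.prod_cons]
  ring

theorem valU_sem (sem : ℕ → V) (hx : ∀ a b, sem (Nat.xor a b) = sem a + sem b)
    (leaf : ℕ → ℕ) (d : ℕ) (L : MvPolynomial (Fin 5) K →ₗ[K] V)
    (hL : ∀ (e : Fin 5 →₀ ℕ) (κ : ℕ), e.degree = d → κ ≡ keyE e [MOD kM] →
      L (monomial e 1) = sem (leaf κ))
    {fs : List (ℕ × ℕ)} {es : List ET} (hr : List.Forall₂ RelU fs es) :
    ∀ (γ : Fin 5 →₀ ℕ) (κ : ℕ), d = γ.degree + (saU es).degree →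
      κ ≡ keyE (γ + saU es) [MOD kM] →
      L (monomial γ 1 * prU K es) = sem (valU leaf fs κ) := by
  induction hr with
  | nil =>
    intro γ κ hd hκ
    simp only [prU, saU, List.map_nil, List.prod_nil, mul_one, List.sum_nil, map_zero, add_zero]
      at hd hκ ⊢
    exact hL _ _ hd.symm hκ
  | @cons f p fs es h1 h2 ih =>
    intro γ κ hd hκ
    obtain ⟨hk1, hk2, hd1, hd2⟩ := h1
    have hs : (saU (p :: es)) = p.1 + saU es := by simp [saU]
    rw [hs] at hκ hd
    rw [map_add] at hd
    have key : ∀ q : Fin 5 →₀ ℕ, ∀ c, keyE p.1 + c ≡ keyE q [MOD kM] →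
        κ + c ≡ keyE (γ + q + saU es) [MOD kM] := by
      intro q c hq
      have e1 : γ + q + saU es = γ + saU es + q := by abel
      have e2 : γ + (p.1 + saU es) = γ + saU es + p.1 := by abel
      rw [e2, keyE_add] at hκ
      rw [e1, keyE_add]
      calc κ + c ≡ keyE (γ + saU es) + keyE p.1 + c [MOD kM] := hκ.add_right _
        _ = keyE (γ + saU es) + (keyE p.1 + c) := by ring
        _ ≡ _ [MOD kM] := hq.add_left _
    rw [prU_cons, map_add, map_add, valU_cons, hx, hx]
    rw [ih (γ + p.1) κ (by rw [map_add]; omega) (by rw [add_assoc]; exact hκ),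
      ih (γ + p.2.1) (κ + f.1) (by rw [map_add]; omega) (key _ _ hk1),
      ih (γ + p.2.2) (κ + f.2) (by rw [map_add]; omega) (key _ _ hk2)]

def facsT (n : ℕ) (α β δ : Fin 5 →₀ ℕ) (a : ℕ) (es : List ET) : List ET :=
  match n with
  | 0 => es
  | n + 1 => if a % 2 = 1 then (α, β, δ) :: facsT n (2 • α) (2 • β) (2 • δ) (a / 2) es
      else facsT n (2 • α) (2 • β) (2 • δ) (a / 2) es

theorem RelU_two {D h : ℕ} {α β δ : Fin 5 →₀ ℕ} (hr : RelU (D, h) (α, β, δ)) :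
    RelU (2 * D, 2 * h) (2 • α, 2 • β, 2 • δ) := by
  obtain ⟨h1, h2, h3, h4⟩ := hr
  simp only at h1 h2 h3 h4
  refine ⟨?_, ?_, ?_, ?_⟩
  · simp only [two_smul, keyE_add, two_mul]
    have := h1.add h1
    rwa [show keyE α + D + (keyE α + D) = keyE α + keyE α + (D + D) by ring] at this
  · simp only [two_smul, keyE_add, two_mul]
    have := h2.add h2
    rwa [show keyE α + h + (keyE α + h) = keyE α + keyE α + (h + h) by ring] at this
  · simp only [two_smul, map_add]; omega
  · simp only [two_smul, map_add]; omega

theorem facsT_rel (n : ℕ) : ∀ (D h a : ℕ) (α β δ : Fin 5 →₀ ℕ) (fs : List (ℕ × ℕ)) (es : List ET),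
    RelU (D, h) (α, β, δ) → List.Forall₂ RelU fs es →
    List.Forall₂ RelU (facs n D h a fs) (facsT n α β δ a es) := by
  induction n with
  | zero => intro D h a α β δ fs es _ hr; exact hr
  | succ n ih =>
    intro D h a α β δ fs es h1 hr
    rw [facs_succ, facsT]
    split_ifs
    · exact List.Forall₂.cons h1 (ih _ _ _ _ _ _ _ _ (RelU_two h1) hr)
    · exact ih _ _ _ _ _ _ _ _ (RelU_two h1) hr

theorem facsT_pr (h2 : (2 : K) = 0) (n : ℕ) : ∀ (a : ℕ) (α β δ : Fin 5 →₀ ℕ) (es : List ET),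
    a < 2 ^ n → prU K (facsT n α β δ a es) =
      (monomial α 1 + monomial β 1 + monomial δ 1) ^ a * prU K es := by
  induction n with
  | zero =>
    intro a α β δ es ha
    have : a = 0 := by simpa using ha
    subst this
    simp [facsT]
  | succ n ih =>
    intro a α β δ es ha
    have : CharP K 2 := CharTwo.of_one_ne_zero_of_two_eq_zero one_ne_zero h2
    have hsq : (monomial (2 • α) (1 : K) + monomial (2 • β) 1 + monomial (2 • δ) 1) =
        (monomial α 1 + monomial β 1 + monomial δ 1) ^ 2 := by
      rw [CharTwo.add_sq, CharTwo.add_sq, monomial_pow, monomial_pow, monomial_pow, one_pow]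
    have ha' : a / 2 < 2 ^ n := by rw [pow_succ] at ha; omega
    rw [facsT]
    split_ifs with hodd
    · have e : a = 2 * (a / 2) + 1 := by omega
      have : ∀ p es, prU K (p :: es) =
          (monomial p.1 1 + monomial p.2.1 1 + monomial p.2.2 1) * prU K es := by
        intro p es; simp [prU]
      rw [this, ih _ _ _ _ _ ha', hsq]
      conv_rhs => rw [e]
      rw [← pow_mul]
      ring
    · have e : a = 2 * (a / 2) := by omega
      rw [ih _ _ _ _ _ ha', hsq]
      conv_rhs => rw [e]
      rw [← pow_mul]

theorem facsT_sa (n : ℕ) : ∀ (a : ℕ) (α β δ : Fin 5 →₀ ℕ) (es : List ET),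
    a < 2 ^ n → saU (facsT n α β δ a es) = a • α + saU es := by
  induction n with
  | zero =>
    intro a α β δ es ha
    have : a = 0 := by simpa using ha
    subst this
    simp [facsT]
  | succ n ih =>
    intro a α β δ es ha
    have ha' : a / 2 < 2 ^ n := by rw [pow_succ] at ha; omega
    rw [facsT]
    split_ifs with hodd
    · have e : a = (a / 2) * 2 + 1 := by omega
      have : ∀ p es, saU (p :: es) = p.1 + saU es := by
        intro p es; simp [saU]
      rw [this, ih _ _ _ _ _ ha']
      conv_rhs => rw [e]
      rw [add_smul, mul_smul, one_smul]
      abel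
    · have e : a = (a / 2) * 2 := by omega
      rw [ih _ _ _ _ _ ha']
      conv_rhs => rw [e]
      rw [mul_smul]

def sg (i : Fin 5) : Fin 5 →₀ ℕ := Finsupp.single i 1

def facsT5 (a : Fin 5 →₀ ℕ) : List ET :=
  facsT 5 (sg 0) (sg 1) (sg 2) (a 0) (facsT 5 (sg 1) (sg 2) (sg 3) (a 1)
  (facsT 5 (sg 2) (sg 3) (sg 4) (a 2) (facsT 5 (sg 3) (sg 4) (sg 0) (a 3)
  (facsT 5 (sg 4) (sg 0) (sg 1) (a 4) []))))

theorem facsU5_rel (a : Fin 5 →₀ ℕ) :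
    List.Forall₂ RelU (facsU5 (a 0) (a 1) (a 2) (a 3) (a 4)) (facsT5 a) := by
  unfold facsU5 facsT5
  rw [facsU_eq]
  refine facsT_rel _ _ _ _ _ _ _ _ _ ?_ (facsT_rel _ _ _ _ _ _ _ _ _ ?_
    (facsT_rel _ _ _ _ _ _ _ _ _ ?_ (facsT_rel _ _ _ _ _ _ _ _ _ ?_
    (facsT_rel _ _ _ _ _ _ _ _ _ ?_ List.Forall₂.nil))))
  all_goals
    refine ⟨?_, ?_, ?_, ?_⟩
    · simp only [sg, keyE_single]; rfl
    · simp only [sg, keyE_single]; rfl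
    · simp [sg, Finsupp.degree_single]
    · simp [sg, Finsupp.degree_single]

theorem facsT5_pr (h2 : (2 : K) = 0) (a : Fin 5 →₀ ℕ) (ha : ∀ i, a i < 32) :
    prU K (facsT5 a) = glA (mU K) (monomial a 1) := by
  unfold facsT5
  rw [facsT_pr h2 _ _ _ _ _ _ (ha _), facsT_pr h2 _ _ _ _ _ _ (ha _),
    facsT_pr h2 _ _ _ _ _ _ (ha _), facsT_pr h2 _ _ _ _ _ _ (ha _),
    facsT_pr h2 _ _ _ _ _ _ (ha _), monomial_prod5 a]
  have hp : prU K [] = 1 := by simp [prU]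
  have h1 : ∀ i : Fin 5, (monomial (sg i) (1 : K)) = X i := fun i => rfl
  have hX : ∀ i : Fin 5, glA (mU K) (X i) = X i + X (i + 1) + X (i + 2) := by
    intro i
    rw [glA_X]
    fin_cases i <;> simp [Fin.sum_univ_five, mU] <;> abel
  simp only [hp, h1, map_mul, map_pow, hX]
  have e0 : (0 : Fin 5) + 1 = 1 := rfl
  have e0' : (0 : Fin 5) + 2 = 2 := rfl
  have e1 : (1 : Fin 5) + 1 = 2 := rfl
  have e1' : (1 : Fin 5) + 2 = 3 := rfl
  have e2 : (2 : Fin 5) + 1 = 3 := rfl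
  have e2' : (2 : Fin 5) + 2 = 4 := rfl
  have e3 : (3 : Fin 5) + 1 = 4 := rfl
  have e3' : (3 : Fin 5) + 2 = 0 := rfl
  have e4 : (4 : Fin 5) + 1 = 0 := rfl
  have e4' : (4 : Fin 5) + 2 = 1 := rfl
  rw [e0, e0', e1, e1', e2, e2', e3, e3', e4, e4']
  ring

theorem facsT5_sa (a : Fin 5 →₀ ℕ) (ha : ∀ i, a i < 32) : saU (facsT5 a) = a := by
  unfold facsT5
  rw [facsT_sa _ _ _ _ _ _ (ha _), facsT_sa _ _ _ _ _ _ (ha _), facsT_sa _ _ _ _ _ _ (ha _),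
    facsT_sa _ _ _ _ _ _ (ha _), facsT_sa _ _ _ _ _ _ (ha _)]
  exact single5 a

theorem u_sem (h2 : (2 : K) = 0)
    (sem : ℕ → V) (hx : ∀ a b, sem (Nat.xor a b) = sem a + sem b)
    (leaf : ℕ → ℕ) (d : ℕ) (L : MvPolynomial (Fin 5) K →ₗ[K] V)
    (hL : ∀ (e : Fin 5 →₀ ℕ) (κ : ℕ), e.degree = d → κ ≡ keyE e [MOD kM] →
      L (monomial e 1) = sem (leaf κ))
    (a : Fin 5 →₀ ℕ) (ha : ∀ i, a i < 32) (hd : a.degree = d) :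
    L (glA (mU K) (monomial a 1)) =
      sem (valU leaf (facsU5 (a 0) (a 1) (a 2) (a 3) (a 4)) (keyE a)) := by
  rw [← facsT5_pr h2 a ha]
  have := valU_sem sem hx leaf d L hL (facsU5_rel a) 0 (keyE a)
    (by rw [facsT5_sa a ha, map_zero]; omega) (by rw [facsT5_sa a ha, zero_add])
  rw [← this, monomial_zero', C_1, one_mul]

theorem allLt_iff (p : ℕ → Bool) (n : ℕ) (h : allLt p n = true) : ∀ m < n, p m = true := by
  induction n with
  | zero => intro m hm; omega
  | succ n ih =>
    change cond (p n) (allLt p n) false = true at h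
    intro m hm
    cases hp : p n with
    | false => rw [hp] at h; exact absurd h (by simp)
    | true =>
      rw [hp] at h
      rcases Nat.lt_succ_iff_lt_or_eq.1 hm with h' | h'
      · exact ih h m h'
      · rw [h']; exact hp

theorem enumA_spec (p : ℕ → ℕ → ℕ → ℕ → ℕ → Bool) (D w : ℕ) (h : enumA p D w = true)
    (hD : D ≤ 31) (a0 a1 a2 a3 a4 : ℕ) (hs : a0 + a1 + a2 + a3 + a4 < D)
    (hk : key5 a0 a1 a2 a3 a4 % 31 = w) : p a0 a1 a2 a3 a4 = true := by
  have h4 := allLt_iff _ _ h a4 (by omega)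
  have h3 := allLt_iff _ _ h4 a3 (by simp only [Nat.sub_eq]; omega)
  have h2 := allLt_iff _ _ h3 a2 (by simp only [Nat.sub_eq]; omega)
  have h1 := allLt_iff _ _ h2 a1 (by simp only [Nat.sub_eq]; omega)
  have e : Nat.mod (Nat.add w (Nat.mul 30 (key5 0 a1 a2 a3 a4))) 31 = a0 := by
    change (w + 30 * (key5 0 a1 a2 a3 a4)) % 31 = a0
    rw [key5_eq] at hk ⊢
    omega
  rw [e] at h1
  exact h1

theorem dg_key5 (a0 a1 a2 a3 a4 : ℕ) (h0 : a0 < 33) (h1 : a1 < 33) (h2 : a2 < 33) (h3 : a3 < 33)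
    (h4 : a4 < 33) : dg (key5 a0 a1 a2 a3 a4) 0 = a0 ∧ dg (key5 a0 a1 a2 a3 a4) 1 = a1 ∧
      dg (key5 a0 a1 a2 a3 a4) 2 = a2 ∧ dg (key5 a0 a1 a2 a3 a4) 3 = a3 ∧
      dg (key5 a0 a1 a2 a3 a4) 4 = a4 := by
  have hdg : ∀ κ i, dg κ i = κ / 33 ^ i % 33 := fun _ _ => rfl
  simp only [hdg, key5_eq]
  norm_num
  refine ⟨?_, ?_, ?_, ?_, ?_⟩ <;> omega

/-- exponent vector from five numbers -/
def ex5 (a0 a1 a2 a3 a4 : ℕ) : Fin 5 →₀ ℕ := Finsupp.equivFunOnFinite.symm ![a0, a1, a2, a3, a4]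

theorem degree5 (e : Fin 5 →₀ ℕ) : e.degree = e 0 + e 1 + e 2 + e 3 + e 4 := by
  rw [Finsupp.degree_eq_sum, Fin.sum_univ_five]

theorem ex5_key (a0 a1 a2 a3 a4 : ℕ) : keyE (ex5 a0 a1 a2 a3 a4) = key5 a0 a1 a2 a3 a4 := rfl

theorem ex5_deg (a0 a1 a2 a3 a4 : ℕ) :
    (ex5 a0 a1 a2 a3 a4).degree = a0 + a1 + a2 + a3 + a4 := by
  rw [degree5]; rfl

theorem le_degree5 (e : Fin 5 →₀ ℕ) (i : Fin 5) : e i ≤ e.degree := by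
  rw [degree5]; fin_cases i <;> simp <;> omega

end semU
section zmain
variable {K : Type*} [Field K]

abbrev RK (K : Type*) [Field K] := MvPolynomial (Fin 5) K

theorem char2_add_self {V : Type*} [AddCommGroup V] [Module K V] (h2 : (2 : K) = 0) (v : V) :
    v + v = 0 := by rw [← two_smul K v, h2, zero_smul]

theorem char2_swap {V : Type*} [AddCommGroup V] [Module K V] (h2 : (2 : K) = 0) {a b : V}
    (h : a + b = 0) : a = b := by
  have := char2_add_self h2 b
  calc a = a + (b + b) := by rw [this, add_zero]
    _ = b := by rw [← add_assoc, h, zero_add]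

theorem gS_X (i : Fin 5) : glA (mS K) (X i) = X (i + 1) := by
  rw [glA_X]; simp [mS]

theorem gU_X (i : Fin 5) : glA (mU K) (X i) = X i + X (i + 1) + X (i + 2) := by
  rw [glA_X]
  fin_cases i <;> simp [Fin.sum_univ_five, mU] <;> abel

theorem gL_X (ζ : K) (i : Fin 5) : glA (mL ζ) (X i) = ζ ^ (33 ^ (i : ℕ)) • X i := by
  rw [glA_X]
  simp [mL, Matrix.diagonal_apply]

theorem comS : (glA (mS K)).comp (sqZ K) = (sqZ K).comp (glA (mS K)) := by
  apply algHom_ext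
  intro i
  simp only [AlgHom.comp_apply, gS_X, sqZ, aeval_X, map_add, map_pow]
  congr 3
  abel

theorem comU (h2 : (2 : K) = 0) : (glA (mU K)).comp (sqZ K) = (sqZ K).comp (glA (mU K)) := by
  have : CharP K 2 := CharTwo.of_one_ne_zero_of_two_eq_zero one_ne_zero h2
  apply algHom_ext
  intro i
  simp only [AlgHom.comp_apply, gU_X, sqZ, aeval_X, map_add, map_pow]
  rw [CharTwo.add_sq, CharTwo.add_sq]
  have e1 : i - 1 + 1 = i + 1 - 1 := by abel
  have e2 : i - 1 + 2 = i + 2 - 1 := by abel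
  rw [e1, e2]
  abel

theorem comL (ζ : K) (h31 : ζ ^ 31 = 1) :
    (glA (mL ζ)).comp (sqZ K) = (sqZ K).comp (glA (mL ζ)) := by
  have hm : ∀ a b, a % 31 = b % 31 → ζ ^ a = ζ ^ b := by
    intro a b h
    rw [← Nat.div_add_mod a 31, ← Nat.div_add_mod b 31, h, pow_add, pow_add, pow_mul, pow_mul, h31,
      one_pow, one_pow]
  apply algHom_ext
  intro i
  simp only [AlgHom.comp_apply, gL_X, sqZ, aeval_X, map_add, map_pow, map_smul, smul_pow,
    smul_add, ← pow_mul]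
  congr 2
  apply hm
  fin_cases i <;> rfl

theorem stabS {x : RK K} (hx : x ∈ hG (sqZ K)) : glA (mS K) x ∈ hG (sqZ K) :=
  glA_hG _ _ _ comS hx
theorem stabU (h2 : (2 : K) = 0) {x : RK K} (hx : x ∈ hG (sqZ K)) : glA (mU K) x ∈ hG (sqZ K) :=
  glA_hG _ _ _ (comU h2) hx
theorem stabL (ζ : K) (h31 : ζ ^ 31 = 1) {x : RK K} (hx : x ∈ hG (sqZ K)) :
    glA (mL ζ) x ∈ hG (sqZ K) :=
  glA_hG _ _ _ (comL ζ h31) hx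

theorem SU (x : RK K) : glA (mS K) (glA (mU K) x) = glA (mU K) (glA (mS K) x) := by
  have : (glA (mS K)).comp (glA (mU K)) = (glA (mU K)).comp (glA (mS K)) := by
    apply algHom_ext
    intro i
    simp only [AlgHom.comp_apply, gU_X, gS_X, map_add]
    have e1 : i + 2 + 1 = i + 1 + 2 := by abel
    rw [e1]
  exact DFunLike.congr_fun this x

theorem S5id (x : RK K) : glA (mS K) (glA (mS K) (glA (mS K) (glA (mS K) (glA (mS K) x)))) = x := by
  have : (glA (mS K)).comp ((glA (mS K)).comp ((glA (mS K)).comp ((glA (mS K)).comp (glA (mS K)))))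
      = AlgHom.id K _ := by
    apply algHom_ext
    intro i
    simp only [AlgHom.comp_apply, gS_X, AlgHom.id_apply]
    congr 1
    fin_cases i <;> rfl
  exact DFunLike.congr_fun this x

/-- rotation of exponents -/
def rot (e : Fin 5 →₀ ℕ) : Fin 5 →₀ ℕ := ex5 (e 4) (e 0) (e 1) (e 2) (e 3)

theorem gS_mon (e : Fin 5 →₀ ℕ) : glA (mS K) (monomial e 1) = monomial (rot e) 1 := by
  rw [monomial_prod5 e, monomial_prod5 (rot e)]
  simp only [map_mul, map_pow, gS_X]
  have e0 : (0 : Fin 5) + 1 = 1 := rfl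
  have e1 : (1 : Fin 5) + 1 = 2 := rfl
  have e2 : (2 : Fin 5) + 1 = 3 := rfl
  have e3 : (3 : Fin 5) + 1 = 4 := rfl
  have e4 : (4 : Fin 5) + 1 = 0 := rfl
  rw [e0, e1, e2, e3, e4]
  change _ = X 0 ^ e 4 * X 1 ^ e 0 * X 2 ^ e 1 * X 3 ^ e 2 * X 4 ^ e 3
  ring

theorem rot_key (e : Fin 5 →₀ ℕ) : 33 * keyE e ≡ keyE (rot e) [MOD kM] := by
  change 33 * key5 (e 0) (e 1) (e 2) (e 3) (e 4) ≡ key5 (e 4) (e 0) (e 1) (e 2) (e 3) [MOD kM]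
  rw [key5_eq, key5_eq]
  unfold Nat.ModEq kM
  omega

theorem rot_deg (e : Fin 5 →₀ ℕ) : (rot e).degree = e.degree := by
  rw [rot, ex5_deg, degree5]; ring

theorem gL_mon (ζ : K) (e : Fin 5 →₀ ℕ) (c : K) :
    glA (mL ζ) (monomial e c) = ζ ^ keyE e • monomial e c := by
  have h1 : (monomial e c) = c • (monomial e (1 : K)) := by
    rw [smul_monomial, smul_eq_mul, mul_one]
  rw [h1, map_smul, smul_comm]
  congr 1
  rw [monomial_prod5 e]
  simp only [map_mul, map_pow, gL_X, smul_pow, smul_mul_smul_comm]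
  congr 1
  rw [keyE, key5_eq]
  simp only [← pow_mul, ← pow_add]
  congr 1
  simp

theorem weight0 (h2 : (2 : K) = 0) (ζ : K) (hord : orderOf ζ = 31) (F : RK K)
    (hL : glA (mL ζ) F + F ∈ hG (sqZ K)) :
    (∑ e ∈ F.support with keyE e % 31 = 0, monomial e (coeff e F)) + F ∈ hG (sqZ K) := by
  have h31 : ζ ^ 31 = 1 := by rw [← hord]; exact pow_orderOf_eq_one ζ
  let ℓ := (glA (mL ζ)).toLinearMap
  have hk : ∀ k : ℕ, (ℓ ^ k) F + F ∈ hG (sqZ K) := by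
    intro k
    induction k with
    | zero => rw [pow_zero, Module.End.one_apply, char2_add_self h2]; exact zero_mem _
    | succ k ih =>
      have := add_mem (stabL ζ h31 ih) hL
      rw [map_add, add_assoc, ← add_assoc _ _ F, char2_add_self h2, zero_add] at this
      rw [pow_succ', Module.End.mul_apply]
      exact this
  have hs : ∑ k ∈ Finset.range 31, ((ℓ ^ k) F + F) ∈ hG (sqZ K) :=
    Submodule.sum_mem _ fun k _ => hk k
  have h31' : (31 : K) = 1 := by
    have : (31 : K) = 15 * 2 + 1 := by norm_num
    rw [this, h2]; simp
  have hF : ∑ k ∈ Finset.range 31, F = F := by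
    rw [Finset.sum_const, Finset.card_range, ← Nat.cast_smul_eq_nsmul K]
    rw [show ((31 : ℕ) : K) = 1 by exact_mod_cast h31', one_smul]
  rw [Finset.sum_add_distrib, hF] at hs
  convert hs using 2
  have hm : ∀ (k : ℕ) (e : Fin 5 →₀ ℕ) (c : K), (ℓ ^ k) (monomial e c) =
      (ζ ^ keyE e) ^ k • monomial e c := by
    intro k e c
    induction k with
    | zero => simp
    | succ k ih =>
      rw [pow_succ', Module.End.mul_apply, ih, map_smul]
      change _ • glA (mL ζ) (monomial e c) = _
      rw [gL_mon, smul_smul, pow_succ]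
  have hsum : ∀ (e : Fin 5 →₀ ℕ) (c : K), ∑ k ∈ Finset.range 31, (ℓ ^ k) (monomial e c) =
      if keyE e % 31 = 0 then monomial e c else 0 := by
    intro e c
    simp only [hm]
    rw [← Finset.sum_smul]
    split_ifs with h
    · have : ζ ^ keyE e = 1 := by
        rw [← orderOf_dvd_iff_pow_eq_one, hord]; omega
      rw [this]
      simp [h31']
    · have : ζ ^ keyE e ≠ 1 := by
        rw [Ne, ← orderOf_dvd_iff_pow_eq_one, hord]; omega
      have hg := mul_geom_sum (ζ ^ keyE e) 31
      rw [← pow_mul, mul_comm _ 31, pow_mul, h31, one_pow, sub_self] at hg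
      rcases mul_eq_zero.1 hg with h' | h'
      · exact absurd (sub_eq_zero.1 h') this
      · rw [h', zero_smul]
  rw [Finset.sum_filter]
  conv_rhs => rw [F.as_sum]
  simp only [map_sum]
  rw [Finset.sum_comm]
  exact Finset.sum_congr rfl fun e _ => (hsum e _).symm

def NS (x : RK K) : RK K := x + (glA (mS K) x + (glA (mS K) (glA (mS K) x) +
  (glA (mS K) (glA (mS K) (glA (mS K) x)) + glA (mS K) (glA (mS K) (glA (mS K) (glA (mS K) x))))))

def NSl : RK K →ₗ[K] RK K where
  toFun := NS
  map_add' x y := by simp only [NS, map_add]; abel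
  map_smul' c x := by simp only [NS, map_smul, smul_add, RingHom.id_apply]

theorem NS_S (x : RK K) : NS (glA (mS K) x) = NS x := by
  simp only [NS]; rw [S5id]; abel

theorem NS_stab {x : RK K} (hx : x ∈ hG (sqZ K)) : NS x ∈ hG (sqZ K) := by
  have h1 := stabS hx
  have h2 := stabS h1
  have h3 := stabS h2
  have h4 := stabS h3
  exact add_mem hx (add_mem h1 (add_mem h2 (add_mem h3 h4)))

theorem NS_inv (h2 : (2 : K) = 0) {x : RK K} (hx : glA (mS K) x + x ∈ hG (sqZ K)) :
    NS x + x ∈ hG (sqZ K) := by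
  have h1 := stabS hx
  have h4 := stabS (stabS (stabS hx))
  have : NS x + x = glA (mS K) (glA (mS K) x + x) +
      (glA (mS K) (glA (mS K) (glA (mS K) (glA (mS K) x + x)))) + (x + x) := by
    simp only [NS, map_add]; ring
  rw [char2_add_self h2, add_zero] at this
  rw [this]
  exact add_mem h1 h4

end zmain
section zmain2
variable {K : Type*} [Field K]

theorem kM_mod31 (x : ℕ) : x % kM % 31 = x % 31 := by unfold kM; omega

theorem modEq31 {a b : ℕ} (h : a ≡ b [MOD kM]) : a % 31 = b % 31 := by
  have := kM_mod31 a
  have := kM_mod31 b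
  unfold Nat.ModEq at h
  omega

/-- bits of a mask -/
def semB (K : Type*) [Field K] (m : ℕ) : ℕ → K := fun i => if m.testBit i then 1 else 0

theorem semB_zero : semB K 0 = 0 := by ext i; simp [semB]

theorem semB_xor (h2 : (2 : K) = 0) (a b : ℕ) : semB K (Nat.xor a b) = semB K a + semB K b := by
  ext i
  change (if (a ^^^ b).testBit i then (1 : K) else 0) =
    (if a.testBit i then 1 else 0) + (if b.testBit i then 1 else 0)
  rw [Nat.testBit_xor]
  have : (1 : K) + 1 = 0 := by rw [one_add_one_eq_two, h2]
  cases a.testBit i <;> cases b.testBit i <;> simp [this]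

/-- dual functional -/
def BF (K : Type*) [Field K] (T : ℕ → ℕ) (d : ℕ) : RK K →ₗ[K] (ℕ → K) :=
  (basisMonomials (Fin 5) K).constr K fun e =>
    if e.degree = d then semB K (T (keyE e % kM)) else 0

theorem BF_mon (T : ℕ → ℕ) (d : ℕ) (e : Fin 5 →₀ ℕ) : BF K T d (monomial e 1) =
    if e.degree = d then semB K (T (keyE e % kM)) else 0 := by
  have := (basisMonomials (Fin 5) K).constr_basis K
    (fun e => if e.degree = d then semB K (T (keyE e % kM)) else 0) e
  rwa [coe_basisMonomials] at this

theorem funChk1_spec {T : ℕ → ℕ} {d a0 a1 a2 a3 a4 k : ℕ}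
    (h : funChk1 T d a0 a1 a2 a3 a4 = true) (hs : a0 + a1 + a2 + a3 + a4 + k = d) (hk : 1 ≤ k) :
    val (fun κ => T (Nat.mod κ kM)) (facs5 a0 a1 a2 a3 a4) k (key5 a0 a1 a2 a3 a4) = 0 := by
  have e : Nat.add a0 (Nat.add a1 (Nat.add a2 (Nat.add a3 a4))) = d - k := by
    simp only [Nat.add_eq]; omega
  unfold funChk1 at h
  simp only [e] at h
  have hb : Nat.ble d (d - k) = false := by
    rw [← Bool.not_eq_true, Nat.ble_eq]; omega
  have e2 : Nat.sub d (d - k) = k := by simp only [Nat.sub_eq]; omega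
  rw [hb, e2] at h
  exact Nat.eq_of_beq_eq_true h

theorem BF_hit (h2 : (2 : K) = 0) (T : ℕ → ℕ) (d : ℕ) (hd : d ≤ 31)
    (hT : ∀ x, x % 31 ≠ 7 → T x = 0) (hf : enumA (funChk1 T d) d 7 = true)
    {x : RK K} (hx : x ∈ hG (sqZ K)) : BF K T d x = 0 := by
  have h0 : ∀ e : Fin 5 →₀ ℕ, e.degree ≠ d → BF K T d (monomial e 1) = 0 := by
    intro e he; rw [BF_mon, if_neg he]
  induction hx using Submodule.span_induction with
  | mem x hx =>
    obtain ⟨a, k, hk, rfl⟩ := hx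
    by_cases hdk : a.degree + k = d
    · have ha : ∀ i, a i < 32 := fun i => by have := le_degree5 a i; omega
      rw [hit_sem h2 (semB K) (semB_xor h2) semB_zero (fun κ => T (Nat.mod κ kM)) d _ a ha k hdk ?_ h0]
      · by_cases hw : keyE a % 31 = 7
        · have := enumA_spec _ _ _ hf hd (a 0) (a 1) (a 2) (a 3) (a 4)
            (by rw [degree5] at hdk; omega) hw
          rw [degree5] at hdk
          change semB K (val _ _ k (key5 (a 0) (a 1) (a 2) (a 3) (a 4))) = 0
          rw [funChk1_spec this hdk hk, semB_zero]
        · rw [val_vanish (fun κ => T (Nat.mod κ kM)) 7 ?_ (facs5_rel a) k _ hw, semB_zero]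
          intro κ hκ
          apply hT
          change κ % kM % 31 ≠ 7
          rwa [kM_mod31]
      · intro e κ he hκ _
        rw [BF_mon, if_pos he]
        change _ = semB K (T (κ % kM))
        rw [hκ]
    · rw [L_homComp d _ h0, if_neg hdk]
  | zero => simp
  | add x y _ _ hx hy => rw [map_add, hx, hy, add_zero]
  | smul c x _ hx => rw [map_smul, hx, smul_zero]

theorem BF_weight (T : ℕ → ℕ) (d : ℕ) (hT : ∀ x, x % 31 ≠ 7 → T x = 0) (e : Fin 5 →₀ ℕ)
    (he : keyE e % 31 ≠ 7) : BF K T d (monomial e 1) = 0 := by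
  rw [BF_mon, hT, semB_zero, ite_self]
  rwa [kM_mod31]

theorem BFN_mon (T : ℕ → ℕ) (d : ℕ) (hT : ∀ x, x % 31 ≠ 7 → T x = 0) (e : Fin 5 →₀ ℕ) (κ : ℕ)
    (he : e.degree = d) (hκ : κ ≡ keyE e [MOD kM]) :
    (BF K T d ∘ₗ NSl) (monomial e 1) = semB K (leafU T κ) := by
  change BF K T d (NS (monomial e 1)) = _
  simp only [NS, gS_mon, map_add]
  have hB : ∀ e' : Fin 5 →₀ ℕ, ∀ κ', e'.degree = d → κ' ≡ keyE e' [MOD kM] →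
      BF K T d (monomial e' 1) = semB K (T (κ' % kM)) := by
    intro e' κ' h1 h2
    rw [BF_mon, if_pos h1, ← h2]
  have r : ∀ e' : Fin 5 →₀ ℕ, ∀ κ', κ' ≡ keyE e' [MOD kM] → 33 * κ' ≡ keyE (rot e') [MOD kM] :=
    fun e' κ' h => (h.mul_left 33).trans (rot_key e')
  have k1 := r _ _ hκ
  have k2 := r _ _ k1
  have k3 := r _ _ k2
  have k4 := r _ _ k3
  rw [hB e κ he hκ, hB _ _ (by rw [rot_deg, he]) k1, hB _ _ (by rw [rot_deg, rot_deg, he]) k2,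
    hB _ _ (by rw [rot_deg, rot_deg, rot_deg, he]) k3,
    hB _ _ (by rw [rot_deg, rot_deg, rot_deg, rot_deg, he]) k4]
  have z : ∀ c, c % 31 ≠ 7 → semB K (T (c % kM)) = 0 := by
    intro c hc
    rw [hT, semB_zero]
    rwa [kM_mod31]
  have m2 : 33 * (33 * κ) = 1089 * κ := by ring
  have m3 : 33 * (1089 * κ) = 35937 * κ := by ring
  have m4 : 33 * (35937 * κ) = 1185921 * κ := by ring
  rw [m2, m3, m4]
  change _ = semB K (cond (Nat.beq (κ % 31) 7) (T (κ % kM)) (cond (Nat.beq (κ % 31) 19)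
    (T (33 * κ % kM)) (cond (Nat.beq (κ % 31) 25) (T (1089 * κ % kM)) (cond (Nat.beq (κ % 31) 28)
    (T (35937 * κ % kM)) (cond (Nat.beq (κ % 31) 14) (T (1185921 * κ % kM)) 0)))))
  have hbeq : ∀ a b : ℕ, Nat.beq a b = decide (a = b) := by
    intro a b
    by_cases h : a = b
    · subst h; simp
    · rw [decide_eq_false h]
      cases hc : Nat.beq a b
      · rfl
      · exact absurd (Nat.eq_of_beq_eq_true hc) h
  simp only [hbeq]
  by_cases c0 : κ % 31 = 7
  · rw [z (33 * κ) (by omega), z (1089 * κ) (by omega), z (35937 * κ) (by omega),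
      z (1185921 * κ) (by omega)]
    simp [c0]
  by_cases c1 : κ % 31 = 19
  · rw [z κ (by omega), z (1089 * κ) (by omega), z (35937 * κ) (by omega),
      z (1185921 * κ) (by omega)]
    simp [c1]
  by_cases c2 : κ % 31 = 25
  · rw [z κ (by omega), z (33 * κ) (by omega), z (35937 * κ) (by omega),
      z (1185921 * κ) (by omega)]
    simp [c2]
  by_cases c3 : κ % 31 = 28
  · rw [z κ (by omega), z (33 * κ) (by omega), z (1089 * κ) (by omega),
      z (1185921 * κ) (by omega)]
    simp [c3]
  by_cases c4 : κ % 31 = 14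
  · rw [z κ (by omega), z (33 * κ) (by omega), z (1089 * κ) (by omega), z (35937 * κ) (by omega)]
    simp [c4]
  rw [z κ (by omega), z (33 * κ) (by omega), z (1089 * κ) (by omega), z (35937 * κ) (by omega),
      z (1185921 * κ) (by omega)]
  simp [c0, c1, c2, c3, c4, semB_zero]

/-- exponent vector of a key -/
def exK (o : ℕ) : Fin 5 →₀ ℕ := ex5 (dg o 0) (dg o 1) (dg o 2) (dg o 3) (dg o 4)

theorem exK_keyE (e : Fin 5 →₀ ℕ) (he : ∀ i, e i < 33) : exK (keyE e) = e := by
  obtain ⟨h0, h1, h2, h3, h4⟩ := dg_key5 (e 0) (e 1) (e 2) (e 3) (e 4) (he 0) (he 1) (he 2) (he 3)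
    (he 4)
  unfold exK keyE
  rw [h0, h1, h2, h3, h4]
  ext i
  fin_cases i <;> rfl

theorem BFu (h2 : (2 : K) = 0) (T : ℕ → ℕ) (d : ℕ) (hd : d ≤ 31)
    (hT : ∀ x, x % 31 ≠ 7 → T x = 0) (o j : ℕ) (ho : (exK o).degree = d) (hk : keyE (exK o) = o)
    (hu : uChk1 T o j = true) :
    BF K T d (NS (glA (mU K) (monomial (exK o) 1))) = semB K (1 <<< j) := by
  have := u_sem h2 (semB K) (semB_xor h2) (leafU T) d (BF K T d ∘ₗ NSl)
    (fun e κ he hκ => BFN_mon T d hT e κ he hκ) (exK o)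
    (fun i => by have := le_degree5 (exK o) i; omega) ho
  change BF K T d (NS (glA (mU K) (monomial (exK o) 1))) = _ at this
  rw [this, hk]
  have h := Nat.eq_of_beq_eq_true hu
  congr 1

end zmain2
section zmain3
variable {K : Type*} [Field K]

def WZ (K : Type*) [Field K] : Submodule K (RK K) :=
  hG (sqZ K) ⊔ LinearMap.range (LinearMap.id + (glA (mS K)).toLinearMap)

theorem WZ_S (h2 : (2 : K) = 0) (x : RK K) : (WZ K).mkQ (glA (mS K) x) = (WZ K).mkQ x := by
  apply char2_swap h2
  rw [← map_add, Submodule.mkQ_apply, Submodule.Quotient.mk_eq_zero]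
  refine Submodule.mem_sup_right ⟨x, ?_⟩
  change x + glA (mS K) x = _
  rw [add_comm]

def qZ (K : Type*) [Field K] (O : List ℕ) (i : ℕ) : RK K ⧸ WZ K :=
  (WZ K).mkQ (monomial (exK (O.getD i 0)) 1)

def semQ (K : Type*) [Field K] (O : List ℕ) (m : ℕ) : RK K ⧸ WZ K :=
  ∑ i ∈ Finset.range O.length, if m.testBit i then qZ K O i else 0

theorem semQ_zero (O : List ℕ) : semQ K O 0 = 0 := by simp [semQ]

theorem semQ_xor (h2 : (2 : K) = 0) (O : List ℕ) (a b : ℕ) :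
    semQ K O (Nat.xor a b) = semQ K O a + semQ K O b := by
  unfold semQ
  rw [← Finset.sum_add_distrib]
  refine Finset.sum_congr rfl fun i _ => ?_
  change (if (a ^^^ b).testBit i then qZ K O i else 0) = _
  rw [Nat.testBit_xor]
  have := char2_add_self h2 (qZ K O i)
  cases a.testBit i <;> cases b.testBit i <;> simp [this]

theorem semQ_shift (O : List ℕ) (r : ℕ) (hr : r < O.length) :
    semQ K O (Nat.shiftLeft 1 r) = qZ K O r := by
  unfold semQ
  rw [Finset.sum_eq_single r]
  · change (if (1 <<< r).testBit r then _ else _) = _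
    simp
  · intro b _ hb
    change (if (1 <<< r).testBit b then _ else _) = _
    rw [if_neg]
    simp only [Nat.one_shiftLeft, Nat.testBit_two_pow]
    simpa using fun h => hb h.symm
  · intro h; simp at h; omega

def LZ (K : Type*) [Field K] (d : ℕ) : RK K →ₗ[K] RK K ⧸ WZ K :=
  (WZ K).mkQ ∘ₗ homogeneousComponent d

theorem LZ0 (d : ℕ) (e : Fin 5 →₀ ℕ) (he : e.degree ≠ d) : LZ K d (monomial e 1) = 0 := by
  have hm : (monomial e (1 : K)).IsHomogeneous e.degree := isHomogeneous_monomial 1 rfl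
  change (WZ K).mkQ (homogeneousComponent d _) = 0
  rw [homogeneousComponent_of_mem hm, if_neg (Ne.symm he), map_zero]

theorem LZ1 (d : ℕ) (e : Fin 5 →₀ ℕ) (he : e.degree = d) :
    LZ K d (monomial e 1) = (WZ K).mkQ (monomial e 1) := by
  have hm : (monomial e (1 : K)).IsHomogeneous e.degree := isHomogeneous_monomial 1 rfl
  change (WZ K).mkQ (homogeneousComponent d _) = _
  rw [homogeneousComponent_of_mem hm, if_pos he.symm]

theorem orb_spec (h2 : (2 : K) = 0) (R : ℕ → ℕ) (O : List ℕ) (d : ℕ) (hd : d ≤ 30)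
    (ho : enumA (orbChk1 R O d) (d + 1) 0 = true) (e : Fin 5 →₀ ℕ) (he : e.degree = d)
    (hw : keyE e % 31 = 0) :
    R (keyE e % kM) < O.length ∧ (WZ K).mkQ (monomial e 1) = qZ K O (R (keyE e % kM)) := by
  have hdeg := degree5 e
  have hc := enumA_spec _ _ _ ho (by omega) (e 0) (e 1) (e 2) (e 3) (e 4) (by omega) hw
  have hs : Nat.add (e 0) (Nat.add (e 1) (Nat.add (e 2) (Nat.add (e 3) (e 4)))) = d := by
    simp only [Nat.add_eq]; omega
  unfold orbChk1 at hc
  rw [hs, Nat.beq_refl, cond_true] at hc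
  change cond (Nat.ble (R (keyE e % kM) + 1) O.length) _ false = true at hc
  cases hb : Nat.ble (R (keyE e % kM) + 1) O.length with
  | false => rw [hb] at hc; exact absurd hc (by simp)
  | true =>
    rw [hb] at hc
    have hlt : R (keyE e % kM) < O.length := by rw [Nat.ble_eq] at hb; omega
    refine ⟨hlt, ?_⟩
    change (Nat.beq (O.getD (R (keyE e % kM)) 0) (keyE e) ||
      (Nat.beq (O.getD (R (keyE e % kM)) 0) (keyE (rot e)) ||
      (Nat.beq (O.getD (R (keyE e % kM)) 0) (keyE (rot (rot e))) ||
      (Nat.beq (O.getD (R (keyE e % kM)) 0) (keyE (rot (rot (rot e)))) ||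
      Nat.beq (O.getD (R (keyE e % kM)) 0) (keyE (rot (rot (rot (rot e)))))))))= true at hc
    unfold qZ
    have hr : ∀ e' : Fin 5 →₀ ℕ, e'.degree = d →
        Nat.beq (O.getD (R (keyE e % kM)) 0) (keyE e') = true →
        (WZ K).mkQ (monomial (exK (O.getD (R (keyE e % kM)) 0)) 1) =
          (WZ K).mkQ (monomial e' 1) := by
      intro e' h1 h2
      rw [Nat.eq_of_beq_eq_true h2, exK_keyE]
      intro i
      have := le_degree5 e' i
      omega
    have hσ : ∀ e' : Fin 5 →₀ ℕ, (WZ K).mkQ (monomial (rot e') 1) = (WZ K).mkQ (monomial e' 1) := by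
      intro e'
      rw [← gS_mon, WZ_S h2]
    have d1 : (rot e).degree = d := by rw [rot_deg, he]
    have d2 : (rot (rot e)).degree = d := by rw [rot_deg, d1]
    have d3 : (rot (rot (rot e))).degree = d := by rw [rot_deg, d2]
    have d4 : (rot (rot (rot (rot e)))).degree = d := by rw [rot_deg, d3]
    simp only [Bool.or_eq_true] at hc
    rcases hc with h | h | h | h | h
    · rw [hr _ he h]
    · rw [hr _ d1 h, hσ]
    · rw [hr _ d2 h, hσ, hσ]
    · rw [hr _ d3 h, hσ, hσ, hσ]
    · rw [hr _ d4 h, hσ, hσ, hσ, hσ]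

theorem gen_spec (h2 : (2 : K) = 0) (R : ℕ → ℕ) (O : List ℕ) (d : ℕ) (hd : d ≤ 30)
    (ho : enumA (orbChk1 R O d) (d + 1) 0 = true) (g : ℕ) (hg : genOk d g = true) :
    semQ K O (genVal R g) = 0 := by
  unfold genOk at hg
  simp only [Bool.and_eq_true] at hg
  obtain ⟨h1, h3, h4⟩ := hg
  replace h1 : 1 ≤ g % 32 := by rw [Nat.ble_eq] at h1; exact h1
  replace h3 := Nat.eq_of_beq_eq_true h3
  replace h4 : keyE (exK (Nat.div g 32)) % 31 = 0 := Nat.eq_of_beq_eq_true h4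
  have hdeg : (exK (Nat.div g 32)).degree + g % 32 = d := by
    unfold exK; rw [ex5_deg]; rw [← h3]; simp only [Nat.add_eq]
    change _ = _ + (_ + (_ + (_ + (_ + g % 32))))
    ring
  have ha : ∀ i, (exK (Nat.div g 32)) i < 32 := fun i => by
    have := le_degree5 (exK (Nat.div g 32)) i; omega
  have hs := hit_sem h2 (semQ K O) (semQ_xor h2 O) (semQ_zero O)
    (fun κ => Nat.shiftLeft 1 (R (Nat.mod κ kM))) d (LZ K d) _ ha (g % 32) hdeg ?_ (LZ0 d)
  · change _ = semQ K O (genVal R g) at hs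
    rw [← hs, hdeg]
    change (WZ K).mkQ (homogeneousComponent d _) = 0
    rw [homogeneousComponent_of_mem (homogeneousComponent_mem d _), if_pos rfl,
      Submodule.mkQ_apply, Submodule.Quotient.mk_eq_zero]
    exact Submodule.mem_sup_left (Submodule.subset_span ⟨_, _, h1, by rw [hdeg]⟩)
  · intro e κ he hκ hw
    have hw' : keyE e % 31 = 0 := by rw [← modEq31 hκ, hw, h4]
    obtain ⟨hlt, hq⟩ := orb_spec h2 R O d hd ho e he hw'
    rw [LZ1 d e he, hq]
    change _ = semQ K O (Nat.shiftLeft 1 (R (κ % kM)))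
    rw [hκ, semQ_shift _ _ hlt]

theorem xorAll_spec (h2 : (2 : K) = 0) (O : List ℕ) (f : ℕ → ℕ) (l : List ℕ)
    (h : ∀ g ∈ l, semQ K O (f g) = 0) : semQ K O (xorAll f l) = 0 := by
  induction l with
  | nil => exact semQ_zero O
  | cons g l ih =>
    change semQ K O (Nat.xor (f g) (xorAll f l)) = 0
    rw [semQ_xor h2, h g (by simp), ih fun g hg => h g (by simp [hg]), add_zero]

theorem top_bit (h2 : (2 : K) = 0) (O : List ℕ) (m i : ℕ) (hi : i < O.length)
    (hm : Nat.shiftRight m i = 1) (h0 : semQ K O m = 0) :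
    qZ K O i ∈ Submodule.span K (qZ K O '' {j | j < i}) := by
  have hb : ∀ j, i ≤ j → m.testBit j = decide (j = i) := by
    intro j hj
    obtain ⟨c, rfl⟩ := Nat.exists_eq_add_of_le hj
    have : (m >>> i).testBit c = m.testBit (i + c) := Nat.testBit_shiftRight ..
    rw [← this]
    have hm' : m >>> i = 1 := hm
    rw [hm']
    rcases c with _ | c
    · simp
    · simp [Nat.testBit_succ]
  unfold semQ at h0
  rw [← Finset.sum_erase_add _ _ (Finset.mem_range.2 hi), hb i le_rfl] at h0
  simp only [decide_true, if_true] at h0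
  rw [← char2_swap h2 h0]
  refine Submodule.sum_mem _ fun j hj => ?_
  split_ifs with hbit
  · apply Submodule.subset_span
    refine ⟨j, ?_, rfl⟩
    by_contra hji
    rw [hb j (by simpa using hji)] at hbit
    simp at hbit hj
    exact hj.1 hbit
  · exact zero_mem _

theorem step_spec (h2 : (2 : K) = 0) (R : ℕ → ℕ) (O : List ℕ) (d : ℕ) (hd : d ≤ 30)
    (ho : enumA (orbChk1 R O d) (d + 1) 0 = true) (st : List (List ℕ)) :
    ∀ i, stepChk R d st i = true → ∀ j, i ≤ j → j < i + st.length → j < O.length →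
      qZ K O j ∈ Submodule.span K (qZ K O '' {k | k < j}) := by
  induction st with
  | nil => intro i _ j h1 h2; simp at h2; omega
  | cons l st ih =>
    intro i h j hj hj2 hjO
    change cond (l.all (genOk d)) (cond (Nat.beq (Nat.shiftRight (xorAll (genVal R) l) i) 1)
      (stepChk R d st (i + 1)) false) false = true at h
    cases hl : l.all (genOk d) with
    | false => rw [hl] at h; exact absurd h (by simp)
    | true =>
      rw [hl, cond_true] at h
      cases hb : Nat.beq (Nat.shiftRight (xorAll (genVal R) l) i) 1 with
      | false => rw [hb] at h; exact absurd h (by simp)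
      | true =>
        rw [hb, cond_true] at h
        rcases Nat.eq_or_lt_of_le hj with rfl | hlt
        · refine top_bit h2 O _ _ hjO (Nat.eq_of_beq_eq_true hb) ?_
          refine xorAll_spec h2 O _ _ fun g hg => ?_
          exact gen_spec h2 R O d hd ho g (List.all_eq_true.1 hl g hg)
        · exact ih (i + 1) h j hlt (by simp at hj2; omega) hjO

theorem span_spec (h2 : (2 : K) = 0) (R : ℕ → ℕ) (O : List ℕ) (d n : ℕ) (hd : d ≤ 30)
    (ho : enumA (orbChk1 R O d) (d + 1) 0 = true) (st : List (List ℕ))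
    (hst : stepChk R d st n = true) (hlen : O.length ≤ n + st.length) (i : ℕ)
    (hi : i < O.length) : qZ K O i ∈ Submodule.span K (Set.range fun j : Fin n => qZ K O j) := by
  induction i using Nat.strong_induction_on with
  | _ i ih =>
    by_cases hin : i < n
    · exact Submodule.subset_span ⟨⟨i, hin⟩, rfl⟩
    · have := step_spec h2 R O d hd ho st n hst i (by omega) (by omega) hi
      refine (Submodule.span_le.2 ?_) this
      rintro _ ⟨k, hk, rfl⟩
      exact ih k hk (lt_trans hk hi)

theorem zmain (h2 : (2 : K) = 0) (ζ : K) (hord : orderOf ζ = 31) (T R : ℕ → ℕ) (O : List ℕ)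
    (st : List (List ℕ)) (d n : ℕ) (hd : d ≤ 30)
    (hT : ∀ x, x % 31 ≠ 7 → T x = 0) (hf : enumA (funChk1 T d) d 7 = true)
    (ho : enumA (orbChk1 R O d) (d + 1) 0 = true)
    (hst : stepChk R d st n = true) (hlen : O.length ≤ n + st.length)
    (hu : uChk T O n = true)
    (hO : ∀ j < n, (exK (O.getD j 0)).degree = d ∧ keyE (exK (O.getD j 0)) = O.getD j 0)
    (F : RK K) (hF : F.IsHomogeneous d) (hFL : glA (mL ζ) F + F ∈ hG (sqZ K))
    (hFS : glA (mS K) F + F ∈ hG (sqZ K)) (hFU : glA (mU K) F + F ∈ hG (sqZ K)) :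
    F ∈ hG (sqZ K) := by
  have hF0 := weight0 h2 ζ hord F hFL
  set F0 := ∑ e ∈ F.support with keyE e % 31 = 0, monomial e (coeff e F) with hF0def
  have tr : ∀ g : RK K →ₐ[K] RK K, (∀ x ∈ hG (sqZ K), g x ∈ hG (sqZ K)) →
      g F + F ∈ hG (sqZ K) → g F0 + F0 ∈ hG (sqZ K) := by
    intro g hg h
    have := add_mem (add_mem (hg _ hF0) h) hF0
    have e : g (F0 + F) + (g F + F) + (F0 + F) = g F0 + F0 + ((g F + g F) + (F + F)) := by
      rw [map_add]; ring
    rwa [e, char2_add_self h2, char2_add_self h2, add_zero, add_zero] at this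
  have hS := tr _ (fun x hx => stabS hx) hFS
  have hU := tr _ (fun x hx => stabU h2 hx) hFU
  have hmon : ∀ (e : Fin 5 →₀ ℕ) (c : K), (monomial e c) = c • (monomial e (1 : K)) := by
    intro e c; rw [smul_monomial, smul_eq_mul, mul_one]
  -- the class of F0 lies in the span of the first `n` orbit classes
  have hspan : (WZ K).mkQ F0 ∈ Submodule.span K (Set.range fun j : Fin n => qZ K O j) := by
    rw [hF0def, map_sum]
    refine Submodule.sum_mem _ fun e he => ?_
    rw [Finset.mem_filter] at he
    have hdeg : e.degree = d := by
      have := hF (mem_support_iff.1 he.1)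
      rw [Finsupp.degree_eq_weight_one]
      exact this
    obtain ⟨hlt, hq⟩ := orb_spec h2 R O d hd ho e hdeg he.2
    rw [hmon, map_smul, hq]
    exact Submodule.smul_mem _ _ (span_spec h2 R O d n hd ho st hst hlen _ hlt)
  obtain ⟨c, hc⟩ := (Submodule.mem_span_range_iff_exists_fun K).1 hspan
  -- the dual functionals
  let M : RK K →ₗ[K] (ℕ → K) := BF K T d ∘ₗ NSl ∘ₗ (glA (mU K)).toLinearMap
  have hMdef : ∀ x, M x = BF K T d (NS (glA (mU K) x)) := fun x => rfl
  have hMW : WZ K ≤ LinearMap.ker M := by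
    refine sup_le ?_ ?_
    · intro x hx
      rw [LinearMap.mem_ker, hMdef]
      exact BF_hit h2 T d (by omega) hT hf (NS_stab (stabU h2 hx))
    · rintro _ ⟨x, rfl⟩
      change M (x + glA (mS K) x) = 0
      rw [map_add, hMdef, hMdef, ← SU, NS_S, char2_add_self h2]
  let M' := (WZ K).liftQ M hMW
  have hMq : ∀ j : Fin n, M' (qZ K O j) = semB K (1 <<< (j : ℕ)) := by
    intro j
    change M (monomial (exK (O.getD j 0)) 1) = _
    rw [hMdef]
    exact BFu h2 T d (by omega) hT _ _ (hO j j.2).1 (hO j j.2).2 (allLt_iff _ _ hu j j.2)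
  have hMF : M F0 = 0 := by
    have h1 : BF K T d (NS (glA (mU K) F0 + F0)) = 0 :=
      BF_hit h2 T d (by omega) hT hf (NS_stab hU)
    have h3 : BF K T d (NS F0) = 0 := by
      change (BF K T d ∘ₗ NSl) F0 = 0
      rw [hF0def, map_sum]
      refine Finset.sum_eq_zero fun e he => ?_
      rw [Finset.mem_filter] at he
      rw [hmon, map_smul]
      change _ • BF K T d (NS (monomial e 1)) = 0
      have w1 := modEq31 (rot_key e)
      have w2 := modEq31 (rot_key (rot e))
      have w3 := modEq31 (rot_key (rot (rot e)))
      have w4 := modEq31 (rot_key (rot (rot (rot e))))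
      have w0 := he.2
      simp only [NS, gS_mon, map_add]
      rw [BF_weight T d hT, BF_weight T d hT, BF_weight T d hT, BF_weight T d hT,
        BF_weight T d hT] <;> first | omega | simp
    have h4 : NS (glA (mU K) F0 + F0) = NS (glA (mU K) F0) + NS F0 := map_add NSl _ _
    rw [h4, map_add, h3, add_zero] at h1
    exact h1
  have hczero : ∀ i : Fin n, c i = 0 := by
    intro i
    have h1 : M' ((WZ K).mkQ F0) = 0 := hMF
    rw [← hc, map_sum] at h1
    have h3 := congrFun h1 i
    rw [Finset.sum_apply] at h3
    rw [Finset.sum_eq_single i] at h3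
    · rw [map_smul, hMq] at h3
      simpa [semB] using h3
    · intro j _ hji
      rw [map_smul, hMq]
      have : (j : ℕ) ≠ (i : ℕ) := fun h => hji (Fin.ext h)
      simp [semB, Nat.one_shiftLeft, Nat.testBit_two_pow, this]
    · simp
  have hF0W : F0 ∈ WZ K := by
    rw [← Submodule.Quotient.mk_eq_zero, ← Submodule.mkQ_apply, ← hc]
    exact Finset.sum_eq_zero fun i _ => by rw [hczero, zero_smul]
  obtain ⟨y, hy, z, ⟨x, rfl⟩, hyz⟩ := Submodule.mem_sup.1 hF0W
  change y + (x + glA (mS K) x) = F0 at hyz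
  have hN : NS F0 = NS y := by
    have a1 : ∀ a b : RK K, NS (a + b) = NS a + NS b := fun a b => map_add NSl a b
    rw [← hyz, a1, a1, NS_S, char2_add_self h2, add_zero]
  have h5 := NS_inv h2 hS
  rw [hN] at h5
  have h6 : F0 ∈ hG (sqZ K) := by
    have := add_mem h5 (NS_stab hy)
    rwa [add_right_comm, char2_add_self h2, zero_add] at this
  have := add_mem hF0 h6
  rwa [add_right_comm, char2_add_self h2, zero_add] at this

end zmain3

theorem lamT_w (L p : ℕ) : ∀ x, x % 31 ≠ 7 → lamT L p 7 x = 0 := by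
  intro x hx
  have : Nat.beq (Nat.mod x 31) 7 = false := by
    cases hc : Nat.beq (Nat.mod x 31) 7
    · rfl
    · exact absurd (Nat.eq_of_beq_eq_true hc) hx
  unfold lamT
  rw [this, cond_false]

def keyChk (d o : ℕ) : Bool :=
  decide (dg o 0 + dg o 1 + dg o 2 + dg o 3 + dg o 4 = d) &&
    decide (key5 (dg o 0) (dg o 1) (dg o 2) (dg o 3) (dg o 4) = o)

theorem keyChk_spec {d o : ℕ} (h : keyChk d o = true) :
    (exK o).degree = d ∧ keyE (exK o) = o := by
  unfold keyChk at h
  rw [Bool.and_eq_true, decide_eq_true_iff, decide_eq_true_iff] at h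
  exact ⟨by rw [exK, ex5_deg]; exact h.1, h.2⟩

theorem exists_zeta : ∃ ζ : AlgebraicClosure (ZMod 2), ζ ^ 5 = ζ ^ 2 + 1 := by
  obtain ⟨z, hz⟩ := IsAlgClosed.exists_root
    (Polynomial.X ^ 5 + (Polynomial.X ^ 2 + 1) : Polynomial (AlgebraicClosure (ZMod 2))) (by
      have : (Polynomial.X ^ 5 + (Polynomial.X ^ 2 + 1) :
        Polynomial (AlgebraicClosure (ZMod 2))).degree = 5 := by compute_degree!
      rw [this]; decide)
  refine ⟨z, ?_⟩
  have h2 : (2 : AlgebraicClosure (ZMod 2)) = 0 := by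
    have := CharP.cast_eq_zero (AlgebraicClosure (ZMod 2)) 2
    exact_mod_cast this
  simp [Polynomial.IsRoot] at hz
  exact char2_swap h2 hz

theorem base25 (f : P 5) (hf : f.IsHomogeneous 25)
    (hinv : ∀ g : Matrix.GeneralLinearGroup (Fin 5) (ZMod 2), glAct (↑g) f + f ∈ hitS 5) :
    f ∈ hitS 5 := by
  obtain ⟨ζ, hz⟩ := exists_zeta
  have h2 : (2 : AlgebraicClosure (ZMod 2)) = 0 := by
    have := CharP.cast_eq_zero (AlgebraicClosure (ZMod 2)) 2
    exact_mod_cast this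
  refine transfer h2 ζ hz 25 (fun F h1 h3 h4 h5 => ?_) f hf hinv
  refine zmain h2 ζ (zeta_ord h2 ζ hz) _ _ ords25 steps25 25 8 (by norm_num) (lamT_w _ _) fun25
    orb25 step25 (by decide +kernel) u25 ?_ F h1 h3 h4 h5
  have : allLt (fun j => keyChk 25 (ords25.getD j 0)) 8 = true := by decide +kernel
  exact fun j hj => keyChk_spec (allLt_iff _ _ this j hj)

theorem base10 (f : P 5) (hf : f.IsHomogeneous 10)
    (hinv : ∀ g : Matrix.GeneralLinearGroup (Fin 5) (ZMod 2), glAct (↑g) f + f ∈ hitS 5) :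
    f ∈ hitS 5 := by
  obtain ⟨ζ, hz⟩ := exists_zeta
  have h2 : (2 : AlgebraicClosure (ZMod 2)) = 0 := by
    have := CharP.cast_eq_zero (AlgebraicClosure (ZMod 2)) 2
    exact_mod_cast this
  refine transfer h2 ζ hz 10 (fun F h1 h3 h4 h5 => ?_) f hf hinv
  refine zmain h2 ζ (zeta_ord h2 ζ hz) _ _ ords10 steps10 10 2 (by norm_num) (lamT_w _ _) fun10
    orb10 step10 (by decide +kernel) u10 ?_ F h1 h3 h4 h5
  have : allLt (fun j => keyChk 10 (ords10.getD j 0)) 2 = true := by decide +kernel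
  exact fun j hj => keyChk_spec (allLt_iff _ _ this j hj)
section kameko

theorem p2_add_self (p : P 5) : p + p = 0 := char2_add_self (K := ZMod 2) (by decide) p

theorem zmod2_cases (c : ZMod 2) : c = 0 ∨ c = 1 := by
  fin_cases c
  · left; rfl
  · right; rfl

theorem psi_mon (a : Fin 5 →₀ ℕ) : psi (monomial a 1) =
    if ∀ j, Odd (a j) then monomial (Finsupp.mapRange (· / 2) (Nat.zero_div 2) a) 1 else 0 := by
  have := (basisMonomials (Fin 5) (ZMod 2)).constr_basis (ZMod 2)
    (fun a => if ∀ j, Odd (a j) then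
      (monomial (Finsupp.mapRange (· / 2) (Nat.zero_div 2) a) 1 : P 5) else 0) a
  rwa [coe_basisMonomials] at this

theorem mon_smul2 (e : Fin 5 →₀ ℕ) (c : ZMod 2) :
    (monomial e c : P 5) = c • (monomial e (1 : ZMod 2)) := by
  rw [smul_monomial, smul_eq_mul, mul_one]

theorem sq_add2 (p q : P 5) : (p + q) ^ 2 = p ^ 2 + q ^ 2 := CharTwo.add_sq p q

theorem smul_sq2 (c : ZMod 2) (p : P 5) : (c • p) ^ 2 = c • p ^ 2 := by
  rw [smul_pow]; rcases zmod2_cases c with rfl | rfl <;> simp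

theorem psi_mul_sq (p q : P 5) : psi (p * q ^ 2) = psi p * q := by
  induction q using MvPolynomial.induction_on' with
  | add q r hq hr => rw [sq_add2, mul_add, map_add, hq, hr, mul_add]
  | monomial b c =>
    rw [mon_smul2, smul_sq2, mul_smul_comm, map_smul, mul_smul_comm]
    congr 1
    induction p using MvPolynomial.induction_on' with
    | add p r hp hr => rw [add_mul, map_add, hp, hr, map_add, add_mul]
    | monomial a c =>
      rw [mon_smul2 a, smul_mul_assoc, map_smul, map_smul, smul_mul_assoc]
      congr 1
      rw [monomial_pow, monomial_mul, one_pow, one_mul, psi_mon, psi_mon]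
      have hodd : (∀ j, Odd ((a + 2 • b) j)) ↔ ∀ j, Odd (a j) := by
        refine forall_congr' fun j => ?_
        simp only [Finsupp.add_apply, Finsupp.smul_apply, smul_eq_mul]
        rw [Nat.odd_add]
        simp
      by_cases h : ∀ j, Odd (a j)
      · rw [if_pos h, if_pos (hodd.2 h), monomial_mul, one_mul]
        have he : Finsupp.mapRange (· / 2) (Nat.zero_div 2) (a + 2 • b) =
            Finsupp.mapRange (· / 2) (Nat.zero_div 2) a + b := by
          ext j
          simp
          try omega
        rw [he]
      · rw [if_neg h, if_neg (fun h' => h (hodd.1 h')), zero_mul]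

/-- squarefree monomials -/
def XT (T : Finset (Fin 5)) : P 5 := ∏ t ∈ T, X t

def indT (T : Finset (Fin 5)) : Fin 5 →₀ ℕ := ∑ t ∈ T, Finsupp.single t 1

theorem indT_apply (T : Finset (Fin 5)) (j : Fin 5) : indT T j = if j ∈ T then 1 else 0 := by
  rw [indT, Finsupp.finsetSum_apply]
  simp [Finsupp.single_apply]

theorem XT_eq (T : Finset (Fin 5)) : XT T = monomial (indT T) 1 := by
  rw [XT, indT, monomial_sum_one]
  rfl

theorem XT_homog (T : Finset (Fin 5)) : (XT T).IsHomogeneous T.card := by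
  have := IsHomogeneous.prod T (fun t => (X t : P 5)) (fun _ => 1)
    (fun t _ => isHomogeneous_X (ZMod 2) t)
  unfold XT
  simpa using this

theorem psi_XT (T : Finset (Fin 5)) : psi (XT T) = if T = Finset.univ then 1 else 0 := by
  rw [XT_eq, psi_mon]
  by_cases h : T = Finset.univ
  · subst h
    rw [if_pos rfl, if_pos (fun j => by rw [indT_apply]; simp)]
    rw [show Finsupp.mapRange (· / 2) (Nat.zero_div 2) (indT Finset.univ) = 0 by
      ext j; simp [indT_apply]]
    rfl
  · rw [if_neg h, if_neg]
    intro h'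
    apply h
    ext j
    have := h' j
    rw [indT_apply] at this
    by_contra hc
    simp at hc
    simp [hc] at this

def oddT (a : Fin 5 →₀ ℕ) : Finset (Fin 5) := Finset.univ.filter fun j => Odd (a j)

def half (a : Fin 5 →₀ ℕ) : Fin 5 →₀ ℕ := Finsupp.mapRange (· / 2) (Nat.zero_div 2) a

theorem mon_decomp (a : Fin 5 →₀ ℕ) :
    (monomial a 1 : P 5) = XT (oddT a) * (monomial (half a) 1) ^ 2 := by
  rw [XT_eq, monomial_pow, monomial_mul, one_pow, one_mul]
  have he : indT (oddT a) + 2 • half a = a := by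
    ext j
    simp only [Finsupp.add_apply, indT_apply, Finsupp.smul_apply, half, Finsupp.mapRange_apply,
      oddT, Finset.mem_filter, Finset.mem_univ, true_and, smul_eq_mul, Nat.odd_iff]
    split_ifs <;> omega
  rw [he]

theorem decomp_deg (a : Fin 5 →₀ ℕ) : a.degree = (oddT a).card + 2 * (half a).degree := by
  have h1 : (monomial a (1 : ZMod 2)).IsHomogeneous a.degree := isHomogeneous_monomial 1 rfl
  have h2 : (monomial (half a) (1 : ZMod 2)).IsHomogeneous (half a).degree :=
    isHomogeneous_monomial 1 rfl
  have h3 := (XT_homog (oddT a)).mul (h2.pow 2)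
  rw [← mon_decomp] at h3
  rw [h1.inj_right h3 (by simp)]
  ring

/-! commutation of `psi` with `Sq` -/

theorem sq_X (i : Fin 5) : sqTot 5 (X i) = X i + X i ^ 2 := by simp [sqTot]

theorem psi_sqXT (T : Finset (Fin 5)) : psi (sqTot 5 (XT T)) = psi (XT T) := by
  rw [psi_XT, XT, map_prod]
  simp only [sq_X]
  rw [Finset.prod_add, map_sum]
  have : ∀ S ∈ T.powerset, psi ((∏ t ∈ S, X t) * ∏ t ∈ T \ S, X t ^ 2) =
      if S = Finset.univ then 1 else 0 := by
    intro S hS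
    rw [Finset.prod_pow, psi_mul_sq]
    change psi (XT S) * _ = _
    rw [psi_XT]
    split_ifs with h
    · subst h
      rw [one_mul]
      rw [show T \ Finset.univ = ∅ by simp]
      simp
    · simp
  rw [Finset.sum_congr rfl this, Finset.sum_ite_eq']
  congr 1
  simp

theorem psi_sq (p : P 5) : psi (sqTot 5 p) = sqTot 5 (psi p) := by
  induction p using MvPolynomial.induction_on' with
  | add p q hp hq => simp only [map_add, hp, hq]
  | monomial a c =>
    rw [mon_smul2, map_smul, map_smul, map_smul, map_smul]
    congr 1
    rw [mon_decomp, map_mul, map_pow, psi_mul_sq, psi_mul_sq, map_mul, psi_sqXT, psi_XT]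
    split_ifs <;> simp

theorem psi_homComp (n q : ℕ) (h : n = 2 * q + 5) (p : P 5) :
    psi (homogeneousComponent n p) = homogeneousComponent q (psi p) := by
  induction p using MvPolynomial.induction_on' with
  | add p q hp hq => simp only [map_add, hp, hq]
  | monomial a c =>
    rw [mon_smul2, map_smul, map_smul, map_smul, map_smul]
    congr 1
    have h1 : (monomial a (1 : ZMod 2)).IsHomogeneous a.degree := isHomogeneous_monomial 1 rfl
    rw [homogeneousComponent_of_mem h1]
    by_cases hT : oddT a = Finset.univ
    · have hd := decomp_deg a
      rw [hT, Finset.card_univ, Fintype.card_fin] at hd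
      have hp : psi (monomial a 1) = monomial (half a) 1 := by
        rw [mon_decomp, psi_mul_sq, psi_XT, if_pos hT, one_mul]
      have h2 : (monomial (half a) (1 : ZMod 2)).IsHomogeneous (half a).degree :=
        isHomogeneous_monomial 1 rfl
      rw [hp, homogeneousComponent_of_mem h2]
      by_cases hn : n = a.degree
      · rw [if_pos hn, if_pos (by omega), hp]
      · rw [if_neg hn, if_neg (by omega), map_zero]
    · have hp : psi (monomial a 1) = 0 := by
        rw [mon_decomp, psi_mul_sq, psi_XT, if_neg hT, zero_mul]
      rw [hp, map_zero]
      split_ifs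
      · exact hp
      · simp

theorem psi_homComp0 (n : ℕ) (h : ∀ q, n ≠ 2 * q + 5) (p : P 5) :
    psi (homogeneousComponent n p) = 0 := by
  induction p using MvPolynomial.induction_on' with
  | add p q hp hq => simp only [map_add, hp, hq, add_zero]
  | monomial a c =>
    rw [mon_smul2, map_smul, map_smul]
    have h1 : (monomial a (1 : ZMod 2)).IsHomogeneous a.degree := isHomogeneous_monomial 1 rfl
    rw [homogeneousComponent_of_mem h1]
    split_ifs with hn
    · have hT : oddT a ≠ Finset.univ := by
        intro hT
        have hd := decomp_deg a
        rw [hT, Finset.card_univ, Fintype.card_fin] at hd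
        exact h (half a).degree (by omega)
      rw [mon_decomp, psi_mul_sq, psi_XT, if_neg hT, zero_mul, smul_zero]
    · simp

theorem psi_homog0 (n : ℕ) (h : ∀ q, n ≠ 2 * q + 5) {p : P 5} (hp : p.IsHomogeneous n) :
    psi p = 0 := by
  have := psi_homComp0 n h p
  rwa [homogeneousComponent_of_mem hp, if_pos rfl] at this

theorem psi_homog (n q : ℕ) (h : n = 2 * q + 5) {p : P 5} (hp : p.IsHomogeneous n) :
    (psi p).IsHomogeneous q := by
  have := psi_homComp n q h p
  rw [homogeneousComponent_of_mem hp, if_pos rfl] at this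
  rw [this]
  exact homogeneousComponent_isHomogeneous q _

theorem psi_hit {p : P 5} (hp : p ∈ hG (sqTot 5)) : psi p ∈ hG (sqTot 5) := by
  induction hp using Submodule.span_induction with
  | zero => simp
  | add x y _ _ hx hy => rw [map_add]; exact add_mem hx hy
  | smul c x _ hx => rw [map_smul]; exact Submodule.smul_mem _ _ hx
  | mem x hx =>
    obtain ⟨a, k, hk, rfl⟩ := hx
    by_cases hn : ∃ q, a.degree + k = 2 * q + 5
    · obtain ⟨q, hq⟩ := hn
      rw [psi_homComp _ q hq, psi_sq]
      have h1 : (monomial a (1 : ZMod 2)).IsHomogeneous a.degree := isHomogeneous_monomial 1 rfl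
      by_cases hm : ∃ r, a.degree = 2 * r + 5
      · obtain ⟨r, hr⟩ := hm
        have h2 := psi_homog _ r hr h1
        have := hG_homog (sqTot 5) (D := r) (k := q - r) (by omega) h2
        rwa [show r + (q - r) = q by omega] at this
      · rw [psi_homog0 _ (fun q hq => hm ⟨q, hq⟩) h1]
        simp
    · rw [psi_homComp0 _ (fun q hq => hn ⟨q, hq⟩)]
      exact zero_mem _

/-! commutation of `psi` with linear substitutions -/

theorem psi_gl_aux (A : Matrix (Fin 5) (Fin 5) (ZMod 2)) : ∃ c : ZMod 2, ∀ p : P 5,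
    psi (glA A p) = c • glA A (psi p) := by
  have h0 : (psi (glA A (XT Finset.univ))).IsHomogeneous 0 :=
    psi_homog 5 0 rfl (glA_homog A (by simpa using XT_homog Finset.univ))
  obtain ⟨c, hc⟩ : ∃ c : ZMod 2, psi (glA A (XT Finset.univ)) = C c := by
    refine ⟨_, (totalDegree_eq_zero_iff_eq_C.1 ?_)⟩
    exact Nat.le_zero.1 h0.totalDegree_le
  refine ⟨c, fun p => ?_⟩
  induction p using MvPolynomial.induction_on' with
  | add p q hp hq => simp only [map_add, hp, hq, smul_add]
  | monomial a b =>
    rw [mon_smul2, map_smul, map_smul, map_smul, map_smul, smul_comm c]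
    congr 1
    rw [mon_decomp, map_mul, map_pow, psi_mul_sq, psi_mul_sq, psi_XT]
    by_cases hT : oddT a = Finset.univ
    · rw [hT, hc, if_pos rfl, one_mul, smul_eq_C_mul]
    · rw [if_neg hT, zero_mul, map_zero, smul_zero]
      have : (oddT a).card < 5 := by
        have := Finset.card_lt_univ_of_notMem (s := oddT a)
          (x := (not_forall.1 (fun h => hT (Finset.eq_univ_iff_forall.2 h))).choose)
          (not_forall.1 (fun h => hT (Finset.eq_univ_iff_forall.2 h))).choose_spec
        simpa using this
      rw [psi_homog0 (oddT a).card (fun q => by omega) (glA_homog A (XT_homog _)), zero_mul]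

theorem psi_gl (g : Matrix.GeneralLinearGroup (Fin 5) (ZMod 2)) (p : P 5) :
    psi (glA (↑g) p) = glA (↑g) (psi p) := by
  obtain ⟨c, hc⟩ := psi_gl_aux (↑g)
  obtain ⟨c', hc'⟩ := psi_gl_aux (↑g⁻¹)
  have h1 : glA (K := ZMod 2) (↑g⁻¹) (glA (↑g) (XT Finset.univ)) = XT Finset.univ := by
    have := DFunLike.congr_fun (glA_mul (K := ZMod 2) (↑g⁻¹) (↑g)) (XT Finset.univ)
    rw [AlgHom.comp_apply] at this
    rw [this, ← Units.val_mul, mul_inv_cancel, Units.val_one, glA_one]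
    rfl
  have h2 := hc' (glA (↑g) (XT Finset.univ))
  rw [h1, hc, psi_XT, if_pos rfl, map_smul, map_one, map_one] at h2
  rcases zmod2_cases c with rfl | rfl
  · simp at h2
  · rw [hc, one_smul]

end kameko
section kameko2

/-- all terms of degree at least `d` -/
def Hi (d : ℕ) (p : P 5) : Prop := ∀ e : Fin 5 →₀ ℕ, e.degree < d → coeff e p = 0

theorem Hi_mul {d d' : ℕ} {p q : P 5} (hp : Hi d p) (hq : Hi d' q) : Hi (d + d') (p * q) := by
  intro e he
  rw [coeff_mul]
  refine Finset.sum_eq_zero fun x hx => ?_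
  have hs : x.1.degree + x.2.degree = e.degree := by
    rw [← map_add, Finset.HasAntidiagonal.mem_antidiagonal.1 hx]
  by_cases h : x.1.degree < d
  · rw [hp _ h, zero_mul]
  · rw [hq x.2 (by omega), mul_zero]

theorem Hi_zero (p : P 5) : Hi 0 p := fun _ h => absurd h (by omega)

theorem Hi_add {d : ℕ} {p q : P 5} (hp : Hi d p) (hq : Hi d q) : Hi d (p + q) := by
  intro e he
  rw [coeff_add, hp e he, hq e he, add_zero]

theorem Hi_homog {d : ℕ} {p : P 5} (hp : p.IsHomogeneous d) : Hi d p :=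
  fun e he => hp.coeff_eq_zero (by omega)

theorem Hi_comp {d n : ℕ} {p : P 5} (hp : Hi d p) (h : n < d) : homogeneousComponent n p = 0 := by
  ext e
  rw [coeff_homogeneousComponent, coeff_zero]
  split_ifs with he
  · exact hp e (by omega)
  · rfl

theorem sq_hi_mon (a : Fin 5 →₀ ℕ) : Hi a.degree (sqTot 5 (monomial a 1)) := by
  induction a using Finsupp.induction_linear with
  | zero => rw [map_zero]; exact Hi_zero _
  | add a b ha hb =>
    have : (monomial (a + b) 1 : P 5) = monomial a 1 * monomial b 1 := by
      rw [monomial_mul, one_mul]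
    rw [this, map_mul, map_add]
    exact Hi_mul ha hb
  | single i n =>
    rw [← X_pow_eq_monomial, map_pow, sq_X, Finsupp.degree_single]
    induction n with
    | zero => exact Hi_zero _
    | succ n ih =>
      rw [pow_succ]
      refine Hi_mul ih ?_
      refine Hi_add (Hi_homog (isHomogeneous_X _ _)) ?_
      rw [pow_two]
      exact Hi_mul (d := 1) (d' := 0) (Hi_homog (isHomogeneous_X _ _)) (Hi_zero _)

theorem sq_low {i n : ℕ} {h : P 5} (hh : h.IsHomogeneous i) (hn : n < i) :
    homogeneousComponent n (sqTot 5 h) = 0 := by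
  rw [h.as_sum, map_sum, map_sum]
  refine Finset.sum_eq_zero fun a ha => ?_
  have hd : a.degree = i := by
    have := hh (mem_support_iff.1 ha)
    rw [Finsupp.degree_eq_weight_one]
    exact this
  rw [mon_smul2, map_smul, map_smul, Hi_comp (sq_hi_mon a) (by omega), smul_zero]

/-- all terms of degree less than `d` -/
def Lo (d : ℕ) (p : P 5) : Prop := ∀ e : Fin 5 →₀ ℕ, d ≤ e.degree → coeff e p = 0

theorem Lo_mul {d d' : ℕ} {p q : P 5} (hp : Lo d p) (hq : Lo (d' + 1) q) :
    Lo (d + d') (p * q) := by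
  intro e he
  rw [coeff_mul]
  refine Finset.sum_eq_zero fun x hx => ?_
  have hs : x.1.degree + x.2.degree = e.degree := by
    rw [← map_add, Finset.HasAntidiagonal.mem_antidiagonal.1 hx]
  by_cases h : d ≤ x.1.degree
  · rw [hp _ h, zero_mul]
  · rw [hq x.2 (by omega), mul_zero]

theorem Lo_homog {d : ℕ} {p : P 5} (hp : p.IsHomogeneous d) : Lo (d + 1) p :=
  fun e he => hp.coeff_eq_zero (by omega)

theorem Lo_add {d : ℕ} {p q : P 5} (hp : Lo d p) (hq : Lo d q) : Lo d (p + q) := by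
  intro e he
  rw [coeff_add, hp e he, hq e he, add_zero]

theorem Lo_comp {d : ℕ} {p : P 5} (hp : Lo d p) : homogeneousComponent d p = 0 := by
  ext e
  rw [coeff_homogeneousComponent, coeff_zero]
  split_ifs with he
  · exact hp e (by omega)
  · rfl

theorem Lo_mono {d d' : ℕ} (h : d ≤ d') {p : P 5} (hp : Lo d p) : Lo d' p :=
  fun e he => hp e (by omega)

/-- `q` is the leading form of `p` in degree `d` -/
def LTop (d : ℕ) (p q : P 5) : Prop := q.IsHomogeneous d ∧ ∃ u, p = q + u ∧ Lo d u

theorem LTop_mul {d d' : ℕ} {p q p' q' : P 5} (h : LTop d p q) (h' : LTop d' p' q') :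
    LTop (d + d') (p * p') (q * q') := by
  obtain ⟨h1, u, rfl, hu⟩ := h
  obtain ⟨h1', u', rfl, hu'⟩ := h'
  refine ⟨h1.mul h1', u * q' + u' * q + u * u', by ring, ?_⟩
  refine Lo_add (Lo_add (Lo_mul hu (Lo_homog h1')) ?_) (Lo_mul hu (Lo_mono (by omega) hu'))
  rw [add_comm d d']
  exact Lo_mul hu' (Lo_homog h1)

theorem LTop_one : LTop 0 1 1 :=
  ⟨isHomogeneous_one _ _, 0, by simp, fun e _ => coeff_zero e⟩

theorem sq_top_mon (a : Fin 5 →₀ ℕ) :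
    LTop (2 * a.degree) (sqTot 5 (monomial a 1)) ((monomial a 1) ^ 2) := by
  induction a using Finsupp.induction_linear with
  | zero =>
    have : (monomial (0 : Fin 5 →₀ ℕ) (1 : ZMod 2)) = 1 := rfl
    rw [map_zero, this, map_one, one_pow]; exact LTop_one
  | add a b ha hb =>
    have : (monomial (a + b) 1 : P 5) = monomial a 1 * monomial b 1 := by
      rw [monomial_mul, one_mul]
    rw [this, map_mul, map_add, mul_add, mul_pow]
    exact LTop_mul ha hb
  | single i n =>
    rw [← X_pow_eq_monomial, map_pow, sq_X, Finsupp.degree_single]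
    induction n with
    | zero => simpa using LTop_one
    | succ n ih =>
      rw [pow_succ (X i + X i ^ 2), pow_succ (X i) n, mul_pow, mul_add]
      refine LTop_mul ih ?_
      exact ⟨by simpa using (isHomogeneous_X (ZMod 2) i).pow 2, X i, by ring,
        Lo_homog (isHomogeneous_X _ _)⟩

theorem sq_tele (t : Fin 5) (L : ℕ) :
    sqTot 5 (∑ i ∈ Finset.range L, X t ^ (2 ^ i)) = X t + X t ^ (2 ^ L) := by
  induction L with
  | zero => simp [p2_add_self]
  | succ L ih =>
    rw [Finset.sum_range_succ, map_add, ih, map_pow, sq_X, add_pow_char_pow, ← pow_mul,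
      ← pow_succ']
    rw [add_assoc, ← add_assoc (X t ^ 2 ^ L), p2_add_self, zero_add]

def CT (T : Finset (Fin 5)) (L : ℕ) : P 5 := ∏ t ∈ T, ∑ i ∈ Finset.range L, X t ^ (2 ^ i)

theorem sq_CT (T : Finset (Fin 5)) (L : ℕ) :
    ∃ u, sqTot 5 (CT T L) = XT T + u ∧ Hi (2 ^ L) u := by
  unfold CT XT
  rw [map_prod]
  simp only [sq_tele]
  induction T using Finset.induction_on with
  | empty => exact ⟨0, by simp, fun e _ => coeff_zero e⟩
  | insert t T ht ih =>
    obtain ⟨u, hu, hu'⟩ := ih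
    refine ⟨u * X t + X t ^ (2 ^ L) * (∏ t ∈ T, X t + u), ?_, ?_⟩
    · rw [Finset.prod_insert ht, Finset.prod_insert ht, hu]; ring
    · refine Hi_add (Hi_mul (d' := 0) hu' (Hi_zero _)) (Hi_mul (d' := 0) (Hi_homog ?_) (Hi_zero _))
      simpa using (isHomogeneous_X (ZMod 2) t).pow (2 ^ L)

/-- sums of `r` powers of two -/
def PS : ℕ → ℕ → Prop
  | 0, k => k = 0
  | r + 1, k => ∃ a k', k = 2 ^ a + k' ∧ PS r k'

theorem CT_supp (T : Finset (Fin 5)) (L : ℕ) (e : Fin 5 →₀ ℕ) (he : coeff e (CT T L) ≠ 0) :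
    PS T.card e.degree := by
  unfold CT at he
  induction T using Finset.induction_on generalizing e with
  | empty =>
    rw [Finset.prod_empty, coeff_one] at he
    have : e = 0 := by
      by_contra h
      exact he (if_neg (Ne.symm h))
    subst this
    exact map_zero _
  | insert t T ht ih =>
    rw [Finset.prod_insert ht, coeff_mul] at he
    obtain ⟨x, hx, hx'⟩ := Finset.exists_ne_zero_of_sum_ne_zero he
    have hs : x.1.degree + x.2.degree = e.degree := by
      rw [← map_add, Finset.HasAntidiagonal.mem_antidiagonal.1 hx]
    have h1 := left_ne_zero_of_mul hx'
    have h2 := ih x.2 (right_ne_zero_of_mul hx')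
    rw [coeff_sum] at h1
    obtain ⟨i, _, hi⟩ := Finset.exists_ne_zero_of_sum_ne_zero h1
    have hh : (X t ^ (2 ^ i) : P 5).IsHomogeneous (2 ^ i) := by
      simpa using (isHomogeneous_X (ZMod 2) t).pow (2 ^ i)
    have h3 : x.1.degree = 2 ^ i := by
      by_contra h
      exact hi (hh.coeff_eq_zero h)
    rw [Finset.card_insert_of_notMem ht]
    exact ⟨i, x.2.degree, by omega, h2⟩

theorem homComp_self {d : ℕ} {p : P 5} (hp : p.IsHomogeneous d) :
    homogeneousComponent d p = p := by
  rw [homogeneousComponent_of_mem hp, if_pos rfl]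

theorem hitA (T : Finset (Fin 5)) (b : Fin 5 →₀ ℕ) (hps : ¬ PS T.card (T.card + b.degree)) :
    XT T * (monomial b 1) ^ 2 ∈ hG (sqTot 5) := by
  set n := T.card + 2 * b.degree with hn
  have hy : (monomial b (1 : ZMod 2)).IsHomogeneous b.degree := isHomogeneous_monomial 1 rfl
  have key : homogeneousComponent n (sqTot 5 (CT T n * monomial b 1)) =
      XT T * (monomial b 1) ^ 2 := by
    obtain ⟨u, hu, hu'⟩ := sq_CT T n
    obtain ⟨hh, v, hv, hv'⟩ := sq_top_mon b
    rw [map_mul, hu, add_mul, map_add,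
      Hi_comp (Hi_mul (d' := 0) hu' (Hi_zero _)) Nat.lt_two_pow_self, add_zero, hv, mul_add,
      map_add, homComp_self ((XT_homog T).mul hh)]
    have : Lo n (XT T * v) := by
      rw [mul_comm, hn, add_comm]
      exact Lo_mul hv' (Lo_homog (XT_homog T))
    rw [Lo_comp this, add_zero]
  rw [← key]
  rw [← sum_homogeneousComponent (CT T n * monomial b 1), map_sum, map_sum]
  refine Submodule.sum_mem _ fun i _ => ?_
  have hi := homogeneousComponent_isHomogeneous i (CT T n * monomial b (1 : ZMod 2))
  rcases lt_trichotomy i n with h | h | h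
  · have := hG_homog (sqTot 5) (D := i) (k := n - i) (by omega) hi
    rwa [show i + (n - i) = n by omega] at this
  · have : homogeneousComponent i (CT T n * monomial b (1 : ZMod 2)) = 0 := by
      ext e
      rw [coeff_homogeneousComponent, coeff_zero]
      split_ifs with he
      · rw [coeff_mul]
        refine Finset.sum_eq_zero fun x hx => ?_
        have hs : x.1.degree + x.2.degree = e.degree := by
          rw [← map_add, Finset.HasAntidiagonal.mem_antidiagonal.1 hx]
        by_contra hne
        have h1 := CT_supp T n x.1 (left_ne_zero_of_mul hne)
        have h2 : x.2.degree = b.degree := by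
          by_contra h
          exact (right_ne_zero_of_mul hne) (hy.coeff_eq_zero h)
        apply hps
        rwa [show T.card + b.degree = x.1.degree by omega]
      · rfl
    rw [this, map_zero, map_zero]
    exact zero_mem _
  · rw [sq_low hi h]
    exact zero_mem _

theorem pow_mod15 (a : ℕ) : 2 ^ a % 15 = 1 ∨ 2 ^ a % 15 = 2 ∨ 2 ^ a % 15 = 4 ∨ 2 ^ a % 15 = 8 := by
  induction a with
  | zero => simp
  | succ a ih => rw [pow_succ]; omega

theorem nt1 (s m : ℕ) (h : 1 + 2 * m = 15 * 2 ^ (s + 2) - 5) : ¬ PS 1 (1 + m) := by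
  rintro ⟨a, k', h1, rfl⟩
  have := pow_mod15 a
  have h2 : 1 ≤ 2 ^ s := Nat.one_le_two_pow
  rw [pow_add] at h
  omega

theorem pow_par (a : ℕ) : 2 ^ a = 1 ∨ ∃ b, 2 ^ a = 2 * 2 ^ b := by
  cases a with
  | zero => left; rfl
  | succ a => right; exact ⟨a, pow_succ' 2 a⟩

theorem nt3 (s m : ℕ) (h : 3 + 2 * m = 15 * 2 ^ (s + 2) - 5) : ¬ PS 3 (3 + m) := by
  rintro ⟨a, k', h1, b, k'', h2, c, k, h3, rfl⟩
  have h4 : 1 ≤ 2 ^ s := Nat.one_le_two_pow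
  rw [pow_add] at h
  rcases pow_par a with ha | ⟨a', ha⟩ <;> rcases pow_par b with hb | ⟨b', hb⟩ <;>
    rcases pow_par c with hc | ⟨c', hc⟩
  · omega
  · omega
  · omega
  · have := pow_mod15 b'
    have := pow_mod15 c'
    omega
  · omega
  · have := pow_mod15 a'
    have := pow_mod15 c'
    omega
  · have := pow_mod15 a'
    have := pow_mod15 b'
    omega
  · omega

theorem hitB (s : ℕ) {f : P 5} (hf : f.IsHomogeneous (15 * 2 ^ (s + 2) - 5)) :
    f + XT Finset.univ * (psi f) ^ 2 ∈ hG (sqTot 5) := by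
  have hadd : ∀ p q : P 5, (p + q) + XT Finset.univ * (psi (p + q)) ^ 2 =
      (p + XT Finset.univ * (psi p) ^ 2) + (q + XT Finset.univ * (psi q) ^ 2) := by
    intro p q
    rw [map_add, sq_add2]
    ring
  have hsum : ∀ (S : Finset (Fin 5 →₀ ℕ)) (g : (Fin 5 →₀ ℕ) → P 5),
      (∀ a ∈ S, g a + XT Finset.univ * (psi (g a)) ^ 2 ∈ hG (sqTot 5)) →
      (∑ a ∈ S, g a) + XT Finset.univ * (psi (∑ a ∈ S, g a)) ^ 2 ∈ hG (sqTot 5) := by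
    intro S g
    induction S using Finset.induction_on with
    | empty => intro _; simp
    | insert a S ha ih =>
      intro h
      rw [Finset.sum_insert ha, hadd]
      exact add_mem (h a (Finset.mem_insert_self _ _))
        (ih fun b hb => h b (Finset.mem_insert_of_mem hb))
  rw [f.as_sum]
  refine hsum _ _ fun a ha => ?_
  have hd : a.degree = 15 * 2 ^ (s + 2) - 5 := by
    have := hf (mem_support_iff.1 ha)
    rw [Finsupp.degree_eq_weight_one]
    exact this
  rw [mon_smul2, map_smul, smul_sq2, mul_smul_comm, ← smul_add]
  refine Submodule.smul_mem _ _ ?_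
  rw [mon_decomp, psi_mul_sq, psi_XT]
  have hdd := decomp_deg a
  by_cases hT : oddT a = Finset.univ
  · rw [if_pos hT, one_mul, hT, p2_add_self]
    exact zero_mem _
  · rw [if_neg hT, zero_mul, zero_pow two_ne_zero, mul_zero, add_zero]
    apply hitA
    have hc : (oddT a).card ≤ 5 := by simpa using Finset.card_le_univ (oddT a)
    have hc5 : (oddT a).card ≠ 5 := by
      intro h
      exact hT (Finset.eq_univ_of_card _ (by simpa using h))
    have h4 : 1 ≤ 2 ^ s := Nat.one_le_two_pow
    have hpw : 2 ^ (s + 2) = 4 * 2 ^ s := by rw [pow_add]; ring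
    have : (oddT a).card = 1 ∨ (oddT a).card = 3 := by omega
    rcases this with h | h
    · rw [h] at hdd ⊢
      exact nt1 s _ (by omega)
    · rw [h] at hdd ⊢
      exact nt3 s _ (by omega)

theorem hitE (s m : ℕ) (hm : 2 * m + 5 = 15 * 2 ^ (s + 2) - 5) {y : P 5}
    (hy : y ∈ hG (sqTot 5)) :
    XT Finset.univ * (homogeneousComponent m y) ^ 2 ∈ hG (sqTot 5) := by
  induction hy using Submodule.span_induction with
  | zero => simp
  | add x y _ _ hx hy => rw [map_add, sq_add2, mul_add]; exact add_mem hx hy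
  | smul c x _ hx =>
    rw [map_smul, smul_sq2, mul_smul_comm]; exact Submodule.smul_mem _ _ hx
  | mem x hx =>
    obtain ⟨a, k, hk, rfl⟩ := hx
    rw [homogeneousComponent_of_mem (homogeneousComponent_isHomogeneous _ _)]
    split_ifs with h
    · have hh : (XT Finset.univ * (monomial a (1 : ZMod 2)) ^ 2).IsHomogeneous
          (5 + a.degree * 2) := by
        have h1 : (monomial a (1 : ZMod 2)).IsHomogeneous a.degree := isHomogeneous_monomial 1 rfl
        simpa using (XT_homog Finset.univ).mul (h1.pow 2)
      have h1 := hG_homog (sqTot 5) (k := 2 * k) (by omega) hh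
      have h2 := hitB s (f := homogeneousComponent (5 + a.degree * 2 + 2 * k)
        (sqTot 5 (XT Finset.univ * (monomial a (1 : ZMod 2)) ^ 2))) (by
          rw [← hm, show 2 * m + 5 = 5 + a.degree * 2 + 2 * k by omega]
          exact homogeneousComponent_isHomogeneous _ _)
      rw [psi_homComp _ (a.degree + k) (by omega), psi_sq, psi_mul_sq, psi_XT, if_pos rfl,
        one_mul] at h2
      exact (Submodule.add_mem_iff_right _ h1).1 h2
    · simp

end kameko2

/-- For every non-negative integer `s`, every homogeneous polynomial
`f ∈ P_5` of degree `15·2^s − 5` such that `g·f + f` is hit for every `g ∈ GL_5`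
is itself hit. -/
theorem statement1 (s : ℕ) (f : P 5)
    (hf : f ∈ homogeneousSubmodule (Fin 5) (ZMod 2) (15 * 2 ^ s - 5))
    (hinv : ∀ g : Matrix.GeneralLinearGroup (Fin 5) (ZMod 2),
      glAct (↑g) f + f ∈ hitS 5) :
    f ∈ hitS 5 := by
  rw [mem_homogeneousSubmodule] at hf
  induction s using Nat.twoStepInduction generalizing f with
  | zero => exact base10 f hf hinv
  | one => exact base25 f hf hinv
  | more s _ ih =>
    have h4 : 1 ≤ 2 ^ s := Nat.one_le_two_pow
    have e1 : 2 ^ (s + 1) = 2 * 2 ^ s := by rw [pow_succ]; ring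
    have e2 : 2 ^ (s + 2) = 4 * 2 ^ s := by rw [pow_add]; ring
    have hdeg : 15 * 2 ^ (s + 2) - 5 = 2 * (15 * 2 ^ (s + 1) - 5) + 5 := by omega
    have hp : (psi f).IsHomogeneous (15 * 2 ^ (s + 1) - 5) := psi_homog _ _ hdeg hf
    have hh : psi f ∈ hitS 5 := by
      refine ih (psi f) hp ?_
      intro g
      have := hinv g
      rw [glAct_eq, hitS_eq] at this ⊢
      have := psi_hit this
      rwa [map_add, psi_gl] at this
    rw [hitS_eq] at hh ⊢
    have hE := hitE s _ hdeg.symm hh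
    rw [homComp_self hp] at hE
    exact (Submodule.add_mem_iff_left _ hE).1 (hitB s hf)
end
end

section
/- Every monomial of degree 25 in P_5 whose weight vector equals (3,3,4) (i.e., ω_1 = 3, ω_2 = 3, ω_3 = 4 and ω_i = 0 for i > 3) lies in A^+P_5 + P_5^−((3,3,4)). Consequently QP_5(3,3,4) := P_5((3,3,4))/((A^+P_5 ∩ P_5((3,3,4))) + P_5^−((3,3,4))) = 0. -/
open MvPolynomial

noncomputable section

def mon5 (v : Fin 5 → ℕ) : P 5 := monomial (ev v) 1

def lowB (t : Fin 5 → ℕ) : Bool :=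
  decide ((∑ j, t j / 2 ^ 0 % 2 < 3) ∨ (∑ j, t j / 2 ^ 0 % 2 = 3 ∧ ∑ j, t j / 2 ^ 1 % 2 < 3) ∨
    (∑ j, t j / 2 ^ 0 % 2 = 3 ∧ ∑ j, t j / 2 ^ 1 % 2 = 3 ∧ ∑ j, t j / 2 ^ 2 % 2 < 4))

def Kset (j : ℕ) : Finset (Fin 5 → ℕ) :=
  (Fintype.piFinset fun _ : Fin 5 => Finset.range (j + 1)).filter fun k => ∑ i, k i = j

def Sset (j : ℕ) (v : Fin 5 → ℕ) : Finset (Fin 5 → ℕ) :=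
  (Kset j).filter fun k => (∏ i, (v i).choose (k i)) % 2 = 1 ∧ lowB (v + k) = false

lemma mon5_eq (v : Fin 5 → ℕ) : mon5 v = ∏ i, X i ^ v i := by
  rw [mon5, monomial_eq]
  simp only [map_one, one_mul]
  rw [Finsupp.prod_fintype _ _ (by simp)]
  rfl

lemma sqTot_mon5 (v : Fin 5 → ℕ) (N : ℕ) (hN : ∀ i, v i ≤ N) :
    sqTot 5 (mon5 v) = ∑ k ∈ Fintype.piFinset fun _ : Fin 5 => Finset.range (N + 1),
      ((∏ i, (v i).choose (k i) : ℕ) : ZMod 2) • mon5 (v + k) := by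
  rw [mon5_eq, map_prod]
  have h : ∀ i, sqTot 5 (X i ^ v i) =
      ∑ k ∈ Finset.range (N + 1), (((v i).choose k : ℕ) : ZMod 2) • (X i ^ (v i + k) : P 5) := by
    intro i
    have h1 : sqTot 5 (X i ^ v i) = X i ^ v i * (X i + 1) ^ v i := by
      rw [map_pow, sqTot, bind₁_X_right, ← mul_pow]; congr 1; ring
    rw [h1, add_pow, Finset.mul_sum]
    rw [← Finset.sum_subset (Finset.range_mono (Nat.add_le_add_right (hN i) 1))]
    · refine Finset.sum_congr rfl fun k _ => ?_
      rw [one_pow, mul_one, pow_add, MvPolynomial.smul_eq_C_mul, map_natCast]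
      ring
    · intro k _ hk
      rw [Nat.choose_eq_zero_of_lt (by simpa using hk)]
      simp
  simp_rw [h]
  rw [Finset.prod_univ_sum]
  refine Finset.sum_congr rfl fun k _ => ?_
  rw [mon5_eq, Finset.prod_smul]
  push_cast
  rfl

lemma mon5_hom (v : Fin 5 → ℕ) : (mon5 v).IsHomogeneous (∑ i, v i) := by
  apply isHomogeneous_monomial
  rw [Finsupp.degree_eq_sum]
  rfl

lemma hc_mon5 (v : Fin 5 → ℕ) (d : ℕ) :
    homogeneousComponent d (mon5 v) = if ∑ i, v i = d then mon5 v else 0 := by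
  rw [homogeneousComponent_of_mem (mon5_hom v)]
  simp only [eq_comm]

lemma SqK_mon5 (v : Fin 5 → ℕ) (j : ℕ) :
    SqK 5 j (mon5 v) = ∑ k ∈ Kset j,
      ((∏ i, (v i).choose (k i) : ℕ) : ZMod 2) • mon5 (v + k) := by
  have ht : (mon5 v).totalDegree = ∑ i, v i :=
    (mon5_hom v).totalDegree (by simp [mon5])
  rw [SqK, Finset.sum_eq_single (∑ i, v i)]
  · rw [hc_mon5, if_pos rfl,
      sqTot_mon5 v (∑ i, v i + j) fun i =>
        (Finset.single_le_sum (f := v) (fun _ _ => Nat.zero_le _) (Finset.mem_univ i)).trans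
          (Nat.le_add_right _ _), map_sum]
    simp_rw [map_smul, hc_mon5]
    have e : ∀ k : Fin 5 → ℕ, (∑ i, (v + k) i = ∑ i, v i + j) ↔ ∑ i, k i = j := by
      intro k
      simp only [Pi.add_apply, Finset.sum_add_distrib]
      omega
    simp_rw [e, smul_ite, smul_zero]
    rw [← Finset.sum_filter]
    refine Finset.sum_congr ?_ fun _ _ => rfl
    ext k
    simp only [Kset, Finset.mem_filter, Fintype.mem_piFinset, Finset.mem_range]
    refine and_congr_left fun hk => ⟨fun _ i => ?_, fun h i => ?_⟩
    · have := Finset.single_le_sum (f := k) (fun _ _ => Nat.zero_le _) (Finset.mem_univ i)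
      omega
    · have := h i
      omega
  · intro d _ hd
    rw [hc_mon5, if_neg (Ne.symm hd)]
    simp
  · intro h
    exact absurd (Finset.mem_range.2 (by omega)) h

abbrev MM : Submodule (ZMod 2) (P 5) := hitS 5 ⊔ PnLt 5 25 w334

lemma low_mem (t : Fin 5 → ℕ) (hd : ∑ i, t i = 25) (h : lowB t = true) : mon5 t ∈ MM := by
  refine Submodule.mem_sup_right (Submodule.subset_span ⟨ev t, hd, ?_, rfl⟩)
  simp only [lowB, decide_eq_true_eq] at h
  rcases h with h | ⟨h0, h⟩ | ⟨h0, h1, h⟩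
  · exact ⟨0, fun j hj => absurd hj (by omega), h⟩
  · refine ⟨1, fun j hj => ?_, h⟩
    obtain rfl : j = 0 := by omega
    exact h0
  · refine ⟨2, fun j hj => ?_, h⟩
    obtain rfl | rfl : j = 0 ∨ j = 1 := by omega
    · exact h0
    · exact h1

lemma Sset_comp (j : ℕ) (v : Fin 5 → ℕ) (hj : 1 ≤ j) (hd : ∑ i, v i + j = 25) :
    ∑ k ∈ Sset j v, mon5 (v + k) ∈ MM := by
  have h1 : SqK 5 j (mon5 v) ∈ MM :=
    Submodule.mem_sup_left (Submodule.subset_span ⟨j, hj, _, rfl⟩)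
  rw [SqK_mon5, ← Finset.sum_filter_add_sum_filter_not (Kset j)
    (fun k => (∏ i, (v i).choose (k i)) % 2 = 1 ∧ lowB (v + k) = false)] at h1
  have h2 := (Submodule.add_mem_iff_left MM (Submodule.sum_mem MM ?_)).1 h1
  · convert h2 using 1
    refine Finset.sum_congr rfl fun k hk => ?_
    have := (Finset.mem_filter.1 hk).2.1
    rw [(ZMod.natCast_eq_one_iff_odd).2 (Nat.odd_iff.2 this), one_smul]
  · intro k hk
    obtain ⟨hk, hn⟩ := Finset.mem_filter.1 hk
    by_cases hp : (∏ i, (v i).choose (k i)) % 2 = 1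
    · apply Submodule.smul_mem
      apply low_mem
      · have := (Finset.mem_filter.1 hk).2
        simp only [Pi.add_apply, Finset.sum_add_distrib]
        omega
      · by_contra hl
        exact hn ⟨hp, by simpa using hl⟩
    · rw [(ZMod.natCast_eq_zero_iff_even).2 (Nat.even_iff.2 (by omega)), zero_smul]
      exact Submodule.zero_mem _

/-- Coordinate permutation of the relation attached to `Sq^j` of a monomial. -/
lemma sset_perm (j : ℕ) (v : Fin 5 → ℕ) (σ : Equiv.Perm (Fin 5)) (k : Fin 5 → ℕ) :
    k ∘ σ ∈ Sset j (v ∘ σ) ↔ k ∈ Sset j v := by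
  have hs : ∀ f : Fin 5 → ℕ, ∑ i, f (σ i) = ∑ i, f i := fun f => Equiv.sum_comp σ f
  have e1 : (∏ i, (v (σ i)).choose (k (σ i))) = ∏ i, (v i).choose (k i) :=
    Equiv.prod_comp σ fun i => (v i).choose (k i)
  have e2 : lowB (v ∘ σ + k ∘ σ) = lowB (v + k) := by
    simp only [lowB, Pi.add_apply, Function.comp_apply]
    rw [hs fun i => (v i + k i) / 2 ^ 0 % 2, hs fun i => (v i + k i) / 2 ^ 1 % 2,
      hs fun i => (v i + k i) / 2 ^ 2 % 2]
  simp only [Sset, Kset, Finset.mem_filter, Fintype.mem_piFinset, e1, e2, Function.comp_apply,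
    hs k]
  rw [σ.forall_congr_left.symm.symm]
  simp

lemma rel (j : ℕ) (v : Fin 5 → ℕ) (L : List (Fin 5 → ℕ))
    (h : 1 ≤ j ∧ ∑ i, v i + j = 25 ∧ L.Nodup ∧ (Sset j v).image (v + ·) = L.toFinset)
    (σ : Equiv.Perm (Fin 5)) : (L.map fun t => mon5 (t ∘ σ)).sum ∈ MM := by
  obtain ⟨hj, hd, hn, hL⟩ := h
  have := Sset_comp j (v ∘ σ) hj (by rw [← hd, ← Equiv.sum_comp σ v]; rfl)
  rw [← List.sum_toFinset _ hn, ← hL, Finset.sum_image (fun a _ b _ hab => add_left_cancel hab)]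
  convert this using 1
  refine Finset.sum_bij (fun k _ => k ∘ σ) (fun k hk => (sset_perm j v σ k).2 hk)
    (fun a _ b _ hab => σ.surjective.injective_comp_right hab) (fun k hk => ?_)
    (fun k _ => rfl)
  refine ⟨k ∘ σ.symm, ?_, ?_⟩
  · rw [← sset_perm j v σ]
    simpa [Function.comp_assoc] using hk
  · simp [Function.comp_assoc]

lemma o1 (σ : Equiv.Perm (Fin 5)) : mon5 (![7,7,7,4,0] ∘ σ) ∈ MM := by
  simpa using rel 1 ![7,7,7,3,0] [![7,7,7,4,0]] (by decide +kernel) σ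

lemma o2 (σ : Equiv.Perm (Fin 5)) : mon5 (![7,7,6,5,0] ∘ σ) ∈ MM := by
  simpa using rel 2 ![7,7,6,3,0] [![7,7,6,5,0]] (by decide +kernel) σ

lemma o3 (σ : Equiv.Perm (Fin 5)) : mon5 (![7,7,6,4,1] ∘ σ) ∈ MM := by
  simpa using rel 2 ![7,7,6,2,1] [![7,7,6,4,1]] (by decide +kernel) σ

lemma o4 (σ : Equiv.Perm (Fin 5)) : mon5 (![7,6,6,5,1] ∘ σ) ∈ MM := by
  simpa using rel 2 ![7,6,6,3,1] [![7,6,6,5,1]] (by decide +kernel) σ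

lemma perm_of (u w : Fin 5 → ℕ) (τ σ : Equiv.Perm (Fin 5)) (h : u = w ∘ τ)
    (hw : ∀ σ : Equiv.Perm (Fin 5), mon5 (w ∘ σ) ∈ MM) : mon5 (u ∘ σ) ∈ MM := by
  have := hw (σ.trans τ)
  rw [h]
  exact this

lemma o5 (σ : Equiv.Perm (Fin 5)) : mon5 (![7,7,5,4,2] ∘ σ) ∈ MM := by
  have h := rel 1 ![7,7,5,4,1] [![7,7,5,4,2], ![7,7,6,4,1]] (by decide +kernel) σ
  simp only [List.map_cons, List.map_nil, List.sum_cons, List.sum_nil, add_zero] at h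
  exact (Submodule.add_mem_iff_left _ (o3 σ)).1 h

lemma o6 (σ : Equiv.Perm (Fin 5)) : mon5 (![7,6,5,5,2] ∘ σ) ∈ MM := by
  have h := rel 1 ![7,6,5,5,1] [![7,6,5,5,2], ![7,6,5,6,1], ![7,6,6,5,1]] (by decide +kernel) σ
  simp only [List.map_cons, List.map_nil, List.sum_cons, List.sum_nil, add_zero] at h
  refine (Submodule.add_mem_iff_left _ (Submodule.add_mem _ ?_ (o4 σ))).1 h
  exact perm_of _ _ (Equiv.swap 2 3) σ (by decide) o4

lemma o7 (σ : Equiv.Perm (Fin 5)) : mon5 (![7,7,4,4,3] ∘ σ) ∈ MM := by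
  have h := rel 2 ![7,7,2,4,3] [![7,7,4,4,3], ![7,7,2,4,5]] (by decide +kernel) σ
  simp only [List.map_cons, List.map_nil, List.sum_cons, List.sum_nil, add_zero] at h
  refine (Submodule.add_mem_iff_left _ ?_).1 h
  exact perm_of _ _ (Equiv.swap 2 4) σ (by decide) o5

lemma o8 (σ : Equiv.Perm (Fin 5)) : mon5 (![7,6,5,4,3] ∘ σ) ∈ MM := by
  have h := rel 2 ![7,6,5,2,3] [![7,6,5,4,3], ![7,6,5,2,5]] (by decide +kernel) σ
  simp only [List.map_cons, List.map_nil, List.sum_cons, List.sum_nil, add_zero] at h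
  refine (Submodule.add_mem_iff_left _ ?_).1 h
  exact perm_of _ _ (Equiv.swap 3 4) σ (by decide) o6

lemma two_z (x : P 5) : x + x = 0 := CharTwo.add_self_eq_zero x

lemma o9 (σ : Equiv.Perm (Fin 5)) : mon5 (![6,6,5,5,3] ∘ σ) ∈ MM := by
  -- triple relations, the exponent 6 at the first place being kept
  have h1 := rel 1 ![6,5,5,5,3] [![6,6,5,5,3], ![6,5,6,5,3], ![6,5,5,6,3]] (by decide +kernel) σ
  have h2 := rel 1 ![6,5,5,3,5] [![6,6,5,3,5], ![6,5,6,3,5], ![6,5,5,3,6]] (by decide +kernel) σ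
  have h3 := rel 1 ![6,5,3,5,5] [![6,6,3,5,5], ![6,5,3,6,5], ![6,5,3,5,6]] (by decide +kernel) σ
  -- transport of the exponent 3 against a 5
  have a1 := rel 2 ![6,6,5,3,3] [![6,6,5,5,3], ![6,6,5,3,5]] (by decide +kernel) σ
  have a2 := rel 2 ![6,6,3,5,3] [![6,6,5,5,3], ![6,6,3,5,5]] (by decide +kernel) σ
  have b1 := rel 2 ![6,5,6,3,3] [![6,5,6,5,3], ![6,5,6,3,5]] (by decide +kernel) σ
  have c1 := rel 2 ![6,5,3,6,3] [![6,5,5,6,3], ![6,5,3,6,5]] (by decide +kernel) σ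
  have d1 := rel 2 ![6,5,3,3,6] [![6,5,5,3,6], ![6,5,3,5,6]] (by decide +kernel) σ
  simp only [List.map_cons, List.map_nil, List.sum_cons, List.sum_nil, add_zero]
    at h1 h2 h3 a1 a2 b1 c1 d1
  have := MM.add_mem (MM.add_mem (MM.add_mem h1 h2) (MM.add_mem h3 a1))
    (MM.add_mem (MM.add_mem a2 b1) (MM.add_mem c1 d1))
  convert this using 1
  generalize mon5 (![6,6,5,5,3] ∘ σ) = p1
  generalize mon5 (![6,5,6,5,3] ∘ σ) = p2
  generalize mon5 (![6,5,5,6,3] ∘ σ) = p3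
  generalize mon5 (![6,6,5,3,5] ∘ σ) = p4
  generalize mon5 (![6,5,6,3,5] ∘ σ) = p5
  generalize mon5 (![6,5,5,3,6] ∘ σ) = p6
  generalize mon5 (![6,6,3,5,5] ∘ σ) = p7
  generalize mon5 (![6,5,3,6,5] ∘ σ) = p8
  generalize mon5 (![6,5,3,5,6] ∘ σ) = p9
  linear_combination - two_z p1 - two_z p2 - two_z p3 - two_z p4 - two_z p5 - two_z p6 - two_z p7
    - two_z p8 - two_z p9

def wB (t : Fin 5 → ℕ) (i : ℕ) : ℕ := ∑ j, t j / 2 ^ i % 2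

lemma sorted_cases : ∀ x0 x1 x2 x3 x4 : Fin 8, x0 ≤ x1 → x1 ≤ x2 → x2 ≤ x3 → x3 ≤ x4 →
    wB ![x0.1, x1, x2, x3, x4] 0 = 3 → wB ![x0.1, x1, x2, x3, x4] 1 = 3 →
    wB ![x0.1, x1, x2, x3, x4] 2 = 4 →
    [x0.1, x1, x2, x3, x4] ∈ [[0,4,7,7,7], [0,5,6,7,7], [1,4,6,7,7], [1,5,6,6,7], [2,4,5,7,7],
      [2,5,5,6,7], [3,4,4,7,7], [3,4,5,6,7], [3,5,5,6,6]] := by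
  decide +kernel

/-- Every monomial of degree 25 in `P_5` whose weight vector equals
`(3,3,4)` lies in `A^+P_5 + P_5^−((3,3,4))`. -/
theorem statement2 (a : Fin 5 →₀ ℕ) (hdeg : mdeg a = 25) (hw : wt a = w334) :
    (monomial a 1 : P 5) ∈ hitS 5 ⊔ PnLt 5 25 w334 := by
  have hb : ∀ i, a i < 8 := by
    intro i
    have h1 : a i ≤ 25 := hdeg ▸
      Finset.single_le_sum (f := fun j => a j) (fun _ _ => Nat.zero_le _) (Finset.mem_univ i)
    have h3 : ∀ n, 3 ≤ n → a i / 2 ^ n % 2 = 0 := by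
      intro n hn
      have : wt a n = 0 := by
        rw [hw, w334]
        rw [if_neg (by omega), if_neg (by omega), if_neg (by omega)]
      exact (Finset.sum_eq_zero_iff.1 this) i (Finset.mem_univ i)
    have h4 := h3 3 (by omega)
    have h5 := h3 4 (by omega)
    norm_num at h4 h5
    omega
  let τ := Tuple.sort (fun i => a i)
  let b : Fin 5 → ℕ := fun i => a (τ i)
  have hm : Monotone b := Tuple.monotone_sort (fun i => a i)
  have hwb : ∀ n, wB b n = w334 n := fun n => by
    rw [← hw]
    exact Equiv.sum_comp τ fun i => a i / 2 ^ n % 2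
  have hbe : b = ![b 0, b 1, b 2, b 3, b 4] := by
    ext i
    fin_cases i <;> rfl
  have hbl : ∀ i, b i < 8 := fun i => hb _
  have key := sorted_cases ⟨b 0, hbl 0⟩ ⟨b 1, hbl 1⟩ ⟨b 2, hbl 2⟩ ⟨b 3, hbl 3⟩ ⟨b 4, hbl 4⟩
    (hm (by decide)) (hm (by decide)) (hm (by decide)) (hm (by decide))
    (by rw [← hbe]; exact hwb 0) (by rw [← hbe]; exact hwb 1) (by rw [← hbe]; exact hwb 2)
  have ha : (monomial a 1 : P 5) = mon5 (b ∘ τ.symm) := by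
    unfold mon5
    have : a = ev (b ∘ τ.symm) := by
      ext i
      simp [ev, b]
    rw [← this]
  rw [ha]
  have rv : ∀ u w : Fin 5 → ℕ, u = w ∘ Fin.revPerm →
      (∀ σ : Equiv.Perm (Fin 5), mon5 (w ∘ σ) ∈ MM) → mon5 (u ∘ τ.symm) ∈ MM :=
    fun u w h hw => perm_of u w _ _ h hw
  rw [hbe]
  simp only [List.mem_cons, List.not_mem_nil, or_false, List.cons.injEq, and_true] at key
  rcases key with h | h | h | h | h | h | h | h | h <;> obtain ⟨h0, h1, h2, h3, h4⟩ := h <;>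
    rw [h0, h1, h2, h3, h4]
  · exact rv _ _ (by decide) o1
  · exact rv _ _ (by decide) o2
  · exact rv _ _ (by decide) o3
  · exact rv _ _ (by decide) o4
  · exact rv _ _ (by decide) o5
  · exact rv _ _ (by decide) o6
  · exact rv _ _ (by decide) o7
  · exact rv _ _ (by decide) o8
  · exact rv _ _ (by decide) o9
end
end
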